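/- arXiv:1111.2801 — 2 statements merged into one kernel-verified Lean document; each statement's English description precedes it below -/
import Mathlib

section
/- Let Ω ⊂ ℝⁿ be a smooth bounded domain with n ≥ 2, let p > 1 and r ∈ [1,∞), assume n > p(1+r), and define p*_r by 1/p*_r = 1/p − (1+r)/n and p' := p/(p−1). Then there exists a constant A > 0 depending only on n, p, and r such that for every v ∈ C^∞ on the closure of Ω with v = 0 on ∂Ω, setting I_p := ( ∫_{Ω ∩ {|∇v|>0}} |H_v|^{pr} |∇v|^p dx )^{1/p} and V(s) := |{x ∈ Ω : |v(x)| > s}|, if I_p > 0 then for almost every s ∈ (0, ‖v‖_{L^∞(Ω)}) one has V(s) ≤ |Ω| · ( (p'/p*_r) ( |Ω|^{1/p*_r} / (A I_p) )^{p'} s^{p'} + 1 )^{−p*_r/p'}. -/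
open MeasureTheory Filter Bornology
open scoped ENNReal Topology

/-- Divergence of a vector field on `ℝⁿ = EuclideanSpace ℝ (Fin n)`. -/
noncomputable def divg {n : ℕ} (V : EuclideanSpace ℝ (Fin n) → EuclideanSpace ℝ (Fin n))
    (x : EuclideanSpace ℝ (Fin n)) : ℝ :=
  ∑ i, fderiv ℝ V x (EuclideanSpace.single i 1) i

/-- `H_v(x) = -(1/(n-1)) div(∇v/|∇v|)(x)`, the mean curvature of the level set of `|v|`
through `x` (at points where `∇v(x) ≠ 0`). -/
noncomputable def meanCurv {n : ℕ} (v : EuclideanSpace ℝ (Fin n) → ℝ)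
    (x : EuclideanSpace ℝ (Fin n)) : ℝ :=
  -(1 / ((n : ℝ) - 1)) * divg (fun y => ‖gradient v y‖⁻¹ • gradient v y) x

theorem measure_setOf_measure_sublevel_le {α : Type*} [MeasurableSpace α] (μ : Measure α)
    [IsFiniteMeasure μ] {f : α → ℝ} (hf : Measurable f) (s : ℝ≥0∞) :
    μ {x | μ {y | f y ≤ f x} ≤ s} ≤ s := by
  let F : ℝ → ℝ≥0∞ := fun t => μ {y | f y ≤ t}
  have hF : Monotone F := fun a b hab => measure_mono fun y hy => le_trans hy hab
  have hL : MeasurableSet {t | F t ≤ s} := hF.measurable measurableSet_Iic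
  have h1 : μ {x | μ {y | f y ≤ f x} ≤ s} = (μ.map f) {t | F t ≤ s} := by
    rw [Measure.map_apply hf hL]; rfl
  rw [h1, hL.measure_eq_iSup_isCompact]
  refine iSup₂_le fun K hK => iSup_le fun hKc => ?_
  rcases K.eq_empty_or_nonempty with rfl | hne
  · simp
  obtain ⟨q, hqK, hq⟩ := hKc.exists_isGreatest hne
  refine (measure_mono (show K ⊆ Set.Iic q from hq)).trans ?_
  rw [Measure.map_apply hf measurableSet_Iic]
  exact hK hqK

theorem lintegral_rpow_neg_measure_sublevel_le {α : Type*} [MeasurableSpace α] (μ : Measure α)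
    [IsFiniteMeasure μ] {f : α → ℝ} (hf : Measurable f) {a : ℝ} (ha0 : 0 ≤ a) :
    ∫⁻ x, (μ {y | f y ≤ f x}) ^ (-a) ∂μ ≤
      2 ^ a * (1 - 2 ^ (a - 1))⁻¹ * (μ Set.univ) ^ (1 - a) := by
  set m : α → ℝ≥0∞ := fun x => μ {y | f y ≤ f x} with hm
  set M := μ Set.univ with hM
  have hMt : M ≠ ⊤ := measure_ne_top _ _
  rcases eq_or_ne M 0 with h0 | h0
  · have : μ = 0 := Measure.measure_univ_eq_zero.1 h0
    simp [this]
  have hmono : Monotone (fun t : ℝ => μ {y | f y ≤ t}) :=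
    fun a b hab => measure_mono fun y hy => le_trans hy hab
  have hmeas : Measurable m := hmono.measurable.comp hf
  have hpos : ∀ᵐ x ∂μ, 0 < m x := by
    have := measure_setOf_measure_sublevel_le μ hf 0
    rw [ae_iff]
    simpa using this
  let b : ℕ → ℝ≥0∞ := fun j => M * (2⁻¹) ^ j
  have hpt : ∀ᵐ x ∂μ, (m x) ^ (-a) ≤
      ∑' j, {x | m x ≤ b j}.indicator (fun _ => (b (j + 1)) ^ (-a)) x := by
    filter_upwards [hpos] with x hx
    have hmM : m x ≤ M := measure_mono (Set.subset_univ _)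
    have hlim : Tendsto b atTop (𝓝 0) := by
      have : Tendsto (fun j : ℕ => (2⁻¹ : ℝ≥0∞) ^ j) atTop (𝓝 0) :=
        ENNReal.tendsto_pow_atTop_nhds_zero_of_lt_one (by simp)
      simpa using ENNReal.Tendsto.const_mul this (Or.inr hMt)
    have hex : ∃ j, b j < m x := (hlim.eventually_lt_const hx).exists
    classical
    have hj := Nat.find_spec hex
    set j := Nat.find hex with hjdef
    have hj0 : j ≠ 0 := by
      intro h
      rw [h] at hj
      exact absurd hj (not_lt.2 (by simpa [b] using hmM))
    obtain ⟨i, hi⟩ := Nat.exists_eq_succ_of_ne_zero hj0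
    have hi' : m x ≤ b i := not_lt.1 (Nat.find_min hex (by omega))
    refine le_trans ?_ (ENNReal.le_tsum i)
    rw [Set.indicator_of_mem (by exact hi')]
    rw [ENNReal.rpow_neg, ENNReal.rpow_neg]
    refine ENNReal.inv_le_inv.2 (ENNReal.rpow_le_rpow ?_ ha0)
    rw [hi] at hj
    exact hj.le
  calc ∫⁻ x, (m x) ^ (-a) ∂μ
      ≤ ∫⁻ x, ∑' j, {x | m x ≤ b j}.indicator (fun _ => (b (j + 1)) ^ (-a)) x ∂μ :=
        lintegral_mono_ae hpt
    _ = ∑' j, ∫⁻ x, {x | m x ≤ b j}.indicator (fun _ => (b (j + 1)) ^ (-a)) x ∂μ := by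
        refine lintegral_tsum fun j => ?_
        exact (measurable_const.indicator (hmeas measurableSet_Iic)).aemeasurable
    _ ≤ ∑' j, 2 ^ a * M ^ (1 - a) * (2 ^ (a - 1)) ^ j := by
        refine ENNReal.tsum_le_tsum fun j => ?_
        have hms : MeasurableSet {x | m x ≤ b j} := hmeas measurableSet_Iic
        rw [lintegral_indicator_const hms]
        refine (mul_le_mul_right (measure_setOf_measure_sublevel_le μ hf (b j)) _).trans
          (le_of_eq ?_)
        have hb0 : b j ≠ 0 := mul_ne_zero h0 (by simp)
        have hbt : b j ≠ ⊤ := ENNReal.mul_ne_top hMt (by simp)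
        have e1 : b (j + 1) = b j * 2⁻¹ := by simp only [b, pow_succ]; ring
        rw [e1, ENNReal.mul_rpow_of_ne_top hbt (by simp), ENNReal.inv_rpow, ← ENNReal.rpow_neg,
          neg_neg]
        have e2 : b j ^ (-a) * 2 ^ a * b j = 2 ^ a * b j ^ (1 - a) := by
          nth_rewrite 2 [← ENNReal.rpow_one (b j)]
          rw [show 1 - a = -a + 1 by ring, ENNReal.rpow_add _ _ hb0 hbt]; ring
        rw [e2]
        simp only [b]
        rw [ENNReal.mul_rpow_of_ne_top hMt (by simp), ← mul_assoc]
        congr 1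
        rw [← ENNReal.rpow_natCast, ← ENNReal.rpow_natCast, ENNReal.inv_rpow, ENNReal.inv_rpow,
          ← ENNReal.rpow_neg, ← ENNReal.rpow_mul, ← ENNReal.rpow_mul]
        congr 1; ring
    _ = _ := by
        rw [ENNReal.tsum_mul_left, ENNReal.tsum_geometric]; ring

theorem one_sub_two_rpow_inv_ne_top {a : ℝ} (ha1 : a < 1) :
    (2 : ℝ≥0∞) ^ a * (1 - 2 ^ (a - 1))⁻¹ ≠ ⊤ := by
  refine ENNReal.mul_ne_top (by simp) (ENNReal.inv_ne_top.2 ?_)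
  rw [Ne, tsub_eq_zero_iff_le, not_le]
  exact ENNReal.rpow_lt_one_of_one_lt_of_neg (by norm_num) (by linarith)

/-- Integrated form of the Michael–Simon argument: potential bounds for the ball ratios at all
scales above `ρ` control the mass of the set of points with a lower density bound at scale `ρ`. -/
theorem measure_le_mul_lintegral_of_potential_bound {E : Type*} [MetricSpace E]
    [MeasurableSpace E] [BorelSpace E] [SecondCountableTopology E]
    (μ : Measure E) [IsFiniteMeasure μ] {w : E → ℝ≥0∞} (hw : Measurable w)
    (hwt : ∫⁻ y, w y ∂μ ≠ ⊤) {k ρ c₁ c : ℝ} (hk : 1 ≤ k) (hρ : 0 < ρ) (hc₁ : 0 < c₁)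
    (hc : 0 < c) {G : Set E} (hG : MeasurableSet G)
    (h1 : ∀ x ∈ G, ∀ σ, ρ ≤ σ → ENNReal.ofReal (c₁ * σ ^ (-k)) * μ (Metric.ball x σ) ≤
      ∫⁻ y, w y * ENNReal.ofReal ((dist x y ^ 2 + σ ^ 2) ^ ((1 - k) / 2)) ∂μ)
    (h2 : ∀ x ∈ G, ENNReal.ofReal (c * ρ ^ k) ≤ μ (Metric.ball x ρ)) :
    μ G ≤ ENNReal.ofReal (1 / (c₁ * c) + 4 ^ k / c₁) *
      (2 ^ (1 - 1 / k) * (1 - 2 ^ (1 - 1 / k - 1))⁻¹ * (μ Set.univ) ^ (1 / k)) *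
        ∫⁻ y, w y ∂μ := by
  set a : ℝ := 1 - 1 / k with ha
  have hk0 : 0 < k := by linarith
  have ha0 : 0 ≤ a := by
    have : 1 / k ≤ 1 := by rw [div_le_one hk0]; exact hk
    simp only [ha]; linarith
  have ha1 : a < 1 := by
    have : 0 < 1 / k := by positivity
    simp only [ha]; linarith
  have hak2 : (1 - k) = - k * a := by simp only [ha]; field_simp; ring
  have hak : 1 - a = 1 / k := by simp only [ha]; ring
  clear_value a
  set C₃ : ℝ := 1 / (c₁ * c) + 4 ^ k / c₁ with hC₃
  have hC₃0 : 0 < C₃ := by positivity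
  let q : E → E → ℝ≥0∞ := fun x y => ENNReal.ofReal ((dist x y ^ 2 + ρ ^ 2) ^ ((1 - k) / 2))
  have hqm : Measurable (Function.uncurry q) := by
    simp only [Function.uncurry_def, q]
    fun_prop
  let Φ : E → ℝ≥0∞ := fun x => ∫⁻ y, w y * q x y ∂μ
  have hΦm : Measurable Φ := by
    have : Measurable (Function.uncurry fun x y => w y * q x y) :=
      (hw.comp measurable_snd).mul hqm
    exact this.lintegral_prod_right
  have hqle : ∀ x y, ∀ σ, ρ ≤ σ →
      ENNReal.ofReal ((dist x y ^ 2 + σ ^ 2) ^ ((1 - k) / 2)) ≤ q x y := by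
    intro x y σ hσ
    refine ENNReal.ofReal_le_ofReal ?_
    refine Real.rpow_le_rpow_of_nonpos (by positivity) ?_ (by linarith)
    gcongr
  have hΦ1 : ∀ x ∈ G, ∀ σ, ρ ≤ σ → ENNReal.ofReal (c₁ * σ ^ (-k)) * μ (Metric.ball x σ) ≤ Φ x := by
    intro x hx σ hσ
    refine (h1 x hx σ hσ).trans (lintegral_mono fun y => ?_)
    exact mul_le_mul_right (hqle x y σ hσ) _
  have hΦt : ∀ x, Φ x ≠ ⊤ := by
    intro x
    have : Φ x ≤ ∫⁻ y, w y * ENNReal.ofReal ((ρ ^ 2) ^ ((1 - k) / 2)) ∂μ := by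
      refine lintegral_mono fun y => ?_
      refine mul_le_mul_right (ENNReal.ofReal_le_ofReal ?_) _
      refine Real.rpow_le_rpow_of_nonpos (by positivity) ?_ (by linarith)
      nlinarith [sq_nonneg (dist x y)]
    rw [lintegral_mul_const _ hw] at this
    exact ne_top_of_le_ne_top (ENNReal.mul_ne_top hwt ENNReal.ofReal_ne_top) this
  have hφc : ∀ x ∈ G, c₁ * c ≤ (Φ x).toReal := by
    intro x hx
    have := (mul_le_mul_right (h2 x hx) _).trans (hΦ1 x hx ρ le_rfl)
    rw [← ENNReal.ofReal_mul (by positivity), ENNReal.ofReal_le_iff_le_toReal (hΦt x)] at this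
    convert this using 1
    have : ρ ^ (-k) * ρ ^ k = 1 := by rw [← Real.rpow_add hρ]; simp
    linear_combination (-c₁ * c) * this
  have hΦ0 : ∀ x ∈ G, Φ x ≠ 0 := by
    intro x hx h
    have := hφc x hx
    rw [h] at this
    have h' : 0 < c₁ * c := by positivity
    simp at this; linarith
  have key : ∀ x ∈ G, ∀ y, q x y * (μ {z | dist z y ≤ dist x y}) ^ a ≤ ENNReal.ofReal C₃ * Φ x := by
    intro x hx y
    set R : ℝ := Real.sqrt (dist x y ^ 2 + ρ ^ 2) with hR
    have hR2 : R ^ 2 = dist x y ^ 2 + ρ ^ 2 := Real.sq_sqrt (by positivity)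
    have hR0 : 0 < R := Real.sqrt_pos.2 (by positivity)
    have hRρ : ρ ≤ R := by
      apply Real.le_sqrt_of_sq_le; nlinarith [sq_nonneg (dist x y)]
    have hRd : dist x y ≤ R := by
      apply Real.le_sqrt_of_sq_le; nlinarith [sq_nonneg ρ]
    have hsub : {z | dist z y ≤ dist x y} ⊆ Metric.ball x (4 * R) := by
      intro z hz
      rw [Metric.mem_ball]
      have h3 := dist_triangle z y x
      rw [dist_comm y x] at h3
      have : dist z y ≤ dist x y := hz
      linarith
    have hmt : μ {z | dist z y ≤ dist x y} ≠ ⊤ := measure_ne_top _ _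
    set m : ℝ := (μ {z | dist z y ≤ dist x y}).toReal with hm
    have hm0 : 0 ≤ m := ENNReal.toReal_nonneg
    have hφ2 : c₁ * (4 * R) ^ (-k) * m ≤ (Φ x).toReal := by
      have := (mul_le_mul_right (measure_mono hsub) _).trans
        (hΦ1 x hx (4 * R) (by linarith))
      rw [← ENNReal.ofReal_toReal hmt, ← ENNReal.ofReal_mul (by positivity),
        ENNReal.ofReal_le_iff_le_toReal (hΦt x)] at this
      exact this
    have hqR : q x y = ENNReal.ofReal (R ^ (1 - k)) := by
      simp only [q]
      rw [← hR2, ← Real.rpow_natCast, ← Real.rpow_mul hR0.le]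
      congr 2; push_cast; ring
    rw [hqR, ← ENNReal.ofReal_toReal hmt, ← ENNReal.ofReal_toReal (hΦt x),
      ENNReal.ofReal_rpow_of_nonneg hm0 ha0, ← ENNReal.ofReal_mul (by positivity),
      ← ENNReal.ofReal_mul hC₃0.le]
    refine ENNReal.ofReal_le_ofReal ?_
    have e1 : R ^ (1 - k) * m ^ a = (R ^ (-k) * m) ^ a := by
      rw [Real.mul_rpow (by positivity) hm0, ← Real.rpow_mul hR0.le]
      rw [hak2]
    rw [e1]
    set t : ℝ := R ^ (-k) * m with ht
    have ht0 : 0 ≤ t := by positivity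
    have e2 : t ^ a ≤ 1 + t := by
      rcases le_total t 1 with h | h
      · linarith [Real.rpow_le_one ht0 h ha0]
      · have := Real.rpow_le_rpow_of_exponent_le h ha1.le
        rw [Real.rpow_one] at this; linarith
    have e3 : (4 * R) ^ (-k) * 4 ^ k = R ^ (-k) := by
      rw [Real.mul_rpow (by norm_num) hR0.le, mul_right_comm, ← Real.rpow_add (by norm_num)]
      simp
    have e4 : 1 ≤ 1 / (c₁ * c) * (Φ x).toReal := by
      rw [one_div, ← div_eq_inv_mul, one_le_div (by positivity)]; exact hφc x hx
    have e5 : t ≤ 4 ^ k / c₁ * (Φ x).toReal := by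
      have : t = 4 ^ k / c₁ * (c₁ * (4 * R) ^ (-k) * m) := by
        rw [ht, ← e3]; field_simp
      rw [this]
      exact mul_le_mul_of_nonneg_left hφ2 (by positivity)
    calc t ^ a ≤ 1 + t := e2
      _ ≤ C₃ * (Φ x).toReal := by rw [hC₃, add_mul]; linarith
  have key2 : ∀ x ∈ G, ∀ y, (Φ x)⁻¹ * q x y ≤
      ENNReal.ofReal C₃ * (μ {z | dist z y ≤ dist x y}) ^ (-a) := by
    intro x hx y
    have hma : (μ {z | dist z y ≤ dist x y}) ^ a ≠ ⊤ :=
      ENNReal.rpow_ne_top_of_nonneg ha0 (measure_ne_top _ _)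
    have hC0 : ENNReal.ofReal C₃ ≠ 0 := by simpa using hC₃0
    rw [ENNReal.rpow_neg, ← div_eq_mul_inv, ENNReal.le_div_iff_mul_le (Or.inr (by simpa using hC₃0))
      (Or.inl hma), mul_assoc, ← ENNReal.div_eq_inv_mul]
    exact ENNReal.div_le_of_le_mul (key x hx y)
  calc μ G = ∫⁻ x in G, (Φ x)⁻¹ * Φ x ∂μ := by
        rw [setLIntegral_congr_fun hG (g := fun _ => 1)
          (fun x hx => ENNReal.inv_mul_cancel (hΦ0 x hx) (hΦt x))]
        simp
    _ = ∫⁻ x in G, ∫⁻ y, w y * ((Φ x)⁻¹ * q x y) ∂μ ∂μ := by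
        refine setLIntegral_congr_fun hG fun x hx => ?_
        rw [← lintegral_const_mul' _ _ (ENNReal.inv_ne_top.2 (hΦ0 x hx))]
        refine lintegral_congr fun y => ?_
        ring
    _ = ∫⁻ y, ∫⁻ x in G, w y * ((Φ x)⁻¹ * q x y) ∂μ ∂μ := by
        rw [lintegral_lintegral_swap]
        refine Measurable.aemeasurable ?_
        exact (hw.comp measurable_snd).mul ((hΦm.inv.comp measurable_fst).mul hqm)
    _ ≤ ∫⁻ y, w y * (ENNReal.ofReal C₃ *
          (2 ^ a * (1 - 2 ^ (a - 1))⁻¹ * (μ Set.univ) ^ (1 / k))) ∂μ := by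
        refine lintegral_mono fun y => ?_
        have hqy' : Measurable fun x => q x y := by
          simp only [q]
          fun_prop
        have hqy : Measurable fun x => (Φ x)⁻¹ * q x y := hΦm.inv.mul hqy'
        rw [lintegral_const_mul _ hqy]
        refine mul_le_mul_right ?_ _
        calc ∫⁻ x in G, (Φ x)⁻¹ * q x y ∂μ
            ≤ ∫⁻ x in G, ENNReal.ofReal C₃ * (μ {z | dist z y ≤ dist x y}) ^ (-a) ∂μ :=
              setLIntegral_mono' hG fun x hx => key2 x hx y
          _ ≤ ∫⁻ x, ENNReal.ofReal C₃ * (μ {z | dist z y ≤ dist x y}) ^ (-a) ∂μ :=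
              setLIntegral_le_lintegral _ _
          _ = ENNReal.ofReal C₃ * ∫⁻ x, (μ {z | dist z y ≤ dist x y}) ^ (-a) ∂μ :=
              lintegral_const_mul' _ _ ENNReal.ofReal_ne_top
          _ ≤ _ := by
              refine mul_le_mul_right ?_ _
              have h := lintegral_rpow_neg_measure_sublevel_le μ
                (f := fun z => dist z y) (measurable_id.dist measurable_const) ha0
              rw [hak] at h
              exact h
    _ = _ := by
        rw [lintegral_mul_const _ hw]; ring

section

open scoped RealInnerProductSpace

variable {n : ℕ}

local notation "𝔼" => EuclideanSpace ℝ (Fin n)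

theorem divg_smul {f : 𝔼 → ℝ} {Y : 𝔼 → 𝔼} {x : 𝔼} (hf : DifferentiableAt ℝ f x)
    (hY : DifferentiableAt ℝ Y x) :
    divg (fun y => f y • Y y) x = f x * divg Y x + fderiv ℝ f x (Y x) := by
  unfold divg
  have h1 : Y x = ∑ i, (Y x) i • EuclideanSpace.single i (1 : ℝ) := by
    ext j
    simp [Finset.sum_apply, Pi.single_apply]
  conv_rhs => rw [h1, map_sum, Finset.mul_sum, ← Finset.sum_add_distrib]
  refine Finset.sum_congr rfl fun i _ => ?_
  rw [fderiv_fun_smul hf hY]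
  simp [mul_comm]

theorem divg_sub {Y Z : 𝔼 → 𝔼} {x : 𝔼} (hY : DifferentiableAt ℝ Y x)
    (hZ : DifferentiableAt ℝ Z x) :
    divg (fun y => Y y - Z y) x = divg Y x - divg Z x := by
  unfold divg
  rw [fderiv_fun_sub hY hZ, ← Finset.sum_sub_distrib]
  simp

theorem divg_sub_const_id (x₀ x : 𝔼) : divg (fun y => y - x₀) x = n := by
  unfold divg
  have h : fderiv ℝ (fun y : 𝔼 => y - x₀) x = ContinuousLinearMap.id ℝ 𝔼 := by
    rw [fderiv_sub_const, fderiv_fun_id]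
  rw [h]
  simp

theorem continuous_divg {Y : 𝔼 → 𝔼} (hY : ContDiff ℝ 1 Y) : Continuous (divg Y) := by
  unfold divg
  have h := hY.continuous_fderiv (by norm_num)
  fun_prop

theorem measurable_divg (Y : 𝔼 → 𝔼) : Measurable (divg Y) := by
  unfold divg
  refine Finset.measurable_sum _ fun i _ => ?_
  have := measurable_fderiv_apply_const ℝ Y (EuclideanSpace.single i (1 : ℝ))
  fun_prop

theorem integral_divg_eq_zero {Y : 𝔼 → 𝔼} (hY : ContDiff ℝ 1 Y) (hc : HasCompactSupport Y) :
    ∫ x, divg Y x = 0 := by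
  unfold divg
  have hcont := hY.continuous_fderiv (by norm_num)
  have hint : ∀ i : Fin n, Integrable
      (fun x => fderiv ℝ Y x (EuclideanSpace.single i (1 : ℝ)) i) := by
    intro i
    refine Continuous.integrable_of_hasCompactSupport (by fun_prop) ?_
    refine (hc.fderiv ℝ).mono' ?_
    intro x hx
    apply subset_closure
    intro h
    apply hx
    simp [h]
  rw [integral_finsetSum _ fun i _ => hint i]
  refine Finset.sum_eq_zero fun i _ => ?_
  have hYi : ContDiff ℝ 1 fun x => Y x i := by fun_prop
  have hfd : ∀ x, fderiv ℝ (fun x => Y x i) x (EuclideanSpace.single i (1 : ℝ)) =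
      fderiv ℝ Y x (EuclideanSpace.single i (1 : ℝ)) i := by
    intro x
    have := ((EuclideanSpace.proj (𝕜 := ℝ) i).hasFDerivAt.comp x
      ((hY.differentiable (by norm_num)) x).hasFDerivAt).fderiv
    have h2 : (fun x => Y x i) = (EuclideanSpace.proj (𝕜 := ℝ) i) ∘ Y := rfl
    rw [h2, this]; rfl
  have := integral_mul_fderiv_eq_neg_fderiv_mul_of_integrable (μ := (volume : Measure 𝔼))
    (f := fun _ : 𝔼 => (1 : ℝ)) (g := fun x => Y x i)
    (v := EuclideanSpace.single i (1 : ℝ)) (by simp) (by simpa [hfd] using hint i)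
    (by
      simp only [one_mul]
      refine hYi.continuous.integrable_of_hasCompactSupport (hc.mono' ?_)
      intro x hx
      apply subset_closure
      intro h
      apply hx
      simp [h]) (fun x _ => by fun_prop)
    (fun x _ => (hYi.differentiable (by norm_num)) x)
  simpa [hfd] using this

section Indicator

variable {E F : Type*} [NormedAddCommGroup E] [NormedAddCommGroup F]

theorem isCompact_closure_inter_superlevel [ProperSpace E] {Ω : Set E} (hb : IsBounded Ω)
    {v : E → ℝ}
    (hv : Continuous v) (a : ℝ) : IsCompact (closure Ω ∩ {x | a ≤ |v x|}) :=
  hb.isCompact_closure.inter_right (isClosed_le continuous_const hv.abs)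

theorem closure_inter_superlevel_subset {Ω : Set E} (ho : IsOpen Ω) {v : E → ℝ}
    (h0 : ∀ x ∈ frontier Ω, v x = 0) {a : ℝ} (ha : 0 < a) :
    closure Ω ∩ {x | a ≤ |v x|} ⊆ Ω := by
  rintro x ⟨hx, hxa⟩
  by_contra hxΩ
  have : x ∈ frontier Ω := by rw [ho.frontier_eq]; exact ⟨hx, hxΩ⟩
  have hxa : a ≤ |v x| := hxa
  rw [h0 x this, abs_zero] at hxa
  linarith

theorem indicator_eventuallyEq_zero [ProperSpace E] {Ω : Set E} (ho : IsOpen Ω)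
    (hb : IsBounded Ω) {v : E → ℝ}
    (hv : Continuous v) (h0 : ∀ x ∈ frontier Ω, v x = 0) {a : ℝ} (ha : 0 < a) {Y : E → F}
    (hYv : ∀ x, |v x| < a → Y x = 0) {x : E} (hx : x ∉ Ω) :
    Ω.indicator Y =ᶠ[𝓝 x] fun _ => 0 := by
  have hK := (isCompact_closure_inter_superlevel hb hv a).isClosed.isOpen_compl
  have hxK : x ∈ (closure Ω ∩ {x | a ≤ |v x|})ᶜ := fun h =>
    hx (closure_inter_superlevel_subset ho h0 ha h)
  filter_upwards [hK.mem_nhds hxK] with y hy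
  by_cases hyΩ : y ∈ Ω
  · rw [Set.indicator_of_mem hyΩ]
    refine hYv y (not_le.1 fun h => hy ⟨subset_closure hyΩ, h⟩)
  · rw [Set.indicator_of_notMem hyΩ]

theorem contDiff_indicator [NormedSpace ℝ E] [NormedSpace ℝ F] [ProperSpace E] {Ω : Set E}
    (ho : IsOpen Ω) (hb : IsBounded Ω) {v : E → ℝ}
    (hv : Continuous v) (h0 : ∀ x ∈ frontier Ω, v x = 0) {a : ℝ} (ha : 0 < a) {Y : E → F}
    (hY : ContDiff ℝ 1 Y) (hYv : ∀ x, |v x| < a → Y x = 0) :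
    ContDiff ℝ 1 (Ω.indicator Y) := by
  rw [contDiff_iff_contDiffAt]
  intro x
  by_cases hx : x ∈ Ω
  · refine hY.contDiffAt.congr_of_eventuallyEq ?_
    filter_upwards [ho.mem_nhds hx] with y hy
    rw [Set.indicator_of_mem hy]
  · exact contDiffAt_const.congr_of_eventuallyEq
      (indicator_eventuallyEq_zero ho hb hv h0 ha hYv hx)

theorem hasCompactSupport_indicator [ProperSpace E] {Ω : Set E} (hb : IsBounded Ω) (Y : E → F) :
    HasCompactSupport (Ω.indicator Y) :=
  HasCompactSupport.intro hb.isCompact_closure fun _ hx =>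
    Set.indicator_of_notMem (fun h => hx (subset_closure h)) _

theorem fderiv_indicator [NormedSpace ℝ E] [NormedSpace ℝ F] [ProperSpace E] {Ω : Set E}
    (ho : IsOpen Ω) (hb : IsBounded Ω) {v : E → ℝ}
    (hv : Continuous v) (h0 : ∀ x ∈ frontier Ω, v x = 0) {a : ℝ} (ha : 0 < a) {Y : E → F}
    (hYv : ∀ x, |v x| < a → Y x = 0) :
    fderiv ℝ (Ω.indicator Y) = Ω.indicator (fderiv ℝ Y) := by
  ext1 x
  by_cases hx : x ∈ Ω
  · rw [Set.indicator_of_mem hx]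
    refine Filter.EventuallyEq.fderiv_eq ?_
    filter_upwards [ho.mem_nhds hx] with y hy
    rw [Set.indicator_of_mem hy]
  · rw [Set.indicator_of_notMem hx,
      (indicator_eventuallyEq_zero ho hb hv h0 ha hYv hx).fderiv_eq]
    simp

end Indicator

theorem setIntegral_divg_eq_zero {Ω : Set 𝔼} (ho : IsOpen Ω) (hb : IsBounded Ω) {v : 𝔼 → ℝ}
    (hv : Continuous v) (h0 : ∀ x ∈ frontier Ω, v x = 0) {a : ℝ} (ha : 0 < a) {Y : 𝔼 → 𝔼}
    (hY : ContDiff ℝ 1 Y) (hYv : ∀ x, |v x| < a → Y x = 0) :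
    ∫ x in Ω, divg Y x = 0 := by
  have h := integral_divg_eq_zero (contDiff_indicator ho hb hv h0 ha hY hYv)
    (hasCompactSupport_indicator hb Y)
  rw [← integral_indicator ho.measurableSet, ← h]
  congr 1
  ext1 x
  unfold divg
  rw [fderiv_indicator ho hb hv h0 ha hYv]
  by_cases hx : x ∈ Ω <;> simp [hx]

theorem contDiff_gradient {v : 𝔼 → ℝ} (hv : ContDiff ℝ (⊤ : ℕ∞) v) :
    ContDiff ℝ (⊤ : ℕ∞) (gradient v) := by
  have h : ContDiff ℝ (⊤ : ℕ∞) (fderiv ℝ v) := hv.fderiv_right (by simp)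
  exact (InnerProductSpace.toDual ℝ 𝔼).symm.contDiff.comp h

theorem norm_gradient (v : 𝔼 → ℝ) (x : 𝔼) : ‖gradient v x‖ = ‖fderiv ℝ v x‖ := by
  unfold gradient; exact LinearIsometryEquiv.norm_map _ _

/-- The Hessian is symmetric. -/
theorem inner_fderiv_gradient_comm {v : 𝔼 → ℝ} (hv : ContDiff ℝ (⊤ : ℕ∞) v) (x w z : 𝔼) :
    ⟪fderiv ℝ (gradient v) x w, z⟫ = ⟪w, fderiv ℝ (gradient v) x z⟫ := by
  have hs : IsSymmSndFDerivAt ℝ v x :=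
    hv.contDiffAt.isSymmSndFDerivAt (by
      rw [minSmoothness_of_isRCLikeNormedField]; exact WithTop.coe_le_coe.2 le_top)
  have h : ContDiff ℝ (⊤ : ℕ∞) (fderiv ℝ v) := hv.fderiv_right (by simp)
  have hd : DifferentiableAt ℝ (fderiv ℝ v) x := (h.differentiable (by simp)) x
  have hg : DifferentiableAt ℝ (gradient v) x :=
    ((contDiff_gradient hv).differentiable (by simp)) x
  have e : ∀ a b : 𝔼, ⟪fderiv ℝ (gradient v) x a, b⟫ = fderiv ℝ (fderiv ℝ v) x a b := by
    intro a b
    have h1 : HasFDerivAt (fun y => ⟪gradient v y, b⟫) _ x :=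
      hg.hasFDerivAt.inner ℝ (hasFDerivAt_const b x)
    have h2 : HasFDerivAt (fun y => fderiv ℝ v y b) _ x :=
      hd.hasFDerivAt.clm_apply (hasFDerivAt_const b x)
    have h3 : (fun y => ⟪gradient v y, b⟫) = fun y => fderiv ℝ v y b := by
      ext y
      simp [inner_gradient_left]
    rw [h3] at h1
    simpa using DFunLike.congr_fun (h1.unique h2) a
  rw [e, real_inner_comm, e]
  exact hs w z

/-- The unit normal field of the level sets of `v`, extended by zero to the critical set. -/
noncomputable def unitNormal (v : 𝔼 → ℝ) (y : 𝔼) : 𝔼 := ‖gradient v y‖⁻¹ • gradient v y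

/-- `|∇v|` times the tangential part of `X`, times `|∇v|`. -/
noncomputable def tangField (v : 𝔼 → ℝ) (X : 𝔼 → 𝔼) (y : 𝔼) : 𝔼 :=
  ‖gradient v y‖ ^ 2 • X y - ⟪X y, gradient v y⟫ • gradient v y

theorem inner_gradient_tangField (v : 𝔼 → ℝ) (X : 𝔼 → 𝔼) (x : 𝔼) :
    ⟪gradient v x, tangField v X x⟫ = 0 := by
  unfold tangField
  rw [inner_sub_right, inner_smul_right, inner_smul_right, real_inner_self_eq_norm_sq,
    real_inner_comm (X x)]
  ring

theorem contDiff_tangField {v : 𝔼 → ℝ} (hv : ContDiff ℝ (⊤ : ℕ∞) v) {X : 𝔼 → 𝔼}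
    (hX : ContDiff ℝ 1 X) : ContDiff ℝ 1 (tangField v X) := by
  have hg : ContDiff ℝ 1 (gradient v) := (contDiff_gradient hv).of_le (by simp)
  unfold tangField
  exact ((hg.norm_sq ℝ).smul hX).sub ((hX.inner ℝ hg).smul hg)

theorem divg_tangField {v : 𝔼 → ℝ} (hv : ContDiff ℝ (⊤ : ℕ∞) v) {X : 𝔼 → 𝔼}
    (hX : ContDiff ℝ 1 X) (x : 𝔼) :
    divg (tangField v X) x = ‖gradient v x‖ ^ 2 * divg X x
      + ⟪gradient v x, fderiv ℝ (gradient v) x (X x)⟫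
      - ⟪fderiv ℝ X x (gradient v x), gradient v x⟫
      - ⟪X x, gradient v x⟫ * divg (gradient v) x := by
  have hg : ContDiff ℝ 1 (gradient v) := (contDiff_gradient hv).of_le (by simp)
  have hgd : DifferentiableAt ℝ (gradient v) x := (hg.differentiable (by norm_num)) x
  have hXd : DifferentiableAt ℝ X x := (hX.differentiable (by norm_num)) x
  have h1 : HasFDerivAt (fun y => ‖gradient v y‖ ^ 2) _ x := hgd.hasFDerivAt.norm_sq
  have h2 : HasFDerivAt (fun y => ⟪X y, gradient v y⟫) _ x :=
    hXd.hasFDerivAt.inner ℝ hgd.hasFDerivAt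
  have hd1 : DifferentiableAt ℝ (fun y => ‖gradient v y‖ ^ 2 • X y) x :=
    h1.differentiableAt.fun_smul hXd
  have hd2 : DifferentiableAt ℝ (fun y => ⟪X y, gradient v y⟫ • gradient v y) x :=
    h2.differentiableAt.fun_smul hgd
  unfold tangField
  rw [divg_sub hd1 hd2,
    divg_smul h1.differentiableAt hXd, divg_smul h2.differentiableAt hgd, h1.fderiv, h2.fderiv]
  simp only [smul_apply, ContinuousLinearMap.comp_apply,
    ContinuousLinearMap.prod_apply, fderivInnerCLM_apply, innerSL_apply_apply]
  have hs := inner_fderiv_gradient_comm hv x (X x) (gradient v x)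
  rw [← hs, real_inner_comm]
  simp
  ring

theorem hasFDerivAt_inv_sqrt_norm_sq_add {G : 𝔼 → 𝔼} {x : 𝔼} (hG : DifferentiableAt ℝ G x)
    {e : ℝ} (he : 0 < ‖G x‖ ^ 2 + e) :
    DifferentiableAt ℝ (fun y => (√(‖G y‖ ^ 2 + e))⁻¹) x ∧ ∀ w,
      fderiv ℝ (fun y => (√(‖G y‖ ^ 2 + e))⁻¹) x w =
        -((√(‖G x‖ ^ 2 + e))⁻¹) ^ 3 * ⟪G x, fderiv ℝ G x w⟫ := by
  have h1 := (hG.hasFDerivAt.norm_sq.add_const e).sqrt he.ne'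
  have hs : √(‖G x‖ ^ 2 + e) ≠ 0 := (Real.sqrt_pos.2 he).ne'
  have h2 : HasFDerivAt (fun y => (√(‖G y‖ ^ 2 + e))⁻¹) _ x :=
    (hasDerivAt_inv hs).comp_hasFDerivAt x h1
  refine ⟨h2.differentiableAt, fun w => ?_⟩
  rw [h2.fderiv]
  simp
  field_simp

theorem divg_inv_sqrt_smul {v : 𝔼 → ℝ} (hv : ContDiff ℝ (⊤ : ℕ∞) v) {x : 𝔼} {e : ℝ}
    (he : 0 < ‖gradient v x‖ ^ 2 + e) {Z : 𝔼 → 𝔼} (hZ : DifferentiableAt ℝ Z x) :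
    divg (fun y => (√(‖gradient v y‖ ^ 2 + e))⁻¹ • Z y) x =
      (√(‖gradient v x‖ ^ 2 + e))⁻¹ * divg Z x - ((√(‖gradient v x‖ ^ 2 + e))⁻¹) ^ 3 *
        ⟪gradient v x, fderiv ℝ (gradient v) x (Z x)⟫ := by
  have hgd : DifferentiableAt ℝ (gradient v) x :=
    ((contDiff_gradient hv).differentiable (by simp)) x
  obtain ⟨h1, h2⟩ := hasFDerivAt_inv_sqrt_norm_sq_add hgd he
  rw [divg_smul h1 hZ, h2]
  ring

theorem divg_unitNormal {v : 𝔼 → ℝ} (hv : ContDiff ℝ (⊤ : ℕ∞) v) {x : 𝔼}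
    (hx : gradient v x ≠ 0) :
    divg (unitNormal v) x = ‖gradient v x‖⁻¹ * divg (gradient v) x
      - (‖gradient v x‖⁻¹) ^ 3 * ⟪gradient v x, fderiv ℝ (gradient v) x (gradient v x)⟫ := by
  have hgd : DifferentiableAt ℝ (gradient v) x :=
    ((contDiff_gradient hv).differentiable (by simp)) x
  have hpos : 0 < ‖gradient v x‖ ^ 2 + 0 := by
    have := norm_pos_iff.2 hx
    positivity
  have h := divg_inv_sqrt_smul hv hpos hgd
  simp only [add_zero, Real.sqrt_sq (norm_nonneg _)] at h
  exact h

/-- Integrand of the first variation formula: `|∇v|` times the tangential divergence of `X` minus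
the normal component of `X` times the curvature term. -/
theorem firstVariation_integrand_eq {v : 𝔼 → ℝ} (hv : ContDiff ℝ (⊤ : ℕ∞) v) {X : 𝔼 → 𝔼}
    (hX : ContDiff ℝ 1 X) (x : 𝔼) :
    ‖gradient v x‖⁻¹ * divg (tangField v X) x - (‖gradient v x‖⁻¹) ^ 3 *
        ⟪gradient v x, fderiv ℝ (gradient v) x (tangField v X x)⟫ =
      ‖gradient v x‖ * divg X x - ‖gradient v x‖⁻¹ * ⟪fderiv ℝ X x (gradient v x), gradient v x⟫
        - ⟪X x, gradient v x⟫ * divg (unitNormal v) x := by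
  by_cases hx : gradient v x = 0
  · simp [hx]
  rw [divg_unitNormal hv hx, divg_tangField hv hX]
  have hN : ‖gradient v x‖ ≠ 0 := norm_ne_zero_iff.2 hx
  simp only [tangField, map_sub, map_smul, inner_sub_right, inner_smul_right]
  field_simp
  ring

theorem gradient_apply_fderiv (v : 𝔼 → ℝ) (x w : 𝔼) : fderiv ℝ v x w = ⟪gradient v x, w⟫ := by
  simp [inner_gradient_left]

/-- Smooth cutoff converging to the indicator of `a < |t| ≤ b`. -/
noncomputable def slabCutoff (a b : ℝ) (j : ℕ) (t : ℝ) : ℝ :=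
  Real.smoothTransition (j * (t ^ 2 - a ^ 2)) * (1 - Real.smoothTransition (j * (t ^ 2 - b ^ 2)))

theorem contDiff_slabCutoff (a b : ℝ) (j : ℕ) : ContDiff ℝ 1 (slabCutoff a b j) := by
  unfold slabCutoff
  have h (c : ℝ) : ContDiff ℝ 1 fun t : ℝ => Real.smoothTransition (j * (t ^ 2 - c ^ 2)) :=
    Real.smoothTransition.contDiff.comp (by fun_prop)
  exact (h a).mul (contDiff_const.sub (h b))

theorem abs_slabCutoff_le_one (a b : ℝ) (j : ℕ) (t : ℝ) : |slabCutoff a b j t| ≤ 1 := by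
  unfold slabCutoff
  rw [abs_mul]
  have h (x : ℝ) : 0 ≤ Real.smoothTransition x ∧ Real.smoothTransition x ≤ 1 :=
    ⟨Real.smoothTransition.nonneg x, Real.smoothTransition.le_one x⟩
  refine mul_le_one₀ ?_ (abs_nonneg _) ?_ <;> rw [abs_le] <;> constructor <;>
    linarith [h (j * (t ^ 2 - a ^ 2)), h (j * (t ^ 2 - b ^ 2)), (h (j * (t ^ 2 - a ^ 2))).1,
      (h (j * (t ^ 2 - b ^ 2))).1]

theorem slabCutoff_eq_zero {a b t : ℝ} (ha : 0 < a) (ht : |t| ≤ a) (j : ℕ) :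
    slabCutoff a b j t = 0 := by
  have h : t ^ 2 ≤ a ^ 2 := sq_le_sq.2 (by rwa [abs_of_pos ha])
  unfold slabCutoff
  rw [Real.smoothTransition.zero_of_nonpos, zero_mul]
  exact mul_nonpos_of_nonneg_of_nonpos (by positivity) (by linarith)

theorem eventually_smoothTransition_mul {c : ℝ} (hc : 0 < c) :
    ∀ᶠ j : ℕ in atTop, Real.smoothTransition (j * c) = 1 := by
  have := (tendsto_natCast_atTop_atTop (R := ℝ)).atTop_mul_const hc
  filter_upwards [this.eventually_ge_atTop 1] with j hj
  exact Real.smoothTransition.one_of_one_le hj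

theorem eventually_slabCutoff {a b : ℝ} (ha : 0 < a) (hab : a ≤ b) (t : ℝ) :
    ∀ᶠ j : ℕ in atTop, slabCutoff a b j t = {s : ℝ | a < |s| ∧ |s| ≤ b}.indicator 1 t := by
  by_cases h1 : a < |t|
  · have h1' : 0 < t ^ 2 - a ^ 2 := by
      have := sq_lt_sq.2 (show |a| < |t| by rwa [abs_of_pos ha])
      linarith
    by_cases h2 : |t| ≤ b
    · have h2' : t ^ 2 - b ^ 2 ≤ 0 := by
        have := sq_le_sq.2 (show |t| ≤ |b| by rwa [abs_of_pos (ha.trans_le hab)])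
        linarith
      filter_upwards [eventually_smoothTransition_mul h1'] with j hj
      rw [Set.indicator_of_mem (show t ∈ {s : ℝ | a < |s| ∧ |s| ≤ b} from ⟨h1, h2⟩)]
      unfold slabCutoff
      rw [hj, Real.smoothTransition.zero_of_nonpos]
      · simp
      · exact mul_nonpos_of_nonneg_of_nonpos (by positivity) h2'
    · have h2' : 0 < t ^ 2 - b ^ 2 := by
        have := sq_lt_sq.2 (show |b| < |t| by
          rw [abs_of_pos (ha.trans_le hab)]; exact not_le.1 h2)
        linarith
      filter_upwards [eventually_smoothTransition_mul h2'] with j hj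
      rw [Set.indicator_of_notMem (fun h => h2 h.2)]
      unfold slabCutoff
      rw [hj]
      simp
  · refine Eventually.of_forall fun j => ?_
    rw [Set.indicator_of_notMem (fun h => h1 h.1), slabCutoff_eq_zero ha (not_lt.1 h1)]

theorem integrableOn_of_continuous {Ω : Set 𝔼} (hb : IsBounded Ω) {f : 𝔼 → ℝ} (hf : Continuous f) :
    IntegrableOn f Ω :=
  (hf.continuousOn.integrableOn_compact hb.isCompact_closure).mono_set subset_closure

/-- First variation formula for the slab `a < |v| ≤ b`. -/
theorem setIntegral_firstVariation_eq_zero {Ω : Set 𝔼} (ho : IsOpen Ω) (hb : IsBounded Ω)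
    {v : 𝔼 → ℝ} (hv : ContDiff ℝ (⊤ : ℕ∞) v) (h0 : ∀ x ∈ frontier Ω, v x = 0) {a b : ℝ}
    (ha : 0 < a) (hab : a ≤ b) {X : 𝔼 → 𝔼} (hX : ContDiff ℝ 1 X) :
    ∫ x in Ω ∩ {x | a < |v x| ∧ |v x| ≤ b}, (‖gradient v x‖ * divg X x
      - ‖gradient v x‖⁻¹ * ⟪fderiv ℝ X x (gradient v x), gradient v x⟫
      - ⟪X x, gradient v x⟫ * divg (unitNormal v) x) = 0 := by
  have hvc : Continuous v := hv.continuous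
  have hg : ContDiff ℝ 1 (gradient v) := (contDiff_gradient hv).of_le (by simp)
  have hgc : Continuous (gradient v) := hg.continuous
  have hDg : Continuous (fderiv ℝ (gradient v)) := hg.continuous_fderiv (by norm_num)
  have hDX : Continuous (fderiv ℝ X) := hX.continuous_fderiv (by norm_num)
  have hXc := hX.continuous
  have hdX := continuous_divg hX
  have hdg := continuous_divg hg
  have hT := contDiff_tangField hv hX
  have hTc := hT.continuous
  have hdT := continuous_divg hT
  set T := tangField v X with hTdef
  set N : ℕ → 𝔼 → ℝ := fun j x => √(‖gradient v x‖ ^ 2 + 1 / ((j : ℝ) + 1)) with hN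
  have hε : ∀ j : ℕ, 0 < 1 / ((j : ℝ) + 1) := fun j => by positivity
  have hNpos : ∀ (j : ℕ) x, 0 < ‖gradient v x‖ ^ 2 + 1 / ((j : ℝ) + 1) := fun j x => by
    have := hε j
    positivity
  have hNle : ∀ j x, ‖gradient v x‖ ≤ N j x := fun j x =>
    Real.le_sqrt_of_sq_le (by linarith [hε j])
  set Z : ℕ → 𝔼 → ℝ := fun j x => (N j x)⁻¹ * divg T x - ((N j x)⁻¹) ^ 3 *
    ⟪gradient v x, fderiv ℝ (gradient v) x (T x)⟫ with hZ
  have hNsm : ∀ j, ContDiff ℝ 1 fun x => (N j x)⁻¹ := fun j =>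
    (((hg.norm_sq ℝ).add contDiff_const).sqrt fun x => (hNpos j x).ne').inv
      fun x => (Real.sqrt_pos.2 (hNpos j x)).ne'
  have hψ : ∀ j, ContDiff ℝ 1 fun x => slabCutoff a b j (v x) := fun j =>
    (contDiff_slabCutoff a b j).comp (hv.of_le (by simp))
  have hzero : ∀ j, ∫ x in Ω, slabCutoff a b j (v x) * Z j x = 0 := by
    intro j
    have hY : ContDiff ℝ 1 fun x => slabCutoff a b j (v x) • ((N j x)⁻¹ • T x) :=
      (hψ j).smul ((hNsm j).smul hT)
    rw [← setIntegral_divg_eq_zero ho hb hvc h0 ha hY fun x hx => by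
      simp [slabCutoff_eq_zero ha hx.le]]
    congr 1
    ext1 x
    have hTd : DifferentiableAt ℝ T x := (hT.differentiable (by norm_num)) x
    have hNT : DifferentiableAt ℝ (fun x => (N j x)⁻¹ • T x) x :=
      (((hNsm j).smul hT).differentiable (by norm_num)) x
    rw [divg_smul (((hψ j).differentiable (by norm_num)) x) hNT,
      divg_inv_sqrt_smul hv (hNpos j x) hTd]
    have hvd : HasFDerivAt v (fderiv ℝ v x) x :=
      ((hv.differentiable (by simp)) x).hasFDerivAt
    have hc : HasFDerivAt (fun x => slabCutoff a b j (v x)) _ x :=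
      ((((contDiff_slabCutoff a b j).differentiable (by norm_num)) (v x)).hasDerivAt
        ).comp_hasFDerivAt
        x hvd
    rw [hc.fderiv]
    have : fderiv ℝ v x (T x) = 0 := by
      rw [gradient_apply_fderiv, inner_gradient_tangField]
    simp [this, hZ, hN]
  set B : 𝔼 → ℝ := fun x => ‖gradient v x‖ * |divg X x| + ‖fderiv ℝ (gradient v) x‖ * ‖X x‖ +
    ‖fderiv ℝ X x‖ * ‖gradient v x‖ + ‖X x‖ * |divg (gradient v) x| +
    2 * ‖fderiv ℝ (gradient v) x‖ * ‖X x‖ with hB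
  have hBint : IntegrableOn B Ω := integrableOn_of_continuous hb (by fun_prop)
  have hinner1 : ∀ x w : 𝔼, |⟪gradient v x, fderiv ℝ (gradient v) x w⟫| ≤
      ‖gradient v x‖ * (‖fderiv ℝ (gradient v) x‖ * ‖w‖) := fun x w =>
    (abs_real_inner_le_norm _ _).trans (by gcongr; exact ContinuousLinearMap.le_opNorm _ _)
  have hTnorm : ∀ x, ‖T x‖ ≤ 2 * ‖gradient v x‖ ^ 2 * ‖X x‖ := by
    intro x
    have h1 := norm_sub_le (‖gradient v x‖ ^ 2 • X x) (⟪X x, gradient v x⟫ • gradient v x)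
    have h2 := abs_real_inner_le_norm (X x) (gradient v x)
    rw [norm_smul, norm_smul, Real.norm_eq_abs, Real.norm_eq_abs,
      abs_of_nonneg (sq_nonneg _)] at h1
    have h3 := mul_le_mul_of_nonneg_right h2 (norm_nonneg (gradient v x))
    rw [hTdef]
    unfold tangField
    linarith
  have hdTbd : ∀ x, |divg T x| ≤ ‖gradient v x‖ * (‖gradient v x‖ * |divg X x|
      + ‖fderiv ℝ (gradient v) x‖ * ‖X x‖ + ‖fderiv ℝ X x‖ * ‖gradient v x‖
      + ‖X x‖ * |divg (gradient v) x|) := by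
    intro x
    rw [hTdef, divg_tangField hv hX]
    have h1 := hinner1 x (X x)
    have h2 : |⟪fderiv ℝ X x (gradient v x), gradient v x⟫| ≤
        (‖fderiv ℝ X x‖ * ‖gradient v x‖) * ‖gradient v x‖ :=
      (abs_real_inner_le_norm _ _).trans (by gcongr; exact ContinuousLinearMap.le_opNorm _ _)
    have h3 : |⟪X x, gradient v x⟫ * divg (gradient v) x| ≤
        ‖X x‖ * ‖gradient v x‖ * |divg (gradient v) x| := by
      rw [abs_mul]
      gcongr
      exact abs_real_inner_le_norm _ _
    have h4 : |‖gradient v x‖ ^ 2 * divg X x| = ‖gradient v x‖ ^ 2 * |divg X x| := by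
      rw [abs_mul, abs_of_nonneg (sq_nonneg _)]
    refine (abs_sub _ _).trans ((add_le_add (abs_sub _ _) le_rfl).trans
      ((add_le_add (add_le_add (abs_add_le _ _) le_rfl) le_rfl).trans ?_))
    rw [h4]
    refine (add_le_add (add_le_add (add_le_add le_rfl h1) h2) h3).trans (le_of_eq ?_)
    ring
  have hbound : ∀ j x, |Z j x| ≤ B x := by
    intro j x
    have hNj : 0 < N j x := Real.sqrt_pos.2 (hNpos j x)
    have e1 : |(N j x)⁻¹ * divg T x| ≤ ‖gradient v x‖ * |divg X x|
      + ‖fderiv ℝ (gradient v) x‖ * ‖X x‖ + ‖fderiv ℝ X x‖ * ‖gradient v x‖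
      + ‖X x‖ * |divg (gradient v) x| := by
      rw [abs_mul, abs_of_pos (inv_pos.2 hNj), inv_mul_le_iff₀ hNj]
      refine (hdTbd x).trans ?_
      gcongr
      exact hNle j x
    have e2 : |((N j x)⁻¹) ^ 3 * ⟪gradient v x, fderiv ℝ (gradient v) x (T x)⟫| ≤
        2 * ‖fderiv ℝ (gradient v) x‖ * ‖X x‖ := by
      rw [abs_mul, abs_of_pos (by positivity), inv_pow, inv_mul_le_iff₀ (by positivity)]
      calc _ ≤ ‖gradient v x‖ * (‖fderiv ℝ (gradient v) x‖ * ‖T x‖) := hinner1 x (T x)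
        _ ≤ ‖gradient v x‖ * (‖fderiv ℝ (gradient v) x‖ * (2 * ‖gradient v x‖ ^ 2 * ‖X x‖)) := by
          gcongr
          exact hTnorm x
        _ = ‖gradient v x‖ ^ 3 * (2 * ‖fderiv ℝ (gradient v) x‖ * ‖X x‖) := by ring
        _ ≤ _ := by
          gcongr
          exact hNle j x
    exact (abs_sub _ _).trans (add_le_add e1 e2)
  have hZc : ∀ j, Continuous (Z j) := by
    intro j
    have := (hNsm j).continuous
    fun_prop
  have hms : MeasurableSet {x : 𝔼 | a < |v x| ∧ |v x| ≤ b} :=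
    (measurableSet_lt measurable_const hvc.abs.measurable).inter
      (measurableSet_le hvc.abs.measurable measurable_const)
  rw [← setIntegral_indicator hms]
  have hlim := tendsto_integral_of_dominated_convergence
    (μ := volume.restrict Ω) (F := fun j x => slabCutoff a b j (v x) * Z j x)
    (f := {x : 𝔼 | a < |v x| ∧ |v x| ≤ b}.indicator fun x => ‖gradient v x‖ * divg X x
      - ‖gradient v x‖⁻¹ * ⟪fderiv ℝ X x (gradient v x), gradient v x⟫
      - ⟪X x, gradient v x⟫ * divg (unitNormal v) x) B
    (fun j => ((hψ j).continuous.mul (hZc j)).aestronglyMeasurable) hBint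
    (fun j => Eventually.of_forall fun x => by
      rw [Real.norm_eq_abs, abs_mul]
      exact (mul_le_of_le_one_left (abs_nonneg _) (abs_slabCutoff_le_one _ _ _ _)).trans
        (hbound j x))
    (Eventually.of_forall fun x => by
      have hZlim : Tendsto (fun j => Z j x) atTop (𝓝 (‖gradient v x‖ * divg X x
          - ‖gradient v x‖⁻¹ * ⟪fderiv ℝ X x (gradient v x), gradient v x⟫
          - ⟪X x, gradient v x⟫ * divg (unitNormal v) x)) := by
        rw [← firstVariation_integrand_eq hv hX]
        by_cases hx : gradient v x = 0
        · have hT0 : T x = 0 := by simp [hTdef, tangField, hx]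
          have hd0 : divg T x = 0 := by
            have := hdTbd x
            simpa [hx] using this
          simp only [hZ, hx, hd0, inner_zero_left, norm_zero, inv_zero]
          simp
        · have hNlim : Tendsto (fun j => N j x) atTop (𝓝 ‖gradient v x‖) := by
            have h1 : Tendsto (fun j : ℕ => ‖gradient v x‖ ^ 2 + 1 / ((j : ℝ) + 1)) atTop
                (𝓝 (‖gradient v x‖ ^ 2 + 0)) :=
              tendsto_const_nhds.add tendsto_one_div_add_atTop_nhds_zero_nat
            have h2 := (Real.continuous_sqrt.tendsto _).comp h1
            rw [add_zero, Real.sqrt_sq (norm_nonneg _)] at h2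
            exact h2
          have hNi := hNlim.inv₀ (norm_ne_zero_iff.2 hx)
          exact (hNi.mul_const _).sub ((hNi.pow 3).mul_const _)
      have hev := eventually_slabCutoff ha hab (v x)
      by_cases hx : a < |v x| ∧ |v x| ≤ b
      · rw [Set.indicator_of_mem (show x ∈ {x : 𝔼 | a < |v x| ∧ |v x| ≤ b} from hx)]
        refine hZlim.congr' ?_
        filter_upwards [hev] with j hj
        rw [hj, Set.indicator_of_mem (show v x ∈ {s : ℝ | a < |s| ∧ |s| ≤ b} from hx)]
        simp
      · rw [Set.indicator_of_notMem (show x ∉ {x : 𝔼 | a < |v x| ∧ |v x| ≤ b} from hx)]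
        refine tendsto_const_nhds.congr' ?_
        filter_upwards [hev] with j hj
        rw [hj, Set.indicator_of_notMem (show v x ∉ {s : ℝ | a < |s| ∧ |s| ≤ b} from hx)]
        simp)
  simp only [hzero] at hlim
  exact (tendsto_nhds_unique hlim tendsto_const_nhds)

theorem measurable_gradient {v : 𝔼 → ℝ} (hv : ContDiff ℝ (⊤ : ℕ∞) v) :
    Measurable (gradient v) := (contDiff_gradient hv).continuous.measurable

theorem norm_gradient_mul_abs_divg_unitNormal_le {v : 𝔼 → ℝ} (hv : ContDiff ℝ (⊤ : ℕ∞) v) (x : 𝔼) :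
    ‖gradient v x‖ * |divg (unitNormal v) x| ≤
      |divg (gradient v) x| + ‖fderiv ℝ (gradient v) x‖ := by
  by_cases hx : gradient v x = 0
  · rw [hx, norm_zero, zero_mul]; positivity
  have hN : 0 < ‖gradient v x‖ := norm_pos_iff.2 hx
  rw [divg_unitNormal hv hx]
  have h1 : |⟪gradient v x, fderiv ℝ (gradient v) x (gradient v x)⟫| ≤
      ‖gradient v x‖ * (‖fderiv ℝ (gradient v) x‖ * ‖gradient v x‖) :=
    (abs_real_inner_le_norm _ _).trans (by gcongr; exact ContinuousLinearMap.le_opNorm _ _)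
  calc _ ≤ ‖gradient v x‖ * (‖gradient v x‖⁻¹ * |divg (gradient v) x| +
        (‖gradient v x‖⁻¹) ^ 3 *
          (‖gradient v x‖ * (‖fderiv ℝ (gradient v) x‖ * ‖gradient v x‖))) := by
        gcongr
        refine (abs_sub _ _).trans ?_
        rw [abs_mul, abs_mul, abs_of_pos (inv_pos.2 hN),
          abs_of_pos (pow_pos (inv_pos.2 hN) 3)]
        gcongr
    _ = _ := by field_simp

theorem integrableOn_norm_gradient_mul_abs_divg_unitNormal {Ω : Set 𝔼} (hb : IsBounded Ω)
    {v : 𝔼 → ℝ} (hv : ContDiff ℝ (⊤ : ℕ∞) v) :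
    IntegrableOn (fun x => ‖gradient v x‖ * |divg (unitNormal v) x|) Ω := by
  have hg : ContDiff ℝ 1 (gradient v) := (contDiff_gradient hv).of_le (by simp)
  have hDg : Continuous (fderiv ℝ (gradient v)) := hg.continuous_fderiv (by norm_num)
  have hdg := continuous_divg hg
  have hB : IntegrableOn (fun x => |divg (gradient v) x| + ‖fderiv ℝ (gradient v) x‖) Ω :=
    integrableOn_of_continuous hb (by fun_prop)
  have hm1 := (measurable_gradient hv).norm
  have hm2 := measurable_divg (unitNormal v)
  refine hB.mono' (by fun_prop) (Eventually.of_forall fun x => ?_)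
  rw [Real.norm_eq_abs, abs_of_nonneg (by positivity)]
  exact norm_gradient_mul_abs_divg_unitNormal_le hv x

theorem measurableSet_slab {Ω : Set 𝔼} (ho : IsOpen Ω) {v : 𝔼 → ℝ} (hv : Continuous v) (a b : ℝ) :
    MeasurableSet (Ω ∩ {x | a < |v x| ∧ |v x| ≤ b}) :=
  ho.measurableSet.inter ((measurableSet_lt measurable_const hv.abs.measurable).inter
    (measurableSet_le hv.abs.measurable measurable_const))

/-- The pointwise inequality behind the monotonicity formula. -/
theorem kernel_inequality {k t u N z h φ s b d m : ℝ} (hN : 0 ≤ N) (hb0 : 0 ≤ b)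
    (hk : 0 ≤ k) (hφ : φ = b * (s + t ^ 2)) (hz : |z| ≤ d * N)
    (hu : φ * d ≤ u) (hφ0 : 0 ≤ φ) (hm : m = k + 1) :
    k * t ^ 2 * b * N ≤ (N * (m * φ - k * b * s) - N⁻¹ * (φ * N ^ 2 - k * b * z * z)
      - (φ * z) * h) + N * |h| * u := by
  have h1 : -(φ * z * h) ≥ -(N * |h| * u) := by
    have : φ * z * h ≤ N * |h| * u := by
      calc φ * z * h ≤ |φ * z * h| := le_abs_self _
        _ = φ * |z| * |h| := by rw [abs_mul, abs_mul, abs_of_nonneg hφ0]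
        _ ≤ φ * (d * N) * |h| := by gcongr
        _ = (φ * d) * (N * |h|) := by ring
        _ ≤ u * (N * |h|) := by gcongr
        _ = _ := by ring
    linarith
  have h2 : N⁻¹ * (φ * N ^ 2 - k * b * z * z) ≤ N * φ := by
    rcases hN.eq_or_lt with hN0 | hN0
    · simp [← hN0]
    · rw [inv_mul_le_iff₀ hN0]
      have : 0 ≤ k * b * (z * z) := mul_nonneg (mul_nonneg hk hb0) (mul_self_nonneg z)
      nlinarith
  have h3 : N * (m * φ - k * b * s) - N * φ = k * t ^ 2 * b * N := by
    rw [hm, hφ]; ring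
  linarith

theorem rpow_kernel_le {s t k d : ℝ} (ht : 0 < t) (hs : s = d ^ 2) :
    (s + t ^ 2) ^ (-k / 2) * d ≤ (s + t ^ 2) ^ ((1 - k) / 2) := by
  have hpos : 0 < s + t ^ 2 := by rw [hs]; positivity
  have : d ≤ (s + t ^ 2) ^ (1 / 2 : ℝ) := by
    rw [← Real.sqrt_eq_rpow]
    exact Real.le_sqrt_of_sq_le (by rw [hs]; nlinarith)
  calc _ ≤ (s + t ^ 2) ^ (-k / 2) * (s + t ^ 2) ^ (1 / 2 : ℝ) := by gcongr
    _ = _ := by rw [← Real.rpow_add hpos]; ring_nf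

theorem integral_monotonicity {Ω : Set 𝔼} (ho : IsOpen Ω) (hb : IsBounded Ω)
    {v : 𝔼 → ℝ} (hv : ContDiff ℝ (⊤ : ℕ∞) v) (h0 : ∀ x ∈ frontier Ω, v x = 0) {a b : ℝ}
    (ha : 0 < a) (hab : a ≤ b) {k : ℝ} (hk : 0 ≤ k) (hkn : (n : ℝ) = k + 1) (x₀ : 𝔼) {t : ℝ}
    (ht : 0 < t) :
    ∫ x in Ω ∩ {x | a < |v x| ∧ |v x| ≤ b},
        k * t ^ 2 * (‖x - x₀‖ ^ 2 + t ^ 2) ^ (-k / 2 - 1) * ‖gradient v x‖ ≤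
      ∫ x in Ω ∩ {x | a < |v x| ∧ |v x| ≤ b},
        ‖gradient v x‖ * |divg (unitNormal v) x| * (‖x - x₀‖ ^ 2 + t ^ 2) ^ ((1 - k) / 2) := by
  have hpos : ∀ x : 𝔼, 0 < ‖x - x₀‖ ^ 2 + t ^ 2 := fun x => by positivity
  have hcd : ∀ q : ℝ, ContDiff ℝ 1 fun x : 𝔼 => (‖x - x₀‖ ^ 2 + t ^ 2) ^ q := fun q =>
    (((contDiff_id.sub contDiff_const).norm_sq ℝ).add contDiff_const).rpow_const_of_ne
      fun x => (hpos x).ne'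
  set X : 𝔼 → 𝔼 := fun x => (‖x - x₀‖ ^ 2 + t ^ 2) ^ (-k / 2) • (x - x₀) with hXdef
  have hX : ContDiff ℝ 1 X := (hcd _).smul (contDiff_id.sub contDiff_const)
  have hfv := setIntegral_firstVariation_eq_zero ho hb hv h0 ha hab hX
  set S := Ω ∩ {x | a < |v x| ∧ |v x| ≤ b} with hS
  have hSΩ : S ⊆ Ω := Set.inter_subset_left
  have hg : ContDiff ℝ 1 (gradient v) := (contDiff_gradient hv).of_le (by simp)
  have hgc := hg.continuous
  have hI := (integrableOn_norm_gradient_mul_abs_divg_unitNormal hb hv).mono_set hSΩ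
  have hIu : IntegrableOn (fun x => ‖gradient v x‖ * |divg (unitNormal v) x| *
      (‖x - x₀‖ ^ 2 + t ^ 2) ^ ((1 - k) / 2)) S := by
    obtain ⟨C, hC⟩ := hb.isCompact_closure.exists_bound_of_continuousOn
      (hcd ((1 - k) / 2)).continuous.continuousOn
    refine Integrable.mul_bdd (c := C) hI ((hcd _).continuous.aestronglyMeasurable) ?_
    refine (ae_restrict_iff' (measurableSet_slab ho hv.continuous a b)).2
      (Eventually.of_forall fun x hx => hC x (subset_closure (hSΩ hx)))
  have hIl : IntegrableOn (fun x => k * t ^ 2 * (‖x - x₀‖ ^ 2 + t ^ 2) ^ (-k / 2 - 1) *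
      ‖gradient v x‖) S := by
    have := (hcd (-k / 2 - 1)).continuous
    exact (integrableOn_of_continuous hb (by fun_prop)).mono_set hSΩ
  have hfd : ∀ x, HasFDerivAt (fun x : 𝔼 => (‖x - x₀‖ ^ 2 + t ^ 2) ^ (-k / 2))
      ((-k / 2 * (‖x - x₀‖ ^ 2 + t ^ 2) ^ (-k / 2 - 1)) •
        ((2 : ℕ) • (innerSL ℝ (x - x₀)).comp (ContinuousLinearMap.id ℝ 𝔼))) x := fun x =>
    ((((hasFDerivAt_id x).sub_const x₀).norm_sq).add_const (t ^ 2)).rpow_const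
      (Or.inl (hpos x).ne')
  have hfdw : ∀ x w, fderiv ℝ (fun x : 𝔼 => (‖x - x₀‖ ^ 2 + t ^ 2) ^ (-k / 2)) x w =
      -(k * (‖x - x₀‖ ^ 2 + t ^ 2) ^ (-k / 2 - 1) * ⟪x - x₀, w⟫) := by
    intro x w
    rw [(hfd x).fderiv]
    simp only [ContinuousLinearMap.comp_id, smul_apply, innerSL_apply_apply, nsmul_eq_mul,
      smul_eq_mul]
    push_cast
    ring
  have hXder : ∀ x w, fderiv ℝ X x w = (‖x - x₀‖ ^ 2 + t ^ 2) ^ (-k / 2) • w -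
      (k * (‖x - x₀‖ ^ 2 + t ^ 2) ^ (-k / 2 - 1) * ⟪x - x₀, w⟫) • (x - x₀) := by
    intro x w
    have h1 : HasFDerivAt X _ x := (hfd x).smul ((hasFDerivAt_id x).sub_const x₀)
    rw [h1.fderiv, ← (hfd x).fderiv]
    rw [add_apply, ContinuousLinearMap.smulRight_apply, hfdw, neg_smul, ← sub_eq_add_neg]
    rfl
  have hXdiv : ∀ x, divg X x = n * (‖x - x₀‖ ^ 2 + t ^ 2) ^ (-k / 2) -
      k * (‖x - x₀‖ ^ 2 + t ^ 2) ^ (-k / 2 - 1) * ‖x - x₀‖ ^ 2 := by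
    intro x
    rw [hXdef, divg_smul (hfd x).differentiableAt (by fun_prop), divg_sub_const_id, hfdw,
      real_inner_self_eq_norm_sq]
    ring
  have hpt : ∀ x, k * t ^ 2 * (‖x - x₀‖ ^ 2 + t ^ 2) ^ (-k / 2 - 1) * ‖gradient v x‖ ≤
      (‖gradient v x‖ * divg X x
      - ‖gradient v x‖⁻¹ * ⟪fderiv ℝ X x (gradient v x), gradient v x⟫
      - ⟪X x, gradient v x⟫ * divg (unitNormal v) x) +
      ‖gradient v x‖ * |divg (unitNormal v) x| * (‖x - x₀‖ ^ 2 + t ^ 2) ^ ((1 - k) / 2) := by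
    intro x
    rw [hXdiv, hXder, inner_sub_left, inner_smul_left, inner_smul_left, inner_smul_left,
      real_inner_self_eq_norm_sq]
    refine kernel_inequality (norm_nonneg _) (by positivity) hk ?_ ?_
      (rpow_kernel_le (d := ‖x - x₀‖) ht rfl) (by positivity) hkn
    · rw [Real.rpow_sub (hpos x), Real.rpow_one, div_mul_cancel₀ _ (hpos x).ne']
    · exact abs_real_inner_le_norm _ _
  have hIf : IntegrableOn (fun x => ‖gradient v x‖ * divg X x
      - ‖gradient v x‖⁻¹ * ⟪fderiv ℝ X x (gradient v x), gradient v x⟫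
      - ⟪X x, gradient v x⟫ * divg (unitNormal v) x) S := by
    have hDg : Continuous (fderiv ℝ (gradient v)) := hg.continuous_fderiv (by norm_num)
    have hDX : Continuous (fderiv ℝ X) := hX.continuous_fderiv (by norm_num)
    have hXc := hX.continuous
    have hdX := continuous_divg hX
    have hdg := continuous_divg hg
    have hB : IntegrableOn (fun x => ‖gradient v x‖ * |divg X x| +
        ‖fderiv ℝ X x‖ * ‖gradient v x‖ + ‖X x‖ * (|divg (gradient v) x| +
          ‖fderiv ℝ (gradient v) x‖)) S :=
      (integrableOn_of_continuous hb (by fun_prop)).mono_set hSΩ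
    have hm := measurable_divg (unitNormal v)
    have hm2 : Measurable fun x => ‖gradient v x‖ := hgc.norm.measurable
    have hm3 : Measurable fun x => ⟪fderiv ℝ X x (gradient v x), gradient v x⟫ :=
      (show Continuous _ by fun_prop).measurable
    have hm4 : Measurable fun x => ⟪X x, gradient v x⟫ :=
      (show Continuous _ by fun_prop).measurable
    refine Integrable.mono' hB (Measurable.aestronglyMeasurable (by fun_prop))
      (Eventually.of_forall fun x => ?_)
    rw [Real.norm_eq_abs]
    refine (abs_sub _ _).trans (add_le_add ((abs_sub _ _).trans (add_le_add ?_ ?_)) ?_)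
    · rw [abs_mul, abs_of_nonneg (norm_nonneg _)]
    · rw [abs_mul, abs_of_nonneg (inv_nonneg.2 (norm_nonneg _))]
      have h1 : |⟪fderiv ℝ X x (gradient v x), gradient v x⟫| ≤
          (‖fderiv ℝ X x‖ * ‖gradient v x‖) * ‖gradient v x‖ :=
        (abs_real_inner_le_norm _ _).trans (by gcongr; exact ContinuousLinearMap.le_opNorm _ _)
      rcases (norm_nonneg (gradient v x)).eq_or_lt with hN | hN
      · simp [← hN]
      · rw [inv_mul_le_iff₀ hN]
        linarith
    · rw [abs_mul]
      calc _ ≤ ‖X x‖ * ‖gradient v x‖ * |divg (unitNormal v) x| := by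
            gcongr
            exact abs_real_inner_le_norm _ _
        _ ≤ _ := by
            rw [mul_assoc]
            gcongr
            exact norm_gradient_mul_abs_divg_unitNormal_le hv x
  calc _ ≤ ∫ x in S, ((‖gradient v x‖ * divg X x
      - ‖gradient v x‖⁻¹ * ⟪fderiv ℝ X x (gradient v x), gradient v x⟫
      - ⟪X x, gradient v x⟫ * divg (unitNormal v) x) +
      ‖gradient v x‖ * |divg (unitNormal v) x| * (‖x - x₀‖ ^ 2 + t ^ 2) ^ ((1 - k) / 2)) :=
        integral_mono hIl (Integrable.add hIf hIu) hpt
    _ = _ := by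
      rw [integral_add hIf hIu, hfv, zero_add]

theorem rpow_ball_lower {s t k : ℝ} (ht : 0 < t) (hs : 0 ≤ s) (hst : s ≤ t ^ 2) (hk : 0 ≤ k) :
    k * 2 ^ (-k / 2 - 1) * t ^ (-k) ≤ k * t ^ 2 * (s + t ^ 2) ^ (-k / 2 - 1) := by
  have hpos : 0 < s + t ^ 2 := by positivity
  have h1 : (2 * t ^ 2) ^ (-k / 2 - 1) ≤ (s + t ^ 2) ^ (-k / 2 - 1) :=
    Real.rpow_le_rpow_of_nonpos hpos (by linarith) (by linarith)
  have h2 : (2 * t ^ 2) ^ (-k / 2 - 1) = 2 ^ (-k / 2 - 1) * (t ^ (-k) * (t ^ 2)⁻¹) := by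
    rw [Real.mul_rpow (by norm_num) (by positivity)]
    congr 1
    rw [← Real.rpow_natCast, ← Real.rpow_mul ht.le, ← Real.rpow_neg ht.le, ← Real.rpow_add ht]
    congr 1
    push_cast
    ring
  rw [h2] at h1
  calc k * 2 ^ (-k / 2 - 1) * t ^ (-k)
      = k * t ^ 2 * (2 ^ (-k / 2 - 1) * (t ^ (-k) * (t ^ 2)⁻¹)) := by field_simp
    _ ≤ _ := by gcongr

/-- Monotonicity-type inequality for the measure `|∇v| dx` on the slab `a < |v| ≤ b`. -/
theorem lintegral_ball_le_potential {Ω : Set 𝔼} (ho : IsOpen Ω) (hb : IsBounded Ω)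
    {v : 𝔼 → ℝ} (hv : ContDiff ℝ (⊤ : ℕ∞) v) (h0 : ∀ x ∈ frontier Ω, v x = 0) {a b : ℝ}
    (ha : 0 < a) (hab : a ≤ b) {k : ℝ} (hk : 0 ≤ k) (hkn : (n : ℝ) = k + 1) (x₀ : 𝔼) {t : ℝ}
    (ht : 0 < t) :
    ENNReal.ofReal (k * 2 ^ (-k / 2 - 1) * t ^ (-k)) *
      ∫⁻ x in (Ω ∩ {x | a < |v x| ∧ |v x| ≤ b}) ∩ Metric.ball x₀ t,
        ENNReal.ofReal ‖gradient v x‖ ≤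
      ∫⁻ x in Ω ∩ {x | a < |v x| ∧ |v x| ≤ b},
        ENNReal.ofReal (‖gradient v x‖ * |divg (unitNormal v) x|) *
          ENNReal.ofReal ((dist x₀ x ^ 2 + t ^ 2) ^ ((1 - k) / 2)) := by
  have hmain := integral_monotonicity ho hb hv h0 ha hab hk hkn x₀ ht
  have hm := measurableSet_slab ho hv.continuous a b
  set S := Ω ∩ {x | a < |v x| ∧ |v x| ≤ b} with hS
  have hSΩ : S ⊆ Ω := Set.inter_subset_left
  have hpos : ∀ x : 𝔼, 0 < ‖x - x₀‖ ^ 2 + t ^ 2 := fun x => by positivity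
  have hcd : ∀ q : ℝ, Continuous fun x : 𝔼 => (‖x - x₀‖ ^ 2 + t ^ 2) ^ q := fun q =>
    ((((contDiff_id.sub contDiff_const).norm_sq ℝ).add contDiff_const).rpow_const_of_ne
      (n := 1) fun x => (hpos x).ne').continuous
  have hgc := (contDiff_gradient hv).continuous
  have hm2 := measurable_divg (unitNormal v)
  have hIl : IntegrableOn (fun x => k * t ^ 2 * (‖x - x₀‖ ^ 2 + t ^ 2) ^ (-k / 2 - 1) *
      ‖gradient v x‖) S := by
    have := hcd (-k / 2 - 1)
    exact (integrableOn_of_continuous hb (by fun_prop)).mono_set hSΩ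
  have hmg : Measurable fun x => ENNReal.ofReal ‖gradient v x‖ := hgc.norm.measurable.ennreal_ofReal
  rw [← lintegral_const_mul _ hmg]
  calc _ ≤ ∫⁻ x in S ∩ Metric.ball x₀ t, ENNReal.ofReal
        (k * t ^ 2 * (‖x - x₀‖ ^ 2 + t ^ 2) ^ (-k / 2 - 1) * ‖gradient v x‖) := by
        refine setLIntegral_mono' (hm.inter Metric.isOpen_ball.measurableSet) fun x hx => ?_
        rw [← ENNReal.ofReal_mul (by positivity)]
        refine ENNReal.ofReal_le_ofReal (mul_le_mul_of_nonneg_right ?_ (norm_nonneg _))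
        have h1 : ‖x - x₀‖ < t := by simpa [dist_eq_norm] using hx.2
        exact rpow_ball_lower ht (by positivity) (by gcongr) hk
    _ ≤ ∫⁻ x in S, ENNReal.ofReal
        (k * t ^ 2 * (‖x - x₀‖ ^ 2 + t ^ 2) ^ (-k / 2 - 1) * ‖gradient v x‖) :=
        lintegral_mono_set Set.inter_subset_left
    _ = ENNReal.ofReal (∫ x in S,
        k * t ^ 2 * (‖x - x₀‖ ^ 2 + t ^ 2) ^ (-k / 2 - 1) * ‖gradient v x‖) :=
        (ofReal_integral_eq_lintegral_ofReal hIl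
          (Eventually.of_forall fun x => by positivity)).symm
    _ ≤ ENNReal.ofReal (∫ x in S, ‖gradient v x‖ * |divg (unitNormal v) x| *
          (‖x - x₀‖ ^ 2 + t ^ 2) ^ ((1 - k) / 2)) := ENNReal.ofReal_le_ofReal hmain
    _ ≤ ∫⁻ x in S, ENNReal.ofReal (‖gradient v x‖ * |divg (unitNormal v) x| *
          (‖x - x₀‖ ^ 2 + t ^ 2) ^ ((1 - k) / 2)) := by
        refine ENNReal.ofReal_le_of_le_toReal ?_
        rw [integral_eq_lintegral_of_nonneg_ae (Eventually.of_forall fun x => by positivity)]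
        have h1 := hcd ((1 - k) / 2)
        have h2 := hgc.norm.measurable
        exact Measurable.aestronglyMeasurable (by fun_prop)
    _ = _ := by
        refine lintegral_congr fun x => ?_
        rw [ENNReal.ofReal_mul (by positivity), dist_comm, dist_eq_norm]

/-- Along a line in the direction of its approximate gradient `g`, the function `w` meets the slab
`a < w ≤ a + δ` at a point of every sufficiently fine grid. -/
theorem exists_int_mem_slab {w : 𝔼 → ℝ} (hw : Continuous w) {x g : 𝔼} {ρ δ a : ℝ} (hδ : 0 < δ)
    (hg : 0 < ‖g‖) (hρ : 0 < ρ)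
    (hlin : ∀ z ∈ Metric.ball x ρ, ∀ z' ∈ Metric.ball x ρ,
      |w z' - w z - ⟪g, z' - z⟫| ≤ ‖g‖ / 8 * ‖z' - z‖)
    (hδρ : δ ≤ 5 / 32 * ‖g‖ * ρ) (hx : a < w x) (hx' : w x ≤ a + δ) {y : 𝔼}
    (hy : y ∈ Metric.ball x (ρ / 4)) :
    ∃ j : ℤ, |(j : ℝ)| ≤ ρ / (δ / (2 * ‖g‖)) ∧
      y + ((j : ℝ) * (δ / (2 * ‖g‖))) • (‖g‖⁻¹ • g) ∈ Metric.ball x ρ ∧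
      a < w (y + ((j : ℝ) * (δ / (2 * ‖g‖))) • (‖g‖⁻¹ • g)) ∧
      w (y + ((j : ℝ) * (δ / (2 * ‖g‖))) • (‖g‖⁻¹ • g)) ≤ a + δ := by
  set η := δ / (2 * ‖g‖) with hη
  set e := ‖g‖⁻¹ • g with he
  have hηpos : 0 < η := by positivity
  have hηρ : η ≤ 5 / 64 * ρ := by
    rw [hη, div_le_iff₀ (by positivity)]
    linarith
  have hηg : ‖g‖ * η = δ / 2 := by rw [hη]; field_simp
  have hen : ‖e‖ = 1 := by rw [he, norm_smul, norm_inv, norm_norm, inv_mul_cancel₀ hg.ne']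
  have hge : ⟪g, e⟫ = ‖g‖ := by
    rw [he, inner_smul_right, real_inner_self_eq_norm_sq]
    field_simp
  have hyx : ‖y - x‖ < ρ / 4 := by rwa [← dist_eq_norm]
  have hmem : ∀ s : ℝ, |s| ≤ 3 / 4 * ρ → y + s • e ∈ Metric.ball x ρ := by
    intro s hs
    rw [Metric.mem_ball, dist_eq_norm]
    calc ‖y + s • e - x‖ = ‖(y - x) + s • e‖ := by congr 1; abel
      _ ≤ ‖y - x‖ + ‖s • e‖ := norm_add_le _ _
      _ = ‖y - x‖ + |s| := by rw [norm_smul, hen, mul_one, Real.norm_eq_abs]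
      _ < ρ := by linarith
  have hline : ∀ s s' : ℝ, |s| ≤ 3 / 4 * ρ → |s'| ≤ 3 / 4 * ρ →
      |w (y + s' • e) - w (y + s • e) - ‖g‖ * (s' - s)| ≤ ‖g‖ / 8 * |s' - s| := by
    intro s s' hs hs'
    have h := hlin _ (hmem s hs) _ (hmem s' hs')
    have hd : y + s' • e - (y + s • e) = (s' - s) • e := by rw [sub_smul]; abel
    rw [hd, inner_smul_right, hge, norm_smul, hen, mul_one, Real.norm_eq_abs] at h
    rwa [mul_comm ‖g‖ (s' - s)]
  have hwy : |w y - w x| ≤ 9 / 32 * ‖g‖ * ρ := by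
    have hxb : x ∈ Metric.ball x ρ := Metric.mem_ball_self hρ
    have h := hlin x hxb y (Metric.ball_subset_ball (by linarith) hy)
    have h2 := abs_real_inner_le_norm g (y - x)
    have h3 : ‖g‖ * ‖y - x‖ ≤ ‖g‖ * (ρ / 4) := by gcongr
    have h4 := abs_le.1 h
    have h5 := abs_le.1 h2
    rw [abs_le]
    constructor <;> linarith [h4.1, h4.2, h5.1, h5.2]
  have hwy' := abs_le.1 hwy
  have hgρ : 0 < ‖g‖ * ρ := by positivity
  have hcont : Continuous fun s : ℝ => w (y + s • e) := by fun_prop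
  obtain ⟨s₁, hs₁, hws₁⟩ : ∃ s ∈ Set.Icc (-(ρ / 2)) (ρ / 2), w (y + s • e) = a := by
    refine intermediate_value_Icc (by linarith) hcont.continuousOn ⟨?_, ?_⟩
    · have h := abs_le.1 (hline 0 (-(ρ / 2)) (by rw [abs_zero]; linarith)
        (by rw [abs_neg, abs_of_pos] <;> linarith))
      rw [sub_zero, zero_smul, add_zero, abs_neg, abs_of_pos (by linarith : (0 : ℝ) < ρ / 2)] at h
      linarith [h.2]
    · have h := abs_le.1 (hline 0 (ρ / 2) (by rw [abs_zero]; linarith)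
        (by rw [abs_of_pos] <;> linarith))
      rw [sub_zero, zero_smul, add_zero, abs_of_pos (by linarith : (0 : ℝ) < ρ / 2)] at h
      linarith [h.1]
  have hs₁abs : |s₁| ≤ ρ / 2 := abs_le.2 hs₁
  refine ⟨⌊s₁ / η⌋ + 1, ?_⟩
  set s₂ : ℝ := ((⌊s₁ / η⌋ + 1 : ℤ) : ℝ) * η with hs₂
  have hlt : s₁ < s₂ := by
    rw [hs₂, ← div_lt_iff₀ hηpos]
    push_cast
    exact Int.lt_floor_add_one _
  have hle : s₂ ≤ s₁ + η := by
    have : (⌊s₁ / η⌋ : ℝ) * η ≤ s₁ := by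
      rw [← le_div_iff₀ hηpos]
      exact Int.floor_le _
    rw [hs₂]
    push_cast
    linarith
  have hs₂abs : |s₂| ≤ 3 / 4 * ρ := by
    have := abs_le.1 hs₁abs
    rw [abs_le]
    constructor <;> linarith
  have h := abs_le.1 (hline s₁ s₂ (by linarith) hs₂abs)
  rw [abs_of_pos (by linarith), hws₁] at h
  have hpos : 0 < ‖g‖ * (s₂ - s₁) := mul_pos hg (by linarith)
  have hub : ‖g‖ * (s₂ - s₁) ≤ δ / 2 := by
    rw [← hηg]
    gcongr
    linarith
  refine ⟨?_, hmem s₂ hs₂abs, by linarith [h.1], by linarith [h.2]⟩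
  rw [le_div_iff₀ hηpos, ← abs_of_pos hηpos, ← abs_mul, abs_of_pos hηpos]
  linarith

theorem volume_ball_le_mul_volume_slab {w : 𝔼 → ℝ} (hw : Continuous w) {x g : 𝔼} {ρ δ a : ℝ}
    (hδ : 0 < δ) (hg : 0 < ‖g‖) (hρ : 0 < ρ)
    (hlin : ∀ z ∈ Metric.ball x ρ, ∀ z' ∈ Metric.ball x ρ,
      |w z' - w z - ⟪g, z' - z⟫| ≤ ‖g‖ / 8 * ‖z' - z‖)
    (hδρ : δ ≤ 5 / 32 * ‖g‖ * ρ) (hx : a < w x) (hx' : w x ≤ a + δ) :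
    volume (Metric.ball x (ρ / 4)) ≤ ENNReal.ofReal (6 * ρ * ‖g‖ / δ) *
      volume ({z | a < w z ∧ w z ≤ a + δ} ∩ Metric.ball x ρ) := by
  set η := δ / (2 * ‖g‖) with hη
  have hηpos : 0 < η := by positivity
  set N : ℤ := ⌊ρ / η⌋ with hN
  set T := {z | a < w z ∧ w z ≤ a + δ} ∩ Metric.ball x ρ with hT
  have hcover : Metric.ball x (ρ / 4) ⊆ ⋃ j ∈ Finset.Icc (-N) N,
      (fun y => y + ((j : ℝ) * η) • (‖g‖⁻¹ • g)) ⁻¹' T := by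
    intro y hy
    obtain ⟨j, hj, hj1, hj2, hj3⟩ := exists_int_mem_slab hw hδ hg hρ hlin hδρ hx hx' hy
    simp only [Set.mem_iUnion]
    refine ⟨j, ?_, ⟨hj2, hj3⟩, hj1⟩
    rw [Finset.mem_Icc, ← abs_le, hN, Int.le_floor]
    exact_mod_cast hj
  have hN0 : 0 ≤ N := Int.floor_nonneg.2 (by positivity)
  have hcard : ((Finset.Icc (-N) N).card : ℝ) ≤ 6 * ρ * ‖g‖ / δ := by
    rw [Int.card_Icc]
    have h1 : (((N + 1 - -N).toNat : ℤ) : ℝ) = 2 * N + 1 := by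
      rw [Int.toNat_of_nonneg (by omega)]
      push_cast
      ring
    have h1' : (((N + 1 - -N).toNat : ℕ) : ℝ) = 2 * N + 1 := by exact_mod_cast h1
    rw [h1']
    have h2 : (N : ℝ) ≤ ρ / η := Int.floor_le _
    have h3 : 1 ≤ ρ / η := by
      rw [le_div_iff₀ hηpos, hη, one_mul, div_le_iff₀ (by positivity)]
      nlinarith [mul_pos hg hρ]
    have h4 : ρ / η = 2 * ρ * ‖g‖ / δ := by rw [hη]; field_simp
    have h5 : 6 * ρ * ‖g‖ / δ = 3 * (2 * ρ * ‖g‖ / δ) := by ring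
    rw [h5, ← h4]
    linarith
  calc volume (Metric.ball x (ρ / 4)) ≤ volume (⋃ j ∈ Finset.Icc (-N) N,
        (fun y => y + ((j : ℝ) * η) • (‖g‖⁻¹ • g)) ⁻¹' T) := measure_mono hcover
    _ ≤ ∑ j ∈ Finset.Icc (-N) N, volume ((fun y => y + ((j : ℝ) * η) • (‖g‖⁻¹ • g)) ⁻¹' T) :=
        measure_biUnion_finset_le _ _
    _ = ((Finset.Icc (-N) N).card : ℝ≥0∞) * volume T := by
        simp only [measure_preimage_add_right, Finset.sum_const, nsmul_eq_mul]
    _ ≤ _ := by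
        gcongr
        rw [← ENNReal.ofReal_natCast]
        exact ENNReal.ofReal_le_ofReal hcard

theorem abs_sub_sub_inner_gradient_le {v : 𝔼 → ℝ} (hv : ContDiff ℝ (⊤ : ℕ∞) v) {x : 𝔼} {ρ C : ℝ}
    (hL : ∀ z ∈ Metric.ball x ρ, ‖gradient v z - gradient v x‖ ≤ C) {z z' : 𝔼}
    (hz : z ∈ Metric.ball x ρ) (hz' : z' ∈ Metric.ball x ρ) :
    |v z' - v z - ⟪gradient v x, z' - z⟫| ≤ C * ‖z' - z‖ := by
  have hd := hv.differentiable (by simp)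
  have h := (convex_ball x ρ).norm_image_sub_le_of_norm_hasFDerivWithin_le' (f := v)
    (f' := fderiv ℝ v) (φ := fderiv ℝ v x) (C := C)
    (fun y _ => (hd y).hasFDerivAt.hasFDerivWithinAt) (fun y hy => ?_) hz hz'
  · rwa [gradient_apply_fderiv, Real.norm_eq_abs] at h
  · refine le_trans (le_of_eq ?_) (hL y hy)
    rw [← (InnerProductSpace.toDual ℝ 𝔼).norm_map]
    congr 1
    ext u
    simp

/-- Lower density bound for the measure `δ⁻¹ |∇v| dx` on the slab `a < |v| ≤ a + δ` near a point
where the gradient does not vanish. -/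
theorem density_lower_bound {Ω : Set 𝔼} {v : 𝔼 → ℝ}
    (hv : ContDiff ℝ (⊤ : ℕ∞) v) {x : 𝔼} {ρ δ a : ℝ} (ha : 0 < a) (hδ : 0 < δ)
    (hg : 0 < ‖gradient v x‖) (hρ : 0 < ρ) (hΩ : Metric.ball x ρ ⊆ Ω)
    (hL : ∀ z ∈ Metric.ball x ρ, ‖gradient v z - gradient v x‖ ≤ ‖gradient v x‖ / 8)
    (hδρ : δ ≤ 5 / 32 * ‖gradient v x‖ * ρ) (hx : a < |v x|) (hx' : |v x| ≤ a + δ) :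
    ENNReal.ofReal ((volume (Metric.ball (0 : 𝔼) 1)).toReal / (4 ^ n * 12) * ρ ^ ((n : ℝ) - 1)) ≤
      ∫⁻ y in (Ω ∩ {x | a < |v x| ∧ |v x| ≤ a + δ}) ∩ Metric.ball x ρ,
        ENNReal.ofReal (‖gradient v y‖ / δ) := by
  set g := gradient v x with hgdef
  set S := (Ω ∩ {x | a < |v x| ∧ |v x| ≤ a + δ}) ∩ Metric.ball x ρ with hS
  have hlin := fun z hz z' hz' => abs_sub_sub_inner_gradient_le hv hL (z := z) (z' := z') hz hz'
  have hvol : volume (Metric.ball x (ρ / 4)) ≤ ENNReal.ofReal (6 * ρ * ‖g‖ / δ) * volume S := by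
    rcases le_or_gt 0 (v x) with hpos | hneg
    · rw [abs_of_nonneg hpos] at hx hx'
      refine (volume_ball_le_mul_volume_slab hv.continuous hδ hg hρ hlin hδρ hx hx').trans ?_
      gcongr
      rintro z ⟨⟨h1, h2⟩, h3⟩
      refine ⟨⟨hΩ h3, ?_⟩, h3⟩
      rw [Set.mem_ofPred_eq, abs_of_pos (ha.trans h1)]
      exact ⟨h1, h2⟩
    · rw [abs_of_neg hneg] at hx hx'
      have hg' : 0 < ‖-g‖ := by rwa [norm_neg]
      have hlin' : ∀ z ∈ Metric.ball x ρ, ∀ z' ∈ Metric.ball x ρ,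
          |(fun y => -v y) z' - (fun y => -v y) z - ⟪-g, z' - z⟫| ≤ ‖-g‖ / 8 * ‖z' - z‖ := by
        intro z hz z' hz'
        have := hlin z hz z' hz'
        rw [norm_neg, inner_neg_left, ← abs_neg]
        convert this using 2
        ring
      have h := volume_ball_le_mul_volume_slab (w := fun y => -v y) hv.continuous.neg hδ hg' hρ
        hlin' (by rwa [norm_neg]) hx hx'
      rw [norm_neg] at h
      refine h.trans ?_
      gcongr
      rintro z ⟨⟨h1, h2⟩, h3⟩
      refine ⟨⟨hΩ h3, ?_⟩, h3⟩
      have : v z < 0 := by linarith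
      rw [Set.mem_ofPred_eq, abs_of_neg this]
      exact ⟨h1, h2⟩
  have hSm : MeasurableSet ({x | a < |v x| ∧ |v x| ≤ a + δ} ∩ Metric.ball x ρ) :=
    ((measurableSet_lt measurable_const hv.continuous.abs.measurable).inter
      (measurableSet_le hv.continuous.abs.measurable measurable_const)).inter
        Metric.isOpen_ball.measurableSet
  have hSe : S = {x | a < |v x| ∧ |v x| ≤ a + δ} ∩ Metric.ball x ρ := by
    rw [hS, Set.inter_assoc, Set.inter_eq_right]
    exact Set.inter_subset_right.trans hΩ
  have hlow : ENNReal.ofReal (‖g‖ / (2 * δ)) * volume S ≤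
      ∫⁻ y in S, ENNReal.ofReal (‖gradient v y‖ / δ) := by
    rw [← setLIntegral_const]
    refine setLIntegral_mono' (hSe ▸ hSm) fun y hy => ENNReal.ofReal_le_ofReal ?_
    have h1 := hL y hy.2
    have h2 := norm_sub_norm_le g (gradient v y)
    rw [norm_sub_rev] at h2
    rw [div_le_div_iff₀ (by positivity) hδ]
    nlinarith
  refine le_trans ?_ hlow
  have hball : volume (Metric.ball x (ρ / 4)) =
      ENNReal.ofReal ((ρ / 4) ^ n * (volume (Metric.ball (0 : 𝔼) 1)).toReal) := by
    rw [Measure.addHaar_ball_of_pos _ _ (by positivity), finrank_euclideanSpace_fin,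
      ENNReal.ofReal_mul (by positivity), ENNReal.ofReal_toReal measure_ball_lt_top.ne]
  rw [hball] at hvol
  have hn' : ρ ^ ((n : ℝ) - 1) = ρ ^ n / ρ := by
    rw [Real.rpow_sub hρ, Real.rpow_natCast, Real.rpow_one]
  calc _ = ENNReal.ofReal (1 / (12 * ρ)) *
        ENNReal.ofReal ((ρ / 4) ^ n * (volume (Metric.ball (0 : 𝔼) 1)).toReal) := by
        rw [← ENNReal.ofReal_mul (by positivity), hn']
        congr 1
        rw [div_pow]
        field_simp
    _ ≤ ENNReal.ofReal (1 / (12 * ρ)) * (ENNReal.ofReal (6 * ρ * ‖g‖ / δ) * volume S) := by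
        gcongr
    _ = _ := by
        rw [← mul_assoc, ← ENNReal.ofReal_mul (by positivity)]
        congr 2
        field_simp
        norm_num

theorem exists_radius {Ω : Set 𝔼} (ho : IsOpen Ω) (hb : IsBounded Ω) {v : 𝔼 → ℝ}
    (hv : ContDiff ℝ (⊤ : ℕ∞) v) (h0 : ∀ x ∈ frontier Ω, v x = 0) {a ε : ℝ} (ha : 0 < a)
    (hε : 0 < ε) :
    ∃ ρ, 0 < ρ ∧ ∀ x ∈ Ω, a ≤ |v x| → Metric.ball x ρ ⊆ Ω ∧
      ∀ z ∈ Metric.ball x ρ, ‖gradient v z - gradient v x‖ ≤ ε := by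
  obtain ⟨ρ₁, hρ₁, h1⟩ := (isCompact_closure_inter_superlevel hb hv.continuous
    a).exists_thickening_subset_open ho (closure_inter_superlevel_subset ho h0 ha)
  have huc := hb.isCompact_closure.uniformContinuousOn_of_continuous
    (contDiff_gradient hv).continuous.continuousOn
  obtain ⟨ρ₂, hρ₂, h2⟩ := Metric.uniformContinuousOn_iff.1 huc ε hε
  refine ⟨min ρ₁ ρ₂, lt_min hρ₁ hρ₂, fun x hx hxa => ?_⟩
  have hsub : Metric.ball x (min ρ₁ ρ₂) ⊆ Ω := fun z hz => h1 <| Metric.mem_thickening_iff.2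
    ⟨x, ⟨subset_closure hx, hxa⟩, lt_of_lt_of_le hz (min_le_left _ _)⟩
  refine ⟨hsub, fun z hz => ?_⟩
  rw [← dist_eq_norm]
  exact (h2 z (subset_closure (hsub hz)) x (subset_closure hx)
    (lt_of_lt_of_le hz (min_le_right _ _))).le

/-- Dimensional constant in `lintegral_slab_le`. -/
noncomputable def slabConst (n : ℕ) (k : ℝ) : ℝ≥0∞ :=
  ENNReal.ofReal (1 / (k * 2 ^ (-k / 2 - 1) *
    ((volume (Metric.ball (0 : EuclideanSpace ℝ (Fin n)) 1)).toReal / (4 ^ n * 12))) +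
      4 ^ k / (k * 2 ^ (-k / 2 - 1))) *
      (2 ^ (1 - 1 / k) * (1 - 2 ^ (1 - 1 / k - 1))⁻¹)

theorem slabConst_ne_top (n : ℕ) {k : ℝ} (hk : 0 < k) : slabConst n k ≠ ⊤ :=
  ENNReal.mul_ne_top ENNReal.ofReal_ne_top
    (one_sub_two_rpow_inv_ne_top (by have := one_div_pos.2 hk; linarith))

theorem lintegral_slab_le {Ω : Set 𝔼} (ho : IsOpen Ω) (hb : IsBounded Ω)
    {v : 𝔼 → ℝ} (hv : ContDiff ℝ (⊤ : ℕ∞) v) (h0 : ∀ x ∈ frontier Ω, v x = 0) {a ε : ℝ}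
    (ha : 0 < a) (hε : 0 < ε) {k : ℝ} (hk : 1 ≤ k) (hkn : (n : ℝ) = k + 1) :
    ∀ᶠ δ in 𝓝[>] (0 : ℝ),
      ∫⁻ x in (Ω ∩ {x | a < |v x| ∧ |v x| ≤ a + δ}) ∩ {x | ε ≤ ‖gradient v x‖},
        ENNReal.ofReal (‖gradient v x‖ / δ) ≤
      slabConst n k * (∫⁻ x in Ω ∩ {x | a < |v x| ∧ |v x| ≤ a + δ},
          ENNReal.ofReal (‖gradient v x‖ / δ)) ^ (1 / k) *
        ∫⁻ x in Ω ∩ {x | a < |v x| ∧ |v x| ≤ a + δ},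
          ENNReal.ofReal (‖gradient v x‖ * |divg (unitNormal v) x| / δ) := by
  obtain ⟨ρ, hρ, hball⟩ := exists_radius ho hb hv h0 ha (show 0 < ε / 8 by positivity)
  have hnp : 0 < n := by
    rcases Nat.eq_zero_or_pos n with h | h
    · rw [h] at hkn; norm_num at hkn; linarith
    · exact h
  have : Nonempty (Fin n) := ⟨⟨0, hnp⟩⟩
  filter_upwards [Ioc_mem_nhdsGT (show 0 < 5 / 32 * ε * ρ by positivity)] with δ hδ
  have hδ0 : 0 < δ := hδ.1
  have hms := measurableSet_slab ho hv.continuous a (a + δ)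
  set S := Ω ∩ {x | a < |v x| ∧ |v x| ≤ a + δ} with hS
  have hSΩ : S ⊆ Ω := Set.inter_subset_left
  have hmg : Measurable fun x => ‖gradient v x‖ := (measurable_gradient hv).norm
  have hmf : Measurable fun x => ENNReal.ofReal (‖gradient v x‖ / δ) :=
    (hmg.div_const δ).ennreal_ofReal
  have hmw : Measurable fun x => ENNReal.ofReal |divg (unitNormal v) x| :=
    ((continuous_abs.measurable).comp (measurable_divg _)).ennreal_ofReal
  set μ : Measure 𝔼 := (volume.restrict S).withDensity
    fun x => ENNReal.ofReal (‖gradient v x‖ / δ) with hμ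
  have hint : ∀ f : 𝔼 → ℝ≥0∞, Measurable f → ∫⁻ x, f x ∂μ =
      ∫⁻ x in S, ENNReal.ofReal (‖gradient v x‖ / δ) * f x := fun f hf => by
    rw [hμ, lintegral_withDensity_eq_lintegral_mul _ hmf hf]; rfl
  have hset : ∀ B : Set 𝔼, MeasurableSet B → μ B =
      ∫⁻ x in S ∩ B, ENNReal.ofReal (‖gradient v x‖ / δ) := fun B hB => by
    rw [hμ, withDensity_apply _ hB, Measure.restrict_restrict hB, Set.inter_comm]
  have hfinN : ∫⁻ x in S, ENNReal.ofReal (‖gradient v x‖ / δ) ≠ ⊤ := by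
    have h : IntegrableOn (fun x => ‖gradient v x‖ / δ) S :=
      (integrableOn_of_continuous hb
        ((contDiff_gradient hv).continuous.norm.div_const δ)).mono_set hSΩ
    exact h.lintegral_lt_top.ne
  have huniv : μ Set.univ = ∫⁻ x in S, ENNReal.ofReal (‖gradient v x‖ / δ) := by
    rw [hset _ MeasurableSet.univ, Set.inter_univ]
  have : IsFiniteMeasure μ := ⟨by rw [huniv]; exact hfinN.lt_top⟩
  have hwint : ∫⁻ x, ENNReal.ofReal |divg (unitNormal v) x| ∂μ =
      ∫⁻ x in S, ENNReal.ofReal (‖gradient v x‖ * |divg (unitNormal v) x| / δ) := by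
    rw [hint _ hmw]
    refine lintegral_congr fun x => ?_
    rw [← ENNReal.ofReal_mul (by positivity)]
    congr 1
    ring
  have hwfin : ∫⁻ x, ENNReal.ofReal |divg (unitNormal v) x| ∂μ ≠ ⊤ := by
    rw [hwint]
    have h : IntegrableOn (fun x => ‖gradient v x‖ * |divg (unitNormal v) x| / δ) S :=
      ((integrableOn_norm_gradient_mul_abs_divg_unitNormal hb hv).mono_set hSΩ).div_const δ
    exact h.lintegral_lt_top.ne
  have hGm : MeasurableSet (S ∩ {x | ε ≤ ‖gradient v x‖}) :=
    hms.inter (measurableSet_le measurable_const hmg)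
  have hc₁ : 0 < k * 2 ^ (-k / 2 - 1) := by positivity
  have hω : 0 < (volume (Metric.ball (0 : 𝔼) 1)).toReal :=
    ENNReal.toReal_pos (Metric.measure_ball_pos _ _ one_pos).ne' measure_ball_lt_top.ne
  have hc : 0 < (volume (Metric.ball (0 : 𝔼) 1)).toReal / (4 ^ n * 12) := by positivity
  have key := measure_le_mul_lintegral_of_potential_bound μ hmw hwfin hk hρ hc₁ hc hGm
    (fun x _ σ hσ => by
      have hσ0 : 0 < σ := hρ.trans_le hσ
      have h := lintegral_ball_le_potential ho hb hv h0 ha (by linarith : a ≤ a + δ)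
        (zero_le_one.trans hk) hkn x hσ0
      have hmk : Measurable fun y : 𝔼 =>
          ENNReal.ofReal ((dist x y ^ 2 + σ ^ 2) ^ ((1 - k) / 2)) := by
        fun_prop
      have hint' := hint (fun y => ENNReal.ofReal |divg (unitNormal v) y| *
        ENNReal.ofReal ((dist x y ^ 2 + σ ^ 2) ^ ((1 - k) / 2))) (hmw.mul hmk)
      rw [hset _ Metric.isOpen_ball.measurableSet, hint']
      have e1 : ∫⁻ y in S ∩ Metric.ball x σ, ENNReal.ofReal (‖gradient v y‖ / δ) =
          ENNReal.ofReal δ⁻¹ * ∫⁻ y in S ∩ Metric.ball x σ, ENNReal.ofReal ‖gradient v y‖ := by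
        rw [← lintegral_const_mul _ hmg.ennreal_ofReal]
        refine lintegral_congr fun y => ?_
        rw [← ENNReal.ofReal_mul (by positivity), mul_comm, div_eq_mul_inv]
      have e2 : ∫⁻ y in S, ENNReal.ofReal (‖gradient v y‖ / δ) *
            (ENNReal.ofReal |divg (unitNormal v) y| *
              ENNReal.ofReal ((dist x y ^ 2 + σ ^ 2) ^ ((1 - k) / 2))) =
          ENNReal.ofReal δ⁻¹ * ∫⁻ y in S,
            ENNReal.ofReal (‖gradient v y‖ * |divg (unitNormal v) y|) *
              ENNReal.ofReal ((dist x y ^ 2 + σ ^ 2) ^ ((1 - k) / 2)) := by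
        rw [← lintegral_const_mul]
        · refine lintegral_congr fun y => ?_
          rw [← ENNReal.ofReal_mul (by positivity), ← ENNReal.ofReal_mul (by positivity),
            ← ENNReal.ofReal_mul (by positivity), ← ENNReal.ofReal_mul (by positivity)]
          congr 1
          ring
        · exact ((hmg.mul ((continuous_abs.measurable).comp
            (measurable_divg _))).ennreal_ofReal).mul hmk
      rw [e1, e2, mul_left_comm]
      gcongr)
    (fun x hx => by
      have hgx : ε ≤ ‖gradient v x‖ := hx.2
      have hxS : x ∈ S := hx.1
      obtain ⟨hsub, hL⟩ := hball x hxS.1 hxS.2.1.le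
      have hkn' : (n : ℝ) - 1 = k := by linarith
      rw [hset _ Metric.isOpen_ball.measurableSet, ← hkn']
      refine density_lower_bound hv ha hδ0 (hε.trans_le hgx) hρ hsub
        (fun z hz => (hL z hz).trans (by linarith)) (hδ.2.trans (by gcongr)) hxS.2.1 hxS.2.2)
  rw [hset _ hGm, huniv, hwint, ← Set.inter_assoc, Set.inter_self] at key
  rw [slabConst]
  simpa only [mul_assoc] using key

/-- The integral of `f` over the part of `Ω` where `|v| ≤ t`. -/
noncomputable def sublevelIntegral {n : ℕ} (Ω : Set (EuclideanSpace ℝ (Fin n)))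
    (v f : EuclideanSpace ℝ (Fin n) → ℝ) (t : ℝ) : ℝ :=
  ∫ x in Ω ∩ {x | |v x| ≤ t}, f x

theorem sublevelIntegral_sub {Ω : Set 𝔼} (ho : IsOpen Ω) {v f : 𝔼 → ℝ} (hv : Continuous v)
    (hf : IntegrableOn f Ω) {a b : ℝ} (hab : a ≤ b) :
    sublevelIntegral Ω v f b - sublevelIntegral Ω v f a =
      ∫ x in Ω ∩ {x | a < |v x| ∧ |v x| ≤ b}, f x := by
  have hU : Ω ∩ {x | |v x| ≤ b} =
      (Ω ∩ {x | |v x| ≤ a}) ∪ (Ω ∩ {x | a < |v x| ∧ |v x| ≤ b}) := by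
    ext x
    simp only [Set.mem_inter_iff, Set.mem_ofPred_eq, Set.mem_union]
    grind
  have hd : Disjoint (Ω ∩ {x | |v x| ≤ a}) (Ω ∩ {x | a < |v x| ∧ |v x| ≤ b}) :=
    Set.disjoint_left.2 fun x h1 h2 => absurd h1.2 (not_le.2 h2.2.1)
  rw [sublevelIntegral, sublevelIntegral, hU, setIntegral_union hd (measurableSet_slab ho hv a b)
    (hf.mono_set Set.inter_subset_left) (hf.mono_set Set.inter_subset_left)]
  ring

theorem monotone_sublevelIntegral {Ω : Set 𝔼} (ho : IsOpen Ω) {v f : 𝔼 → ℝ} (hv : Continuous v)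
    (hf : IntegrableOn f Ω) (hf0 : ∀ x, 0 ≤ f x) : Monotone (sublevelIntegral Ω v f) := by
  intro a b hab
  rw [← sub_nonneg, sublevelIntegral_sub ho hv hf hab]
  exact integral_nonneg hf0

theorem sublevelIntegral_le {Ω : Set 𝔼} {v f : 𝔼 → ℝ}
    (hf : IntegrableOn f Ω) (hf0 : ∀ x, 0 ≤ f x) (t : ℝ) :
    sublevelIntegral Ω v f t ≤ ∫ x in Ω, f x :=
  setIntegral_mono_set hf (Eventually.of_forall hf0)
    (Eventually.of_forall fun _ hx => hx.1)

theorem sublevelIntegral_nonneg {Ω : Set 𝔼} {v f : 𝔼 → ℝ} (hf0 : ∀ x, 0 ≤ f x) (t : ℝ) :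
    0 ≤ sublevelIntegral Ω v f t := integral_nonneg hf0

theorem tendsto_slab_average {Ω : Set 𝔼} (ho : IsOpen Ω) {v f : 𝔼 → ℝ} (hv : Continuous v)
    (hf : IntegrableOn f Ω) {a d : ℝ} (hd : HasDerivAt (sublevelIntegral Ω v f) d a) :
    Tendsto (fun δ => δ⁻¹ * ∫ x in Ω ∩ {x | a < |v x| ∧ |v x| ≤ a + δ}, f x) (𝓝[>] 0) (𝓝 d) := by
  refine hd.tendsto_slope_zero_right.congr' ?_
  filter_upwards [self_mem_nhdsWithin] with δ hδ
  rw [sublevelIntegral_sub ho hv hf (by linarith [Set.mem_Ioi.1 hδ]), smul_eq_mul]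

theorem lintegral_ofReal_div {S : Set 𝔼} {f : 𝔼 → ℝ} (hf : IntegrableOn f S) (hf0 : ∀ x, 0 ≤ f x)
    {δ : ℝ} (hδ : 0 < δ) :
    ∫⁻ x in S, ENNReal.ofReal (f x / δ) = ENNReal.ofReal (δ⁻¹ * ∫ x in S, f x) := by
  rw [← integral_const_mul, ofReal_integral_eq_lintegral_ofReal (hf.const_mul _)
    (Eventually.of_forall fun x => mul_nonneg (inv_nonneg.2 hδ.le) (hf0 x))]
  simp only [div_eq_inv_mul]

/-- Mean curvature lower bound for the level set `|v| = a`. -/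
theorem deriv_le_of_curvature {Ω : Set 𝔼} (ho : IsOpen Ω) (hb : IsBounded Ω) {v : 𝔼 → ℝ}
    (hv : ContDiff ℝ (⊤ : ℕ∞) v) (h0 : ∀ x ∈ frontier Ω, v x = 0) {a k P Q R : ℝ} (ha : 0 < a)
    (hk : 1 ≤ k) (hkn : (n : ℝ) = k + 1)
    (hP : HasDerivAt (sublevelIntegral Ω v fun x => ‖gradient v x‖) P a)
    (hQ : HasDerivAt (sublevelIntegral Ω v fun x =>
      ‖gradient v x‖ * |divg (unitNormal v) x|) Q a)
    (hR : HasDerivAt (sublevelIntegral Ω v fun _ => 1) R a) :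
    P ≤ (slabConst n k).toReal * P ^ (1 / k) * Q := by
  have hvc := hv.continuous
  have hIP : IntegrableOn (fun x => ‖gradient v x‖) Ω :=
    integrableOn_of_continuous hb (contDiff_gradient hv).continuous.norm
  have hIQ := integrableOn_norm_gradient_mul_abs_divg_unitNormal hb hv
  have hIR : IntegrableOn (fun _ : 𝔼 => (1 : ℝ)) Ω := integrableOn_of_continuous hb continuous_const
  have tP := tendsto_slab_average ho hvc hIP hP
  have tQ := tendsto_slab_average ho hvc hIQ hQ
  have tR := tendsto_slab_average ho hvc hIR hR
  have key : ∀ ε : ℝ, 0 < ε → P ≤ ε * R + (slabConst n k).toReal * P ^ (1 / k) * Q := by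
    intro ε hε
    refine le_of_tendsto_of_tendsto tP ((tR.const_mul ε).add
      (((tP.rpow_const (Or.inr (by positivity : 0 ≤ 1 / k))).const_mul
        (slabConst n k).toReal).mul tQ)) ?_
    filter_upwards [lintegral_slab_le ho hb hv h0 ha hε hk hkn, self_mem_nhdsWithin] with δ hδ hδ0
    replace hδ0 : 0 < δ := hδ0
    set S := Ω ∩ {x | a < |v x| ∧ |v x| ≤ a + δ}
    have hS : MeasurableSet S := measurableSet_slab ho hvc _ _
    have hSΩ : S ⊆ Ω := Set.inter_subset_left
    have hE : MeasurableSet {x | ε ≤ ‖gradient v x‖} :=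
      measurableSet_le measurable_const (measurable_gradient hv).norm
    rw [lintegral_ofReal_div (hIP.mono_set hSΩ) (fun _ => norm_nonneg _) hδ0,
      lintegral_ofReal_div (hIQ.mono_set hSΩ) (fun _ => by positivity) hδ0,
      lintegral_ofReal_div (hIP.mono_set (Set.inter_subset_left.trans hSΩ))
        (fun _ => norm_nonneg _) hδ0] at hδ
    have hPn : 0 ≤ δ⁻¹ * ∫ x in S, ‖gradient v x‖ :=
      mul_nonneg (by positivity) (integral_nonneg fun _ => norm_nonneg _)
    have hQn : 0 ≤ δ⁻¹ * ∫ x in S, ‖gradient v x‖ * |divg (unitNormal v) x| :=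
      mul_nonneg (by positivity) (integral_nonneg fun _ => by positivity)
    rw [ENNReal.ofReal_rpow_of_nonneg hPn (by positivity),
      ← ENNReal.ofReal_toReal (slabConst_ne_top n (zero_lt_one.trans_le hk)),
      ← ENNReal.ofReal_mul ENNReal.toReal_nonneg, ← ENNReal.ofReal_mul (by positivity),
      ENNReal.ofReal_le_ofReal_iff (by positivity)] at hδ
    have hsplit := integral_inter_add_sdiff hE (hIP.mono_set hSΩ)
    have hsmall : ∫ x in S \ {x | ε ≤ ‖gradient v x‖}, ‖gradient v x‖ ≤ ε * ∫ x in S, (1 : ℝ) := by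
      rw [← integral_const_mul]
      refine (setIntegral_mono_on (hIP.mono_set (Set.sdiff_subset.trans hSΩ))
        ((hIR.mono_set (Set.sdiff_subset.trans hSΩ)).const_mul ε) (hS.diff hE)
        (fun x hx => ?_)).trans (setIntegral_mono_set ((hIR.mono_set hSΩ).const_mul ε)
          (Eventually.of_forall fun _ => by simpa using hε.le)
          (Eventually.of_forall fun _ hx => hx.1))
      rw [mul_one]
      exact (not_le.1 hx.2).le
    calc δ⁻¹ * ∫ x in S, ‖gradient v x‖
        = δ⁻¹ * (∫ x in S \ {x | ε ≤ ‖gradient v x‖}, ‖gradient v x‖) +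
          δ⁻¹ * (∫ x in S ∩ {x | ε ≤ ‖gradient v x‖}, ‖gradient v x‖) := by
          rw [← hsplit]; ring
      _ ≤ δ⁻¹ * (ε * ∫ x in S, (1 : ℝ)) + _ := add_le_add (by gcongr) hδ
      _ = _ := by ring
  have hlim : Tendsto (fun ε => ε * R + (slabConst n k).toReal * P ^ (1 / k) * Q) (𝓝[>] 0)
      (𝓝 (0 * R + (slabConst n k).toReal * P ^ (1 / k) * Q)) :=
    ((tendsto_id.mono_left nhdsWithin_le_nhds).mul_const R).add_const _
  rw [zero_mul, zero_add] at hlim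
  exact ge_of_tendsto hlim (by filter_upwards [self_mem_nhdsWithin] with ε hε using key ε hε)

/-- Hölder's inequality with the weights `w ^ (p r) g ^ p`, `g` and `1`. -/
theorem lintegral_mul_le_three {α : Type*} [MeasurableSpace α] {μ : Measure α} {w g : α → ℝ≥0∞}
    (hw : AEMeasurable w μ) (hg : AEMeasurable g μ) {p r : ℝ} (hp : 1 < p) (hr : 1 ≤ r) :
    ∫⁻ x, g x * w x ∂μ ≤ (∫⁻ x, w x ^ (p * r) * g x ^ p ∂μ) ^ (1 / (p * r)) *
      (∫⁻ x, g x ∂μ) ^ (1 - 1 / r) * (∫⁻ _, 1 ∂μ) ^ ((1 - 1 / p) / r) := by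
  have hp0 : 0 < p := by linarith
  have hr0 : 0 < r := by linarith
  have h1r : 1 / r ≤ 1 := by rw [div_le_one hr0]; exact hr
  have h1p : 1 / p ≤ 1 := by rw [div_le_one hp0]; exact hp.le
  have := ENNReal.lintegral_prod_norm_pow_le (μ := μ) Finset.univ
    (f := ![fun x => w x ^ (p * r) * g x ^ p, g, fun _ => 1])
    (p := ![1 / (p * r), 1 - 1 / r, (1 - 1 / p) / r])
    (by intro i _; fin_cases i <;> simp <;> fun_prop)
    (by simp [Fin.sum_univ_three]; field_simp; ring)
    (by intro i _
        fin_cases i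
        · simp; positivity
        · simpa using h1r
        · simpa using div_nonneg (by simpa using h1p) hr0.le)
  simp only [Fin.prod_univ_three, Matrix.cons_val_zero, Matrix.cons_val_one,
    Matrix.cons_val] at this
  refine le_trans (lintegral_mono fun x => ?_) this
  rw [ENNReal.one_rpow, mul_one, ENNReal.mul_rpow_of_nonneg _ _ (by positivity),
    ← ENNReal.rpow_mul, ← ENNReal.rpow_mul, mul_one_div_cancel (by positivity), ENNReal.rpow_one,
    mul_assoc, ← ENNReal.rpow_add_of_nonneg _ _ (by positivity) (by linarith),
    show p * (1 / (p * r)) + (1 - 1 / r) = 1 by field_simp; ring, ENNReal.rpow_one, mul_comm]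

theorem deriv_curvature_le {Ω : Set 𝔼} (ho : IsOpen Ω) (hb : IsBounded Ω) {v : 𝔼 → ℝ}
    (hv : ContDiff ℝ (⊤ : ℕ∞) v) {a p r K P Q R : ℝ} (hp : 1 < p) (hr : 1 ≤ r)
    (hIK : IntegrableOn (fun x => |divg (unitNormal v) x| ^ (p * r) * ‖gradient v x‖ ^ p) Ω)
    (hK : HasDerivAt (sublevelIntegral Ω v fun x =>
      |divg (unitNormal v) x| ^ (p * r) * ‖gradient v x‖ ^ p) K a)
    (hP : HasDerivAt (sublevelIntegral Ω v fun x => ‖gradient v x‖) P a)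
    (hQ : HasDerivAt (sublevelIntegral Ω v fun x =>
      ‖gradient v x‖ * |divg (unitNormal v) x|) Q a)
    (hR : HasDerivAt (sublevelIntegral Ω v fun _ => 1) R a) :
    Q ≤ K ^ (1 / (p * r)) * P ^ (1 - 1 / r) * R ^ ((1 - 1 / p) / r) := by
  have hp0 : 0 < p := by linarith
  have hr0 : 0 < r := by linarith
  have h1r : 0 ≤ 1 - 1 / r := by rw [sub_nonneg, div_le_one hr0]; exact hr
  have h1p : 0 ≤ (1 - 1 / p) / r :=
    div_nonneg (by rw [sub_nonneg, div_le_one hp0]; exact hp.le) hr0.le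
  have hvc := hv.continuous
  have hIP : IntegrableOn (fun x => ‖gradient v x‖) Ω :=
    integrableOn_of_continuous hb (contDiff_gradient hv).continuous.norm
  have hIQ := integrableOn_norm_gradient_mul_abs_divg_unitNormal hb hv
  have hIR : IntegrableOn (fun _ : 𝔼 => (1 : ℝ)) Ω := integrableOn_of_continuous hb continuous_const
  have tK := tendsto_slab_average ho hvc hIK hK
  have tP := tendsto_slab_average ho hvc hIP hP
  have tQ := tendsto_slab_average ho hvc hIQ hQ
  have tR := tendsto_slab_average ho hvc hIR hR
  refine le_of_tendsto_of_tendsto tQ (((tK.rpow_const (Or.inr (by positivity))).mul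
    (tP.rpow_const (Or.inr h1r))).mul (tR.rpow_const (Or.inr h1p))) ?_
  filter_upwards [self_mem_nhdsWithin] with δ hδ0
  replace hδ0 : 0 < δ := hδ0
  set S := Ω ∩ {x | a < |v x| ∧ |v x| ≤ a + δ}
  have hSΩ : S ⊆ Ω := Set.inter_subset_left
  have hmg := (measurable_gradient hv).norm
  have hmh := measurable_divg (unitNormal v)
  have hofReal (x : 𝔼) : ENNReal.ofReal |divg (unitNormal v) x| ^ (p * r) *
      ENNReal.ofReal ‖gradient v x‖ ^ p =
      ENNReal.ofReal (|divg (unitNormal v) x| ^ (p * r) * ‖gradient v x‖ ^ p) := by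
    rw [ENNReal.ofReal_rpow_of_nonneg (abs_nonneg _) (by positivity),
      ENNReal.ofReal_rpow_of_nonneg (norm_nonneg _) hp0.le, ENNReal.ofReal_mul (by positivity)]
  have hH := lintegral_mul_le_three (μ := ENNReal.ofReal δ⁻¹ • volume.restrict S)
    (w := fun x => ENNReal.ofReal |divg (unitNormal v) x|)
    (g := fun x => ENNReal.ofReal ‖gradient v x‖) (by fun_prop)
    hmg.ennreal_ofReal.aemeasurable hp hr
  simp only [hofReal, ← ENNReal.ofReal_mul (norm_nonneg _)] at hH
  have hconv {f : 𝔼 → ℝ} (hf : IntegrableOn f Ω) (hf0 : ∀ x, 0 ≤ f x) :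
      ∫⁻ x, ENNReal.ofReal (f x) ∂(ENNReal.ofReal δ⁻¹ • volume.restrict S) =
        ENNReal.ofReal (δ⁻¹ * ∫ x in S, f x) := by
    rw [lintegral_smul_measure, smul_eq_mul, ENNReal.ofReal_mul (by positivity),
      ofReal_integral_eq_lintegral_ofReal (hf.mono_set hSΩ) (Eventually.of_forall hf0)]
  have hnn {f : 𝔼 → ℝ} (hf0 : ∀ x, 0 ≤ f x) : 0 ≤ δ⁻¹ * ∫ x in S, f x :=
    mul_nonneg (by positivity) (integral_nonneg hf0)
  rw [← ENNReal.ofReal_one, hconv hIQ (fun _ => by positivity), hconv hIK (fun _ => by positivity),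
    hconv hIP (fun _ => norm_nonneg _), hconv hIR (fun _ => zero_le_one),
    ENNReal.ofReal_rpow_of_nonneg (hnn fun _ => by positivity) (by positivity),
    ENNReal.ofReal_rpow_of_nonneg (hnn fun _ => norm_nonneg _) h1r,
    ENNReal.ofReal_rpow_of_nonneg (hnn fun _ => zero_le_one) h1p,
    ← ENNReal.ofReal_mul (Real.rpow_nonneg (hnn fun _ => by positivity) _),
    ← ENNReal.ofReal_mul (mul_nonneg (Real.rpow_nonneg (hnn fun _ => by positivity) _)
      (Real.rpow_nonneg (hnn fun _ => norm_nonneg _) _))] at hH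
  exact (ENNReal.ofReal_le_ofReal_iff (mul_nonneg (mul_nonneg
    (Real.rpow_nonneg (hnn fun _ => by positivity) _)
    (Real.rpow_nonneg (hnn fun _ => norm_nonneg _) _))
    (Real.rpow_nonneg (hnn fun _ => zero_le_one) _))).1 hH

theorem deriv_smoothTransition_eq_zero {t : ℝ} (ht : t ≤ 0 ∨ 1 ≤ t) :
    deriv Real.smoothTransition t = 0 := by
  rcases ht with ht | ht
  · refine IsLocalMin.deriv_eq_zero (Eventually.of_forall fun s => ?_)
    rw [Real.smoothTransition.zero_of_nonpos ht]
    exact Real.smoothTransition.nonneg s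
  · refine IsLocalMax.deriv_eq_zero (Eventually.of_forall fun s => ?_)
    rw [Real.smoothTransition.one_of_one_le ht]
    exact Real.smoothTransition.le_one s

theorem exists_bound_deriv_smoothTransition :
    ∃ C, 0 ≤ C ∧ ∀ t, |deriv Real.smoothTransition t| ≤ C := by
  have hc : Continuous (deriv Real.smoothTransition) :=
    (Real.smoothTransition.contDiff (n := 1)).continuous_deriv (by norm_num)
  obtain ⟨C, hC⟩ := (isCompact_Icc (a := (0 : ℝ)) (b := 1)).exists_bound_of_continuousOn
    hc.continuousOn
  have hC0 : 0 ≤ C := (norm_nonneg _).trans (hC 0 (by simp))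
  refine ⟨C, hC0, fun t => ?_⟩
  by_cases ht : t ∈ Set.Icc (0 : ℝ) 1
  · exact hC t ht
  · rw [deriv_smoothTransition_eq_zero, abs_zero]
    · exact hC0
    · by_contra! h
      exact ht ⟨h.1.le, h.2.le⟩

/-- Smooth function of `s`, equal to `0` for `|s| ≤ a` and to `1` for `|s| ≥ a + δ`. -/
noncomputable def levelCutoff (a δ s : ℝ) : ℝ :=
  Real.smoothTransition ((s - a) / δ) + Real.smoothTransition ((-s - a) / δ)

theorem contDiff_levelCutoff (a δ : ℝ) : ContDiff ℝ 1 (levelCutoff a δ) :=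
  (Real.smoothTransition.contDiff.comp (by fun_prop)).add
    (Real.smoothTransition.contDiff.comp (by fun_prop))

theorem levelCutoff_eq_zero {a δ s : ℝ} (hδ : 0 < δ) (hs : |s| ≤ a) : levelCutoff a δ s = 0 := by
  obtain ⟨h1, h2⟩ := abs_le.1 hs
  rw [levelCutoff, Real.smoothTransition.zero_of_nonpos (div_nonpos_of_nonpos_of_nonneg
    (by linarith) hδ.le), Real.smoothTransition.zero_of_nonpos (div_nonpos_of_nonpos_of_nonneg
    (by linarith) hδ.le), add_zero]

theorem levelCutoff_eq_one {a δ s : ℝ} (ha : 0 < a) (hδ : 0 < δ) (hs : a + δ ≤ |s|) :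
    levelCutoff a δ s = 1 := by
  rcases le_abs.1 hs with h | h
  · rw [levelCutoff, Real.smoothTransition.one_of_one_le ((one_le_div hδ).2 (by linarith)),
      Real.smoothTransition.zero_of_nonpos (div_nonpos_of_nonpos_of_nonneg
      (by linarith) hδ.le), add_zero]
  · rw [levelCutoff, Real.smoothTransition.zero_of_nonpos (div_nonpos_of_nonpos_of_nonneg
      (by linarith) hδ.le), Real.smoothTransition.one_of_one_le ((one_le_div hδ).2 (by linarith)),
      zero_add]

theorem deriv_levelCutoff (a δ s : ℝ) : deriv (levelCutoff a δ) s =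
    (deriv Real.smoothTransition ((s - a) / δ) -
      deriv Real.smoothTransition ((-s - a) / δ)) / δ := by
  have hd : Differentiable ℝ Real.smoothTransition :=
    (Real.smoothTransition.contDiff (n := 1)).differentiable (by norm_num)
  have h1 := (hd ((s - a) / δ)).hasDerivAt.comp s (((hasDerivAt_id s).sub_const a).div_const δ)
  have h2 := (hd ((-s - a) / δ)).hasDerivAt.comp s (((hasDerivAt_id s).neg.sub_const a).div_const δ)
  refine (h1.add h2).deriv.trans ?_
  ring

theorem abs_deriv_levelCutoff_le {C a δ s : ℝ} (ha : 0 < a) (hδ : 0 < δ)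
    (hC : ∀ t, |deriv Real.smoothTransition t| ≤ C) :
    |deriv (levelCutoff a δ) s| ≤
      {s : ℝ | a < |s| ∧ |s| ≤ a + δ}.indicator (fun _ => 2 * C / δ) s := by
  rw [deriv_levelCutoff, abs_div, abs_of_pos hδ]
  by_cases hs : a < |s| ∧ |s| ≤ a + δ
  · rw [Set.indicator_of_mem (by exact hs)]
    gcongr
    refine (abs_sub _ _).trans ?_
    linarith [hC ((s - a) / δ), hC ((-s - a) / δ)]
  · rw [Set.indicator_of_notMem (by exact hs)]
    have key (t : ℝ) (ht : t = s ∨ t = -s) : deriv Real.smoothTransition ((t - a) / δ) = 0 := by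
      refine deriv_smoothTransition_eq_zero ?_
      rw [one_le_div hδ, div_nonpos_iff]
      have habs : |t| = |s| := by rcases ht with rfl | rfl <;> simp
      by_contra! h
      have h1 : a < t := by
        by_contra! h'
        linarith [h.1.2 (by linarith)]
      refine hs ?_
      rw [← habs, abs_of_pos (ha.trans h1)]
      exact ⟨h1, by linarith [h.2]⟩
    rw [key s (Or.inl rfl), key (-s) (Or.inr rfl)]
    simp

theorem toReal_measure_superlevel {Ω : Set 𝔼} (hb : IsBounded Ω) {v : 𝔼 → ℝ}
    (hv : Continuous v) (t : ℝ) :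
    (volume (Ω ∩ {x | t < |v x|})).toReal =
      (volume Ω).toReal - sublevelIntegral Ω v (fun _ => 1) t := by
  have h := measure_inter_add_sdiff (μ := volume) Ω (measurableSet_le hv.abs.measurable
    (measurable_const (a := t)))
  have hfin : volume Ω ≠ ∞ := hb.measure_lt_top.ne
  have hd : Ω \ {x | |v x| ≤ t} = Ω ∩ {x | t < |v x|} := by
    ext x; simp
  rw [sublevelIntegral, setIntegral_const, smul_eq_mul, mul_one, ← h, hd, measureReal_def,
    ENNReal.toReal_add (measure_ne_top_of_subset Set.inter_subset_left hfin)
      (measure_ne_top_of_subset Set.inter_subset_left hfin)]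
  ring

/-- The isoperimetric inequality for almost every superlevel set. -/
theorem exists_isoperimetric_const (n : ℕ) {k : ℝ} (hk : 1 ≤ k) (hkn : (n : ℝ) = k + 1) :
    ∃ C, 0 ≤ C ∧ ∀ (Ω : Set (EuclideanSpace ℝ (Fin n))), IsOpen Ω → IsBounded Ω →
      ∀ v : EuclideanSpace ℝ (Fin n) → ℝ, ContDiff ℝ (⊤ : ℕ∞) v → (∀ x ∈ frontier Ω, v x = 0) →
      ∀ a P R : ℝ, 0 < a → HasDerivAt (sublevelIntegral Ω v fun x => ‖gradient v x‖) P a →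
        HasDerivAt (sublevelIntegral Ω v fun _ => 1) R a →
        (volume (Ω ∩ {x | a < |v x|})).toReal ^ (k / (k + 1)) ≤ C * P := by
  obtain ⟨C, hC0, hC⟩ := exists_bound_deriv_smoothTransition
  set q : ℝ := (k + 1) / k
  have hk0 : 0 < k := by linarith
  have hq : Real.HolderConjugate (Module.finrank ℝ (EuclideanSpace ℝ (Fin n))) q := by
    rw [finrank_euclideanSpace, Fintype.card_fin, hkn, Real.holderConjugate_iff]
    refine ⟨by linarith, ?_⟩
    simp only [q]
    field_simp
    ring
  have hq0 : 0 < q := by positivity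
  set c := lintegralPowLePowLIntegralFDerivConst (volume : Measure (EuclideanSpace ℝ (Fin n))) q
  refine ⟨(c : ℝ) ^ (1 / q) * (2 * C), by positivity, fun Ω ho hb v hv h0 a P R ha hP hR => ?_⟩
  have hvc := hv.continuous
  have hIP : IntegrableOn (fun x => ‖gradient v x‖) Ω :=
    integrableOn_of_continuous hb (contDiff_gradient hv).continuous.norm
  have tP := tendsto_slab_average ho hvc hIP hP
  have hkq : k / (k + 1) = 1 / q := by simp [q]
  rw [hkq]
  have hcont : Tendsto (fun δ => (volume (Ω ∩ {x | a + δ < |v x|})).toReal) (𝓝[>] 0)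
      (𝓝 (volume (Ω ∩ {x | a < |v x|})).toReal) := by
    simp only [toReal_measure_superlevel hb hvc]
    refine Tendsto.const_sub _ ?_
    have h1 : Tendsto (fun δ : ℝ => a + δ) (𝓝[>] 0) (𝓝 a) := by
      have : Tendsto (fun δ : ℝ => a + δ) (𝓝 0) (𝓝 (a + 0)) :=
        tendsto_const_nhds.add tendsto_id
      rw [add_zero] at this
      exact this.mono_left nhdsWithin_le_nhds
    exact hR.continuousAt.tendsto.comp h1
  refine le_of_tendsto_of_tendsto (hcont.rpow_const (Or.inr (by positivity)))
    (tP.const_mul ((c : ℝ) ^ (1 / q) * (2 * C))) ?_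
  filter_upwards [self_mem_nhdsWithin] with δ hδ0
  replace hδ0 : 0 < δ := hδ0
  set S := Ω ∩ {x | a < |v x| ∧ |v x| ≤ a + δ}
  have hS : MeasurableSet S := measurableSet_slab ho hvc _ _
  have hSΩ : S ⊆ Ω := Set.inter_subset_left
  have hY : ContDiff ℝ 1 fun x => levelCutoff a δ (v x) :=
    (contDiff_levelCutoff a δ).comp (hv.of_le (by simp))
  have hYv : ∀ x, |v x| < a → levelCutoff a δ (v x) = 0 := fun x hx =>
    levelCutoff_eq_zero hδ0 hx.le
  have hI := lintegral_pow_le_pow_lintegral_fderiv volume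
    (contDiff_indicator ho hb hvc h0 ha hY hYv) (hasCompactSupport_indicator hb _) hq
  rw [fderiv_indicator ho hb hvc h0 ha hYv] at hI
  have hleft : volume (Ω ∩ {x | a + δ < |v x|}) ≤
      ∫⁻ x, ‖Ω.indicator (fun x => levelCutoff a δ (v x)) x‖ₑ ^ q := by
    have hm : MeasurableSet (Ω ∩ {x | a + δ < |v x|}) :=
      ho.measurableSet.inter (measurableSet_lt measurable_const hvc.abs.measurable)
    rw [← lintegral_indicator_one hm]
    refine lintegral_mono fun x => ?_
    by_cases hx : x ∈ Ω ∩ {x | a + δ < |v x|}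
    · rw [Set.indicator_of_mem hx, Set.indicator_of_mem hx.1,
        levelCutoff_eq_one ha hδ0 (le_of_lt hx.2)]
      simp
    · rw [Set.indicator_of_notMem hx]
      exact zero_le
  have hfd (x : EuclideanSpace ℝ (Fin n)) :
      ‖fderiv ℝ (fun x => levelCutoff a δ (v x)) x‖ =
        |deriv (levelCutoff a δ) (v x)| * ‖gradient v x‖ := by
    have h1 : DifferentiableAt ℝ (levelCutoff a δ) (v x) :=
      (contDiff_levelCutoff a δ).differentiable (by norm_num) _
    have h2 : DifferentiableAt ℝ v x := hv.differentiable (by simp) x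
    have := (h1.hasDerivAt.comp_hasFDerivAt x h2.hasFDerivAt).fderiv
    rw [norm_gradient, show (fun x => levelCutoff a δ (v x)) = levelCutoff a δ ∘ v from rfl, this,
      norm_smul, Real.norm_eq_abs]
  have hright : ∫⁻ x, ‖Ω.indicator (fderiv ℝ fun x => levelCutoff a δ (v x)) x‖ₑ ≤
      ENNReal.ofReal (2 * C * (δ⁻¹ * ∫ x in S, ‖gradient v x‖)) := by
    rw [← mul_assoc, ← integral_const_mul, ofReal_integral_eq_lintegral_ofReal
      ((hIP.mono_set hSΩ).const_mul _) (Eventually.of_forall fun x => by positivity),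
      ← lintegral_indicator hS]
    refine lintegral_mono fun x => ?_
    by_cases hx : x ∈ Ω
    · rw [Set.indicator_of_mem hx, ← ofReal_norm, hfd]
      have hle := mul_le_mul_of_nonneg_right (abs_deriv_levelCutoff_le (s := v x) ha hδ0 hC)
        (norm_nonneg (gradient v x))
      by_cases hxS : a < |v x| ∧ |v x| ≤ a + δ
      · rw [Set.indicator_of_mem (by exact hxS)] at hle
        rw [Set.indicator_of_mem (show x ∈ S from ⟨hx, hxS⟩)]
        exact ENNReal.ofReal_le_ofReal (by rwa [div_eq_mul_inv] at hle)
      · rw [Set.indicator_of_notMem (by exact hxS), zero_mul] at hle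
        rw [ENNReal.ofReal_of_nonpos hle]
        exact zero_le
    · rw [Set.indicator_of_notMem hx]
      exact (enorm_zero (E := EuclideanSpace ℝ (Fin n) →L[ℝ] ℝ)).trans_le zero_le
  have hD0 : 0 ≤ δ⁻¹ * ∫ x in S, ‖gradient v x‖ :=
    mul_nonneg (by positivity) (integral_nonneg fun _ => norm_nonneg _)
  have hfin : volume (Ω ∩ {x | a + δ < |v x|}) ≠ ∞ :=
    measure_ne_top_of_subset Set.inter_subset_left hb.measure_lt_top.ne
  have hall := hleft.trans (hI.trans (mul_le_mul_right (ENNReal.rpow_le_rpow hright hq0.le) _))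
  rw [ENNReal.ofReal_rpow_of_nonneg (by positivity) hq0.le] at hall
  have hreal := ENNReal.toReal_mono
    (ENNReal.mul_ne_top ENNReal.coe_ne_top ENNReal.ofReal_ne_top) hall
  rw [ENNReal.toReal_mul, ENNReal.toReal_ofReal (by positivity), ENNReal.coe_toReal] at hreal
  calc (volume (Ω ∩ {x | a + δ < |v x|})).toReal ^ (1 / q)
      ≤ ((c : ℝ) * (2 * C * (δ⁻¹ * ∫ x in S, ‖gradient v x‖)) ^ q) ^ (1 / q) := by
        gcongr
    _ = _ := by
        rw [Real.mul_rpow (by positivity) (by positivity), ← Real.rpow_mul (by positivity),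
          mul_one_div_cancel hq0.ne', Real.rpow_one]
        ring

theorem superlevel_rpow_le_of_inequalities {k p r C C₂ K P Q R V : ℝ} (hr : 1 ≤ r) (hrk : r < k)
    (hp : 1 < p) (hC : 0 ≤ C) (hC₂ : 0 ≤ C₂) (hK : 0 ≤ K) (hP : 0 ≤ P) (hR : 0 ≤ R)
    (hV : 0 < V) (h1 : P ≤ C * P ^ (1 / k) * Q)
    (h2 : Q ≤ K ^ (1 / (p * r)) * P ^ (1 - 1 / r) * R ^ ((1 - 1 / p) / r))
    (h3 : V ^ (k / (k + 1)) ≤ C₂ * P) :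
    V ^ ((k - r) / (k + 1)) ≤ C₂ ^ (1 - r / k) * C ^ r * (K ^ (1 / p) * R ^ (1 - 1 / p)) := by
  have hr0 : 0 < r := by linarith
  have hk0 : 0 < k := by linarith
  have hp0 : 0 < p := by linarith
  have hrk' : 0 < 1 - r / k := by rw [sub_pos, div_lt_one hk0]; exact hrk
  have hP0 : 0 < P := by
    refine lt_of_le_of_ne hP fun h => ?_
    rw [← h, mul_zero] at h3
    exact absurd h3 (not_le.2 (Real.rpow_pos_of_pos hV _))
  set M := K ^ (1 / p) * R ^ (1 - 1 / p) with hM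
  have hM0 : 0 ≤ M := by positivity
  have hMr : M ^ (1 / r) = K ^ (1 / (p * r)) * R ^ ((1 - 1 / p) / r) := by
    rw [hM, Real.mul_rpow (by positivity) (by positivity), ← Real.rpow_mul hK, ← Real.rpow_mul hR]
    congr 2 <;> field_simp
  have h4 : P ≤ C * M ^ (1 / r) * P ^ (1 / k + (1 - 1 / r)) := by
    calc P ≤ C * P ^ (1 / k) * Q := h1
      _ ≤ C * P ^ (1 / k) * (K ^ (1 / (p * r)) * P ^ (1 - 1 / r) * R ^ ((1 - 1 / p) / r)) := by
        gcongr
      _ = _ := by rw [Real.rpow_add hP0, hMr]; ring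
  have h5 : P ^ (1 / r - 1 / k) ≤ C * M ^ (1 / r) := by
    have e : P ^ (1 / r - 1 / k) * P ^ (1 / k + (1 - 1 / r)) = P := by
      rw [← Real.rpow_add hP0]
      convert Real.rpow_one P using 2
      ring
    rw [← e] at h4
    exact le_of_mul_le_mul_right (by rwa [e] at h4 ⊢) (Real.rpow_pos_of_pos hP0 _)
  have h6 : P ^ (1 - r / k) ≤ C ^ r * M := by
    have := Real.rpow_le_rpow (by positivity) h5 hr0.le
    rw [← Real.rpow_mul hP, Real.mul_rpow hC (by positivity), ← Real.rpow_mul hM0,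
      one_div_mul_cancel hr0.ne', Real.rpow_one] at this
    convert this using 2
    field_simp
  calc V ^ ((k - r) / (k + 1)) = (V ^ (k / (k + 1))) ^ (1 - r / k) := by
        rw [← Real.rpow_mul hV.le]
        congr 1
        field_simp
    _ ≤ (C₂ * P) ^ (1 - r / k) := Real.rpow_le_rpow (by positivity) h3 hrk'.le
    _ = C₂ ^ (1 - r / k) * P ^ (1 - r / k) := Real.mul_rpow hC₂ hP
    _ ≤ C₂ ^ (1 - r / k) * (C ^ r * M) := by gcongr
    _ = _ := by ring

theorem deriv_nonneg_of_monotoneOn_Icc {f : ℝ → ℝ} {a b t : ℝ} (hf : MonotoneOn f (Set.Icc a b))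
    (ht : t ∈ Set.Ioo a b) : 0 ≤ deriv f t := by
  rw [← derivWithin_of_mem_nhds (Icc_mem_nhds ht.1 ht.2)]
  exact hf.derivWithin_nonneg

theorem lintegral_deriv_le_of_monotoneOn {f : ℝ → ℝ} {a b : ℝ} (hab : a ≤ b)
    (hf : MonotoneOn f (Set.Icc a b)) :
    ∫⁻ t in Set.Ioo a b, ENNReal.ofReal (deriv f t) ≤ ENNReal.ofReal (f b - f a) := by
  rw [← Set.uIcc_of_le hab] at hf
  have hi := hf.intervalIntegrable_deriv
  have hm := hf.intervalIntegral_deriv_mem_uIcc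
  rw [Set.uIcc_of_le hab] at hf
  have hle : f a ≤ f b := hf (Set.left_mem_Icc.2 hab) (Set.right_mem_Icc.2 hab) hab
  rw [Set.uIcc_of_le (sub_nonneg.2 hle)] at hm
  rw [intervalIntegrable_iff_integrableOn_Ioo_of_le hab] at hi
  rw [← ofReal_integral_eq_lintegral_ofReal hi
    ((ae_restrict_iff' measurableSet_Ioo).2
      (Eventually.of_forall fun t ht => deriv_nonneg_of_monotoneOn_Icc hf ht)),
    ← integral_Ioc_eq_integral_Ioo, ← intervalIntegral.integral_of_le hab]
  exact ENNReal.ofReal_le_ofReal hm.2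

/-- Integrated form of the differential inequality `W ^ α ≤ A F' ^ (1/p) (-W') ^ (1 - 1/p)`. -/
theorem rpow_le_of_differential_inequality {F W : ℝ → ℝ} {A J M p q s : ℝ} (hp : 1 < p)
    (hq : 0 < q) (hs : 0 < s) (hA : 0 ≤ A) (hF : Monotone F) (hF0 : 0 ≤ F 0) (hFJ : F s ≤ J)
    (hW : Antitone W) (hWs : 0 < W s) (hW0 : W 0 ≤ M)
    (h : ∀ᵐ t, t ∈ Set.Ioo 0 s → W t ^ ((q + 1) * (1 - 1 / p)) ≤
      A * (deriv F t ^ (1 / p) * (-deriv W t) ^ (1 - 1 / p))) :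
    s ≤ A * (J ^ (1 / p) * ((W s ^ (-q) - M ^ (-q)) / q) ^ (1 - 1 / p)) := by
  have hp0 : 0 < p := by linarith
  have h1p : 0 < 1 - 1 / p := by rw [sub_pos, div_lt_one hp0]; exact hp
  have hWpos {t : ℝ} (ht : t ≤ s) : 0 < W t := hWs.trans_le (hW ht)
  set G : ℝ → ℝ := fun t => W t ^ (-q)
  have hG : MonotoneOn G (Set.Icc 0 s) := fun x hx y hy hxy =>
    Real.rpow_le_rpow_of_nonpos (hWpos hy.2) (hW hxy) (by linarith)
  have hF' (t : ℝ) : 0 ≤ deriv F t := hF.deriv_nonneg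
  have hpt : ∀ᵐ t, t ∈ Set.Ioo 0 s →
      1 ≤ A * (deriv F t ^ (1 / p) * (deriv G t / q) ^ (1 - 1 / p)) := by
    filter_upwards [h, hW.neg.ae_differentiableAt] with t ht hd hts
    have hWt := hWpos hts.2.le
    have hd' : DifferentiableAt ℝ W t := by simpa using hd.neg
    have hdG : deriv G t / q = -deriv W t * W t ^ (-(q + 1)) := by
      have := (hd'.hasDerivAt.rpow_const (p := -q) (Or.inl hWt.ne')).deriv
      rw [show deriv G t = _ from this, show -q - 1 = -(q + 1) by ring]
      field_simp
    have hW' : 0 ≤ -deriv W t := by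
      have : 0 ≤ deriv (-W) t := hW.neg.deriv_nonneg
      rwa [deriv.neg'] at this
    rw [hdG, Real.mul_rpow hW' (by positivity), ← Real.rpow_mul hWt.le, neg_mul,
      Real.rpow_neg hWt.le, ← mul_assoc, ← mul_assoc, ← div_eq_mul_inv,
      one_le_div (Real.rpow_pos_of_pos hWt _), mul_assoc]
    exact ht hts
  have hconj : Real.HolderConjugate p (1 / (1 - 1 / p)) := by
    rw [Real.holderConjugate_iff]
    refine ⟨hp, ?_⟩
    simp
  have hH := ENNReal.lintegral_mul_le_Lp_mul_Lq (volume.restrict (Set.Ioo 0 s)) hconj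
    (f := fun t => ENNReal.ofReal (deriv F t) ^ (1 / p))
    (g := fun t => ENNReal.ofReal (deriv G t / q) ^ (1 - 1 / p))
    (((measurable_deriv F).ennreal_ofReal.pow_const _).aemeasurable)
    ((((measurable_deriv G).div_const q).ennreal_ofReal.pow_const _).aemeasurable)
  simp only [← ENNReal.rpow_mul, one_div_mul_cancel hp0.ne', mul_one_div_cancel h1p.ne',
    ENNReal.rpow_one, Pi.mul_apply, one_div_one_div] at hH
  have hFint : ∫⁻ t in Set.Ioo 0 s, ENNReal.ofReal (deriv F t) ≤ ENNReal.ofReal J :=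
    (lintegral_deriv_le_of_monotoneOn hs.le (hF.monotoneOn _)).trans
      (ENNReal.ofReal_le_ofReal (by linarith))
  have hGint : ∫⁻ t in Set.Ioo 0 s, ENNReal.ofReal (deriv G t / q) ≤
      ENNReal.ofReal ((W s ^ (-q) - M ^ (-q)) / q) := by
    simp only [div_eq_inv_mul, ENNReal.ofReal_mul (inv_nonneg.2 hq.le)]
    rw [lintegral_const_mul _ (measurable_deriv G).ennreal_ofReal]
    gcongr
    refine (lintegral_deriv_le_of_monotoneOn hs.le hG).trans (ENNReal.ofReal_le_ofReal ?_)
    have : M ^ (-q) ≤ W 0 ^ (-q) :=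
      Real.rpow_le_rpow_of_nonpos (hWpos hs.le) hW0 (by linarith)
    change W s ^ (-q) - W 0 ^ (-q) ≤ _
    linarith
  have hJ0 : 0 ≤ J := hF0.trans ((hF hs.le).trans hFJ)
  have hGM : 0 ≤ (W s ^ (-q) - M ^ (-q)) / q := by
    refine div_nonneg (sub_nonneg.2 ?_) hq.le
    exact Real.rpow_le_rpow_of_nonpos hWs ((hW hs.le).trans hW0) (by linarith)
  have hmain : ENNReal.ofReal s ≤ ENNReal.ofReal A * (ENNReal.ofReal J ^ (1 / p) *
      ENNReal.ofReal ((W s ^ (-q) - M ^ (-q)) / q) ^ (1 - 1 / p)) := by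
    calc ENNReal.ofReal s = ∫⁻ _ in Set.Ioo 0 s, 1 := by simp
      _ ≤ ∫⁻ t in Set.Ioo 0 s, ENNReal.ofReal A * (ENNReal.ofReal (deriv F t) ^ (1 / p) *
          ENNReal.ofReal (deriv G t / q) ^ (1 - 1 / p)) := by
        refine lintegral_mono_ae ((ae_restrict_iff' measurableSet_Ioo).2 ?_)
        filter_upwards [hpt] with t ht hts
        have hG' : 0 ≤ deriv G t / q :=
          div_nonneg (deriv_nonneg_of_monotoneOn_Icc hG hts) hq.le
        rw [ENNReal.ofReal_rpow_of_nonneg (hF' t) (by positivity),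
          ENNReal.ofReal_rpow_of_nonneg hG' h1p.le,
          ← ENNReal.ofReal_mul (Real.rpow_nonneg (hF' t) _), ← ENNReal.ofReal_mul hA,
          ← ENNReal.ofReal_one]
        exact ENNReal.ofReal_le_ofReal (ht hts)
      _ = ENNReal.ofReal A * ∫⁻ t in Set.Ioo 0 s, ENNReal.ofReal (deriv F t) ^ (1 / p) *
          ENNReal.ofReal (deriv G t / q) ^ (1 - 1 / p) :=
        lintegral_const_mul _ (by
          have := measurable_deriv F
          have := measurable_deriv G
          fun_prop)
      _ ≤ _ := by
        gcongr
        refine hH.trans ?_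
        gcongr
  rw [ENNReal.ofReal_rpow_of_nonneg hJ0 (by positivity),
    ENNReal.ofReal_rpow_of_nonneg hGM h1p.le, ← ENNReal.ofReal_mul (by positivity),
    ← ENNReal.ofReal_mul hA] at hmain
  exact (ENNReal.ofReal_le_ofReal_iff (by positivity)).1 hmain

theorem measure_superlevel_pos {α : Type*} [MeasurableSpace α] {μ : Measure α} {f : α → ℝ} {s : ℝ}
    (hs : 0 ≤ s) (h : s < (eLpNorm f ⊤ μ).toReal) : μ {x | s < |f x|} ≠ 0 := by
  intro h0
  have hle : eLpNorm f ⊤ μ ≤ ENNReal.ofReal s := by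
    rw [eLpNorm_exponent_top]
    refine eLpNormEssSup_le_of_ae_bound ?_
    rw [ae_iff]
    simpa using h0
  exact absurd h (not_lt.2 (ENNReal.toReal_le_of_le_ofReal hs hle))

theorem abs_divg_unitNormal {k : ℝ} (hk : 0 < k) (hkn : (n : ℝ) = k + 1) (v : 𝔼 → ℝ) (x : 𝔼) :
    |divg (unitNormal v) x| = k * |meanCurv v x| := by
  have : meanCurv v x = -(1 / k) * divg (unitNormal v) x := by
    rw [meanCurv, show (n : ℝ) - 1 = k by linarith]
    rfl
  rw [this, abs_mul, abs_neg, abs_of_pos (by positivity : 0 < 1 / k)]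
  field_simp

theorem superlevel_le_of_integrated {V M B p q s : ℝ} (hp : 1 < p) (hq : 0 < q) (hs : 0 < s)
    (hV : 0 < V) (hVM : V ≤ M) (hB : 0 < B)
    (h : s ≤ B * ((V ^ (-q) - M ^ (-q)) / q) ^ (1 - 1 / p)) :
    V ≤ M * (q * (M ^ q / B ^ (p / (p - 1))) * s ^ (p / (p - 1)) + 1) ^ (-(1 / q)) := by
  have hM : 0 < M := hV.trans_le hVM
  have hp1 : 0 < p - 1 := by linarith
  have hp' : 0 < p / (p - 1) := by positivity
  have hD : 0 ≤ (V ^ (-q) - M ^ (-q)) / q :=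
    div_nonneg (sub_nonneg.2 (Real.rpow_le_rpow_of_nonpos hV hVM (by linarith))) hq.le
  have h1 : s ^ (p / (p - 1)) ≤ B ^ (p / (p - 1)) * ((V ^ (-q) - M ^ (-q)) / q) := by
    have := Real.rpow_le_rpow hs.le h hp'.le
    rwa [Real.mul_rpow hB.le (by positivity), ← Real.rpow_mul hD,
      show (1 - 1 / p) * (p / (p - 1)) = 1 by field_simp, Real.rpow_one] at this
  have hMM : M ^ q * M ^ (-q) = 1 := by rw [← Real.rpow_add hM]; simp
  have h2 : q * (M ^ q / B ^ (p / (p - 1))) * s ^ (p / (p - 1)) + 1 ≤ M ^ q * V ^ (-q) := by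
    calc _ ≤ q * (M ^ q / B ^ (p / (p - 1))) *
          (B ^ (p / (p - 1)) * ((V ^ (-q) - M ^ (-q)) / q)) + 1 := by gcongr
      _ = M ^ q * V ^ (-q) - M ^ q * M ^ (-q) + 1 := by field_simp
      _ = _ := by rw [hMM]; ring
  calc V = M * (M ^ q * V ^ (-q)) ^ (-(1 / q)) := by
        rw [Real.mul_rpow (by positivity) (by positivity), ← Real.rpow_mul hM.le,
          ← Real.rpow_mul hV.le, show q * -(1 / q) = -1 by field_simp,
          show -q * -(1 / q) = 1 by field_simp, Real.rpow_one, Real.rpow_neg_one]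
        field_simp
    _ ≤ _ := by
        refine mul_le_mul_of_nonneg_left (Real.rpow_le_rpow_of_nonpos (by positivity) h2 ?_) hM.le
        have : 0 < 1 / q := by positivity
        linarith

theorem integral_curvature {Ω : Set 𝔼} (ho : IsOpen Ω) {v : 𝔼 → ℝ}
    {k p r Ip : ℝ} (hp : 1 < p) (hk : 0 < k) (hkn : (n : ℝ) = k + 1)
    (hIp : Ip = (∫ x in Ω ∩ {x | gradient v x ≠ 0},
      |meanCurv v x| ^ (p * r) * ‖gradient v x‖ ^ p) ^ (1 / p)) (hIp0 : 0 < Ip) :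
    IntegrableOn (fun x => |divg (unitNormal v) x| ^ (p * r) * ‖gradient v x‖ ^ p) Ω ∧
      (∫ x in Ω, |divg (unitNormal v) x| ^ (p * r) * ‖gradient v x‖ ^ p) ^ (1 / p) =
        k ^ r * Ip := by
  have hp0 : 0 < p := by linarith
  have hpt : (fun x => |divg (unitNormal v) x| ^ (p * r) * ‖gradient v x‖ ^ p) = fun x =>
      k ^ (p * r) * (|meanCurv v x| ^ (p * r) * ‖gradient v x‖ ^ p) := by
    ext x
    rw [abs_divg_unitNormal hk hkn, Real.mul_rpow hk.le (abs_nonneg _), mul_assoc]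
  have hz : ∀ x ∈ Ω \ (Ω ∩ {x | gradient v x ≠ 0}),
      |meanCurv v x| ^ (p * r) * ‖gradient v x‖ ^ p = 0 := by
    intro x hx
    have : gradient v x = 0 := by
      by_contra h
      exact hx.2 ⟨hx.1, h⟩
    rw [this, norm_zero, Real.zero_rpow hp0.ne', mul_zero]
  have hI : IntegrableOn (fun x => |meanCurv v x| ^ (p * r) * ‖gradient v x‖ ^ p)
      (Ω ∩ {x | gradient v x ≠ 0}) := by
    by_contra h
    rw [integral_undef h, Real.zero_rpow (by positivity)] at hIp
    exact hIp0.ne' hIp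
  have hIΩ := IntegrableOn.of_forall_sdiff_eq_zero hI ho.measurableSet hz
  rw [hpt]
  refine ⟨hIΩ.const_mul _, ?_⟩
  rw [integral_const_mul, setIntegral_eq_of_subset_of_forall_sdiff_eq_zero ho.measurableSet
    Set.inter_subset_left hz,
    Real.mul_rpow (by positivity) (integral_nonneg fun _ => by positivity),
    ← hIp, ← Real.rpow_mul hk.le]
  congr 2
  field_simp

/-- Integral bound for the height of a superlevel set in terms of its measure. -/
theorem exists_height_le (n : ℕ) {k p r q : ℝ} (hkn : (n : ℝ) = k + 1) (hk : 1 ≤ k) (hp : 1 < p)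
    (hr : 1 ≤ r) (hrk : r < k) (hq0 : 0 < q) (hq : (q + 1) * (1 - 1 / p) = (k - r) / (k + 1)) :
    ∃ A, 0 < A ∧ ∀ (Ω : Set (EuclideanSpace ℝ (Fin n))), IsOpen Ω → IsBounded Ω →
      ∀ v : EuclideanSpace ℝ (Fin n) → ℝ, ContDiff ℝ (⊤ : ℕ∞) v → (∀ x ∈ frontier Ω, v x = 0) →
      IntegrableOn (fun x => |divg (unitNormal v) x| ^ (p * r) * ‖gradient v x‖ ^ p) Ω →
      ∀ s, 0 < s → 0 < (volume (Ω ∩ {x | s < |v x|})).toReal →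
        s ≤ A * ((∫ x in Ω, |divg (unitNormal v) x| ^ (p * r) * ‖gradient v x‖ ^ p) ^ (1 / p) *
          (((volume (Ω ∩ {x | s < |v x|})).toReal ^ (-q) - (volume Ω).toReal ^ (-q)) / q) ^
            (1 - 1 / p)) := by
  obtain ⟨C₂, hC₂, hiso⟩ := exists_isoperimetric_const n hk hkn
  refine ⟨C₂ ^ (1 - r / k) * (slabConst n k).toReal ^ r + 1, by positivity,
    fun Ω ho hb v hv h0 hIK s hs hVs => ?_⟩
  have hvc := hv.continuous
  have hIP : IntegrableOn (fun x => ‖gradient v x‖) Ω :=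
    integrableOn_of_continuous hb (contDiff_gradient hv).continuous.norm
  have hIQ := integrableOn_norm_gradient_mul_abs_divg_unitNormal hb hv
  have hIR : IntegrableOn (fun _ : EuclideanSpace ℝ (Fin n) => (1 : ℝ)) Ω :=
    integrableOn_of_continuous hb continuous_const
  have mK := monotone_sublevelIntegral ho hvc hIK fun x => by positivity
  have mP := monotone_sublevelIntegral ho hvc hIP fun x => by positivity
  have mQ := monotone_sublevelIntegral ho hvc hIQ fun x => by positivity
  have mR := monotone_sublevelIntegral ho hvc hIR fun x => by positivity
  have hanti : Antitone fun t => (volume (Ω ∩ {x | t < |v x|})).toReal := by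
    intro a b hab
    simp only [toReal_measure_superlevel hb hvc]
    linarith [mR hab]
  refine rpow_le_of_differential_inequality (F := sublevelIntegral Ω v _)
    (W := fun t => (volume (Ω ∩ {x | t < |v x|})).toReal) hp hq0 hs (by positivity) mK
    (sublevelIntegral_nonneg (fun x => by positivity) _)
    (sublevelIntegral_le hIK (fun x => by positivity) _) hanti hVs
    (ENNReal.toReal_mono hb.measure_lt_top.ne (measure_mono Set.inter_subset_left)) ?_
  filter_upwards [mK.ae_differentiableAt, mP.ae_differentiableAt, mQ.ae_differentiableAt,
    mR.ae_differentiableAt] with t dK dP dQ dR ht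
  have hK := dK.hasDerivAt
  have hP := dP.hasDerivAt
  have hQ := dQ.hasDerivAt
  have hR := dR.hasDerivAt
  have hWd : -deriv (fun t => (volume (Ω ∩ {x | t < |v x|})).toReal) t =
      deriv (sublevelIntegral Ω v fun _ => 1) t := by
    simp only [toReal_measure_superlevel hb hvc]
    rw [(hR.const_sub _).deriv, neg_neg]
  rw [hWd, hq]
  refine (superlevel_rpow_le_of_inequalities hr hrk hp ENNReal.toReal_nonneg hC₂ mK.deriv_nonneg
    mP.deriv_nonneg mR.deriv_nonneg (hVs.trans_le (hanti ht.2.le))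
    (deriv_le_of_curvature ho hb hv h0 ht.1 hk hkn hP hQ hR)
    (deriv_curvature_le ho hb hv hp hr hIK hK hP hQ hR)
    (hiso Ω ho hb v hv h0 t _ _ ht.1 hP hR)).trans ?_
  refine mul_le_mul_of_nonneg_right (by linarith) ?_
  have := mK.deriv_nonneg (x := t)
  have := mR.deriv_nonneg (x := t)
  positivity

end

/-- Decay of the distribution function in the subcritical case `n > p(1+r)` (Remark 3.2):
`V(s) ≤ |Ω| ((p'/p*_r)(|Ω|^{1/p*_r}/(A I_p))^{p'} s^{p'} + 1)^{-p*_r/p'}`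
for a.e. `s ∈ (0, ‖v‖_{L^∞(Ω)})`, where `p' = p/(p-1)`. -/
theorem stmt_6 (n : ℕ) (hn : 2 ≤ n) (p r : ℝ) (hp : 1 < p) (hr : 1 ≤ r)
    (hnpr : p * (1 + r) < (n : ℝ))
    (pstar : ℝ) (hpstar : 1 / pstar = 1 / p - (1 + r) / n) :
    ∃ A : ℝ, 0 < A ∧
      ∀ (Ω : Set (EuclideanSpace ℝ (Fin n))), IsOpen Ω → IsBounded Ω →
        ∀ v : EuclideanSpace ℝ (Fin n) → ℝ, ContDiff ℝ (⊤ : ℕ∞) v →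
          (∀ x ∈ frontier Ω, v x = 0) →
          ∀ Ip : ℝ,
            Ip = (∫ x in Ω ∩ {x | gradient v x ≠ 0},
                |meanCurv v x| ^ (p * r) * ‖gradient v x‖ ^ p) ^ (1 / p) →
            0 < Ip →
            ∀ᵐ s ∂(volume.restrict (Set.Ioo 0 ((eLpNorm v ⊤ (volume.restrict Ω)).toReal))),
              (volume (Ω ∩ {x | s < |v x|})).toReal ≤
                (volume Ω).toReal *
                  ((p / (p - 1) / pstar) *
                      ((volume Ω).toReal ^ (1 / pstar) / (A * Ip)) ^ (p / (p - 1)) *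
                        s ^ (p / (p - 1)) + 1) ^ (-(pstar / (p / (p - 1)))) := by
  obtain ⟨k, hkn⟩ : ∃ k : ℝ, (n : ℝ) = k + 1 := ⟨n - 1, by ring⟩
  have hp1 : 0 < p - 1 := by linarith
  have hn0 : (0 : ℝ) < n := by exact_mod_cast zero_lt_two.trans_le hn
  have hrk : r < k := by nlinarith
  have hk : 1 ≤ k := by linarith
  have hps : 0 < 1 / pstar := by
    rw [hpstar, sub_pos, div_lt_div_iff₀ hn0 (by linarith)]
    linarith
  have hps0 : 0 < pstar := one_div_pos.1 hps
  set q := p / (p - 1) / pstar with hqdef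
  have hq0 : 0 < q := by positivity
  have hq : (q + 1) * (1 - 1 / p) = (k - r) / (k + 1) := by
    rw [hqdef, div_eq_mul_one_div _ pstar, hpstar, hkn]
    have : k + 1 ≠ 0 := by linarith
    field_simp
    ring
  obtain ⟨A, hA, h⟩ := exists_height_le n hkn hk hp hr hrk hq0 hq
  refine ⟨A * k ^ r, by positivity, fun Ω ho hb v hv h0 Ip hIp hIp0 => ?_⟩
  obtain ⟨hI, hIeq⟩ := integral_curvature ho hp (by linarith) hkn hIp hIp0
  refine (ae_restrict_iff' measurableSet_Ioo).2 (Eventually.of_forall fun s hs => ?_)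
  have hfin : volume Ω ≠ ∞ := hb.measure_lt_top.ne
  have hms : MeasurableSet {x | s < |v x|} :=
    measurableSet_lt measurable_const hv.continuous.abs.measurable
  have hV : 0 < (volume (Ω ∩ {x | s < |v x|})).toReal := by
    refine ENNReal.toReal_pos ?_ (measure_ne_top_of_subset Set.inter_subset_left hfin)
    rw [Set.inter_comm, ← Measure.restrict_apply hms]
    exact measure_superlevel_pos hs.1.le hs.2
  have hVM : (volume (Ω ∩ {x | s < |v x|})).toReal ≤ (volume Ω).toReal :=
    ENNReal.toReal_mono hfin (measure_mono Set.inter_subset_left)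
  have hs' := h Ω ho hb v hv h0 hI s hs.1 hV
  rw [hIeq, ← mul_assoc, ← mul_assoc] at hs'
  have hfinal := superlevel_le_of_integrated hp hq0 hs.1 hV hVM (by positivity) hs'
  rw [Real.div_rpow (by positivity) (by positivity), ← Real.rpow_mul (by positivity),
    show 1 / pstar * (p / (p - 1)) = q by rw [hqdef]; ring,
    show pstar / (p / (p - 1)) = 1 / q by rw [hqdef]; field_simp]
  exact hfinal
end

section
/- Let n ≥ 2, let 1 ≤ p < 2, and let r ∈ (0, 2/p − 1). Then there exist a ball B ⊂ ℝⁿ, a sequence of smooth bounded domains Ω_k ⊂ B each containing the open unit cube Q₁ = (0,1)ⁿ, and functions v_k that are C^∞ on a neighborhood of the closure of Ω_k with v_k = 0 on ∂Ω_k, such that v_k ≡ 1 on Q₁ (so ‖v_k‖_{L^∞(Ω_k)} ≥ 1 and ‖v_k‖_{L^q(Ω_k)} ≥ 1 for every q ∈ [1,∞)), while ∫_{Ω_k ∩ {|∇v_k|>0}} |H_{v_k}|^{pr} |∇v_k|^p dx → 0 as k → ∞. In particular, for these values of n, p, r there is no constant C for which the inequality ‖v‖_{L^q(Ω)} ≤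 C ( ∫_{Ω ∩ {|∇v|>0}} |H_v|^{pr} |∇v|^p dx )^{1/p} holds for all smooth bounded domains Ω of uniformly bounded measure and all such v, for any q ∈ [1,∞]. -/
open MeasureTheory Filter Bornology
open scoped ENNReal Topology

/-- The open unit cube `Q₁ = (0,1)ⁿ` in `ℝⁿ`. -/
def unitCube (n : ℕ) : Set (EuclideanSpace ℝ (Fin n)) :=
  {x | ∀ i, 0 < x i ∧ x i < 1}

/-- `φ` is a smooth cutoff, equal to `1` on `[0,1]` and to `0` off `[-ε, 1 + ε]`, whose first two
derivatives `φ'`, `φ''` are bounded by `a` and `a²`. -/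
structure IsCutoff (ε a : ℝ) (φ φ' φ'' : ℝ → ℝ) : Prop where
  contDiff : ContDiff ℝ (⊤ : ℕ∞) φ
  hasDerivAt : ∀ t, HasDerivAt φ (φ' t) t
  hasDerivAt' : ∀ t, HasDerivAt φ' (φ'' t) t
  abs_le : ∀ t, |φ t| ≤ 1
  abs_deriv_le : ∀ t, |φ' t| ≤ a
  abs_deriv2_le : ∀ t, |φ'' t| ≤ a ^ 2
  eq_one : ∀ t, 0 ≤ t → t ≤ 1 → φ t = 1
  eq_zero_left : ∀ t, t ≤ -ε → φ t = 0
  eq_zero_right : ∀ t, 1 + ε ≤ t → φ t = 0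
  deriv_eq_zero : ∀ t, t ∉ Set.Icc (-ε) 0 ∪ Set.Icc 1 (1 + ε) → φ' t = 0

lemma smoothTransition_deriv_eq_zero {t : ℝ} (ht : t ∉ Set.Icc (0 : ℝ) 1) :
    deriv Real.smoothTransition t = 0 := by
  rcases lt_or_ge t 0 with h | h
  · have : Real.smoothTransition =ᶠ[𝓝 t] fun _ => 0 := by
      filter_upwards [Iio_mem_nhds h] with s hs
      exact Real.smoothTransition.zero_of_nonpos (le_of_lt hs)
    rw [this.deriv_eq, deriv_const]
  · have h1 : 1 < t := by
      by_contra! h1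
      exact ht ⟨h, h1⟩
    have : Real.smoothTransition =ᶠ[𝓝 t] fun _ => 1 := by
      filter_upwards [Ioi_mem_nhds h1] with s hs
      exact Real.smoothTransition.one_of_one_le (le_of_lt hs)
    rw [this.deriv_eq, deriv_const]

lemma exists_smoothTransition_deriv_bound :
    ∃ M : ℝ, 0 ≤ M ∧ (∀ t, |deriv Real.smoothTransition t| ≤ M) ∧
      ∀ t, |deriv (deriv Real.smoothTransition) t| ≤ M := by
  have hc1 : ContDiff ℝ ((⊤ : ℕ∞) : WithTop ℕ∞) (deriv Real.smoothTransition) :=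
    (contDiff_infty_iff_deriv.1 Real.smoothTransition.contDiff).2
  have hs : HasCompactSupport (deriv Real.smoothTransition) :=
    HasCompactSupport.intro isCompact_Icc fun t ht => smoothTransition_deriv_eq_zero ht
  obtain ⟨A, hA⟩ := hs.exists_bound_of_continuous hc1.continuous
  obtain ⟨B, hB⟩ := hs.deriv.exists_bound_of_continuous
    (contDiff_infty_iff_deriv.1 hc1).2.continuous
  refine ⟨max A B, le_trans (norm_nonneg _) ((hA 0).trans (le_max_left _ _)),
    fun t => (hA t).trans (le_max_left _ _), fun t => (hB t).trans (le_max_right _ _)⟩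

lemma exists_isCutoff :
    ∃ M : ℝ, 0 < M ∧ ∀ ε : ℝ, 0 < ε → ∃ φ φ' φ'' : ℝ → ℝ, IsCutoff ε (M / ε) φ φ' φ'' := by
  obtain ⟨M, hM, h1, h2⟩ := exists_smoothTransition_deriv_bound
  refine ⟨2 + 2 * M, by positivity, fun ε hε => ?_⟩
  set S := Real.smoothTransition with hS
  have hSc : ContDiff ℝ ((⊤ : ℕ∞) : WithTop ℕ∞) S := Real.smoothTransition.contDiff
  have hSc1 := (contDiff_infty_iff_deriv.1 hSc)
  have hSc2 := (contDiff_infty_iff_deriv.1 hSc1.2)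
  have hS1 : ∀ t, |S t| ≤ 1 := fun t => by
    rw [abs_of_nonneg (Real.smoothTransition.nonneg t)]
    exact Real.smoothTransition.le_one t
  have hl : ∀ t, HasDerivAt (fun t : ℝ => 1 + t / ε) (1 / ε) t := fun t =>
    ((hasDerivAt_id t).div_const ε).const_add 1
  have hr : ∀ t, HasDerivAt (fun t : ℝ => 1 + (1 - t) / ε) (-1 / ε) t := fun t =>
    (((hasDerivAt_id t).const_sub 1).div_const ε).const_add 1
  have hS' : ∀ t, HasDerivAt S (deriv S t) t := fun t => (hSc1.1 t).hasDerivAt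
  have hS'' : ∀ t, HasDerivAt (deriv S) (deriv (deriv S) t) t := fun t => (hSc2.1 t).hasDerivAt
  have hL : ∀ t, HasDerivAt (fun t => S (1 + t / ε)) (deriv S (1 + t / ε) * (1 / ε)) t :=
    fun t => (hS' _).comp t (hl t)
  have hL' : ∀ t, HasDerivAt (fun t => deriv S (1 + t / ε))
      (deriv (deriv S) (1 + t / ε) * (1 / ε)) t := fun t => (hS'' _).comp t (hl t)
  have hR : ∀ t, HasDerivAt (fun t => S (1 + (1 - t) / ε))
      (deriv S (1 + (1 - t) / ε) * (-1 / ε)) t := fun t => (hS' _).comp t (hr t)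
  have hR' : ∀ t, HasDerivAt (fun t => deriv S (1 + (1 - t) / ε))
      (deriv (deriv S) (1 + (1 - t) / ε) * (-1 / ε)) t := fun t => (hS'' _).comp t (hr t)
  have hφ0 : ∀ t, t ≤ -ε → S (1 + t / ε) = 0 := fun t ht => by
    apply Real.smoothTransition.zero_of_nonpos
    have : t / ε ≤ -1 := by rw [div_le_iff₀ hε]; linarith
    linarith
  have hφ1 : ∀ t, 1 + ε ≤ t → S (1 + (1 - t) / ε) = 0 := fun t ht => by
    apply Real.smoothTransition.zero_of_nonpos
    have : (1 - t) / ε ≤ -1 := by rw [div_le_iff₀ hε]; linarith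
    linarith
  have hφ2 : ∀ t, 0 ≤ t → t ≤ 1 → S (1 + t / ε) * S (1 + (1 - t) / ε) = 1 := fun t h0 h1 => by
    have a1 : 0 ≤ t / ε := by positivity
    have a2 : 0 ≤ (1 - t) / ε := div_nonneg (by linarith) hε.le
    rw [hS, Real.smoothTransition.one_of_one_le (by linarith),
      Real.smoothTransition.one_of_one_le (by linarith), one_mul]
  have hd : ∀ t, HasDerivAt (fun t => S (1 + t / ε) * S (1 + (1 - t) / ε))
      ((deriv S (1 + t / ε) * S (1 + (1 - t) / ε) -
        S (1 + t / ε) * deriv S (1 + (1 - t) / ε)) / ε) t := fun t => by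
    refine HasDerivAt.congr_deriv ((hL t).mul (hR t)) ?_
    ring
  have hd' : ∀ t, HasDerivAt (fun t => (deriv S (1 + t / ε) * S (1 + (1 - t) / ε) -
        S (1 + t / ε) * deriv S (1 + (1 - t) / ε)) / ε)
      ((deriv (deriv S) (1 + t / ε) * S (1 + (1 - t) / ε) -
        2 * (deriv S (1 + t / ε) * deriv S (1 + (1 - t) / ε)) +
        S (1 + t / ε) * deriv (deriv S) (1 + (1 - t) / ε)) / ε ^ 2) t := fun t => by
    refine HasDerivAt.congr_deriv
      ((((hL' t).mul (hR t)).sub ((hL t).mul (hR' t))).div_const ε) ?_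
    field_simp
    ring
  have hmul : ∀ a b A B : ℝ, |a| ≤ A → |b| ≤ B → |a * b| ≤ A * B := fun a b A B ha hb => by
    rw [abs_mul]
    exact mul_le_mul ha hb (abs_nonneg _) ((abs_nonneg _).trans ha)
  refine ⟨_, _, _, ⟨?_, hd, hd', ?_, ?_, ?_, hφ2, ?_, ?_, ?_⟩⟩
  · exact (hSc.comp (by fun_prop)).mul (hSc.comp (by fun_prop))
  · intro t
    simpa using hmul _ _ 1 1 (hS1 (1 + t / ε)) (hS1 (1 + (1 - t) / ε))
  · intro t
    rw [abs_div, abs_of_pos hε]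
    gcongr
    have e1 := hmul _ _ _ _ (h1 (1 + t / ε)) (hS1 (1 + (1 - t) / ε))
    have e2 := hmul _ _ _ _ (hS1 (1 + t / ε)) (h1 (1 + (1 - t) / ε))
    rw [abs_le] at *
    constructor <;> linarith [e1.1, e1.2, e2.1, e2.2]
  · intro t
    rw [abs_div, div_pow, abs_of_pos (pow_pos hε 2)]
    gcongr
    have e1 := hmul _ _ _ _ (h2 (1 + t / ε)) (hS1 (1 + (1 - t) / ε))
    have e2 := hmul _ _ _ _ (hS1 (1 + t / ε)) (h2 (1 + (1 - t) / ε))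
    have e3 := hmul _ _ _ _ (h1 (1 + t / ε)) (h1 (1 + (1 - t) / ε))
    rw [abs_le] at *
    constructor <;> nlinarith [e1.1, e1.2, e2.1, e2.2, e3.1, e3.2]
  · intro t ht
    simp only [hφ0 t ht, zero_mul]
  · intro t ht
    simp only [hφ1 t ht, mul_zero]
  · intro t ht
    simp only [Set.mem_union, Set.mem_Icc, not_or, not_and, not_le] at ht
    refine (hd t).unique ?_
    by_cases c1 : t < -ε
    · refine (hasDerivAt_const t (0 : ℝ)).congr_of_eventuallyEq ?_
      filter_upwards [Iio_mem_nhds c1] with s hs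
      rw [hφ0 s (le_of_lt hs), zero_mul]
    by_cases c2 : 1 + ε < t
    · refine (hasDerivAt_const t (0 : ℝ)).congr_of_eventuallyEq ?_
      filter_upwards [Ioi_mem_nhds c2] with s hs
      rw [hφ1 s (le_of_lt hs), mul_zero]
    have c3 : 0 < t := ht.1 (not_lt.1 c1)
    have c4 : t < 1 := by
      by_contra! h
      exact c2 (ht.2 h)
    refine (hasDerivAt_const t (1 : ℝ)).congr_of_eventuallyEq ?_
    filter_upwards [Ioo_mem_nhds c3 c4] with s hs
    exact hφ2 s hs.1.le hs.2.le

lemma EuclideanSpace.norm_le_sum_abs {n : ℕ} (x : EuclideanSpace ℝ (Fin n)) :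
    ‖x‖ ≤ ∑ i, |x i| := by
  calc ‖x‖ = ‖∑ i, x i • EuclideanSpace.single i (1 : ℝ)‖ := by
        congr 1
        ext j
        simp [Pi.single_apply]
    _ ≤ ∑ i, ‖x i • EuclideanSpace.single i (1 : ℝ)‖ := norm_sum_le _ _
    _ = ∑ i, |x i| := by simp [norm_smul]

lemma EuclideanSpace.abs_apply_le_norm {n : ℕ} (x : EuclideanSpace ℝ (Fin n)) (i : Fin n) :
    |x i| ≤ ‖x‖ := PiLp.norm_apply_le x i

lemma hasFDerivAt_prod_apply {n : ℕ} {ψ ψ' : Fin n → ℝ → ℝ}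
    (h : ∀ i t, HasDerivAt (ψ i) (ψ' i t) t) (x : EuclideanSpace ℝ (Fin n)) :
    HasFDerivAt (fun y : EuclideanSpace ℝ (Fin n) => ∏ i, ψ i (y i))
      (∑ i, (∏ j ∈ Finset.univ.erase i, ψ j (x j)) •
        (ψ' i (x i) • (EuclideanSpace.proj i : EuclideanSpace ℝ (Fin n) →L[ℝ] ℝ))) x := by
  refine HasFDerivAt.finsetProd fun i _ => ?_
  exact (h i (x i)).comp_hasFDerivAt x
    (EuclideanSpace.proj i : EuclideanSpace ℝ (Fin n) →L[ℝ] ℝ).hasFDerivAt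

lemma norm_fderiv_prod_apply_le {n : ℕ} {ψ ψ' : Fin n → ℝ → ℝ}
    (h : ∀ i t, HasDerivAt (ψ i) (ψ' i t) t) (x : EuclideanSpace ℝ (Fin n)) {B : ℝ}
    (hB : ∀ i, |(∏ j ∈ Finset.univ.erase i, ψ j (x j)) * ψ' i (x i)| ≤ B) :
    ‖fderiv ℝ (fun y : EuclideanSpace ℝ (Fin n) => ∏ i, ψ i (y i)) x‖ ≤ n * B := by
  rw [(hasFDerivAt_prod_apply h x).fderiv]
  refine (norm_sum_le _ _).trans ?_
  calc _ ≤ ∑ _i : Fin n, B := by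
        refine Finset.sum_le_sum fun i _ => ?_
        rw [smul_smul, norm_smul]
        have hp : ‖(EuclideanSpace.proj i : EuclideanSpace ℝ (Fin n) →L[ℝ] ℝ)‖ ≤ 1 :=
          ContinuousLinearMap.opNorm_le_bound _ zero_le_one fun y => by
            simpa using EuclideanSpace.abs_apply_le_norm y i
        exact (mul_le_of_le_one_right (norm_nonneg _) hp).trans (hB i)
    _ = n * B := by simp

/-- The derivative of a normalised vector field. -/
lemma norm_fderiv_normalize_le {E : Type*} [NormedAddCommGroup E] [InnerProductSpace ℝ E]
    {g : E → E} {x : E} (hg : DifferentiableAt ℝ g x) (h0 : g x ≠ 0) :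
    ‖fderiv ℝ (fun y => ‖g y‖⁻¹ • g y) x‖ ≤ 2 * ‖fderiv ℝ g x‖ / ‖g x‖ := by
  have hn : 0 < ‖g x‖ := norm_pos_iff.2 h0
  have h1 : HasFDerivAt (fun y => ‖g y‖) ((fderiv ℝ norm (g x)).comp (fderiv ℝ g x)) x :=
    ((differentiableAt_id.norm ℝ h0).hasFDerivAt (f := norm)).comp x hg.hasFDerivAt
  have h2 := (hasDerivAt_inv hn.ne').comp_hasFDerivAt x h1
  have h3 := h2.smul hg.hasFDerivAt
  have h4 : ‖fderiv ℝ (norm : E → ℝ) (g x)‖ ≤ 1 := by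
    simpa using norm_fderiv_le_of_lipschitz ℝ (x₀ := g x) (lipschitzWith_one_norm (E := E))
  have h5 : fderiv ℝ (fun y => ‖g y‖⁻¹ • g y) x = _ := h3.fderiv
  rw [h5]
  refine (norm_add_le _ _).trans ?_
  rw [ContinuousLinearMap.norm_smulRight_apply, norm_smul, norm_smul]
  have h6 : ‖(fderiv ℝ norm (g x)).comp (fderiv ℝ g x)‖ ≤ ‖fderiv ℝ g x‖ :=
    (ContinuousLinearMap.opNorm_comp_le _ _).trans
      (mul_le_of_le_one_left (norm_nonneg _) h4)
  have e : ‖-(‖g x‖ ^ 2)⁻¹‖ = (‖g x‖ ^ 2)⁻¹ := by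
    rw [norm_neg, norm_inv, norm_pow, norm_norm]
  have e' : ‖(Inv.inv ∘ fun y => ‖g y‖) x‖ = ‖g x‖⁻¹ := by simp
  rw [e, e']
  calc _ ≤ ‖g x‖⁻¹ * ‖fderiv ℝ g x‖ + (‖g x‖ ^ 2)⁻¹ * ‖fderiv ℝ g x‖ * ‖g x‖ := by gcongr
    _ = 2 * ‖fderiv ℝ g x‖ / ‖g x‖ := by field_simp; ring

lemma abs_divg_le {n : ℕ} (V : EuclideanSpace ℝ (Fin n) → EuclideanSpace ℝ (Fin n))
    (x : EuclideanSpace ℝ (Fin n)) : |divg V x| ≤ n * ‖fderiv ℝ V x‖ := by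
  refine (Finset.abs_sum_le_sum_abs _ _).trans ?_
  calc _ ≤ ∑ _i : Fin n, ‖fderiv ℝ V x‖ := by
        refine Finset.sum_le_sum fun i _ => (EuclideanSpace.abs_apply_le_norm _ i).trans ?_
        simpa using (fderiv ℝ V x).le_opNorm (EuclideanSpace.single i (1 : ℝ))
    _ = _ := by simp

lemma abs_meanCurv_le {n : ℕ} (hn : 2 ≤ n) {v : EuclideanSpace ℝ (Fin n) → ℝ}
    {x : EuclideanSpace ℝ (Fin n)} (hv : DifferentiableAt ℝ (gradient v) x)
    (h0 : gradient v x ≠ 0) :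
    |meanCurv v x| ≤ 2 * n * ‖fderiv ℝ (gradient v) x‖ / ‖gradient v x‖ := by
  have hn' : (1 : ℝ) ≤ n - 1 := by
    have : (2 : ℝ) ≤ n := by exact_mod_cast hn
    linarith
  rw [meanCurv, abs_mul, abs_neg, abs_of_nonneg (by positivity)]
  calc _ ≤ 1 * (n * (2 * ‖fderiv ℝ (gradient v) x‖ / ‖gradient v x‖)) := by
        gcongr
        · rw [div_le_one (by linarith)]
          exact hn'
        · exact (abs_divg_le _ _).trans (by gcongr; exact norm_fderiv_normalize_le hv h0)
    _ = _ := by ring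

/-- The curvature vanishes where the level sets are locally flat. -/
lemma meanCurv_eq_zero {n : ℕ} {v : EuclideanSpace ℝ (Fin n) → ℝ}
    {x e : EuclideanSpace ℝ (Fin n)} {f : EuclideanSpace ℝ (Fin n) → ℝ}
    (hf : ContinuousAt f x) (h0 : f x ≠ 0) (hv : ∀ᶠ y in 𝓝 x, gradient v y = f y • e) :
    meanCurv v x = 0 := by
  have hc : ∃ w, ∀ᶠ y in 𝓝 x, ‖gradient v y‖⁻¹ • gradient v y = w := by
    rcases lt_or_gt_of_ne h0 with h | h
    · refine ⟨-‖e‖⁻¹ • e, ?_⟩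
      filter_upwards [hv, hf.eventually_lt continuousAt_const h] with y hy hy'
      rw [hy, norm_smul, Real.norm_of_nonpos hy'.le, smul_smul]
      congr 1
      rw [mul_inv, inv_neg]
      field_simp [hy'.ne]
    · refine ⟨‖e‖⁻¹ • e, ?_⟩
      filter_upwards [hv, continuousAt_const.eventually_lt hf h] with y hy hy'
      rw [hy, norm_smul, Real.norm_of_nonneg hy'.le, smul_smul]
      congr 1
      rw [mul_inv]
      field_simp [hy'.ne']
  obtain ⟨w, hw⟩ := hc
  have h1 : fderiv ℝ (fun y => ‖gradient v y‖⁻¹ • gradient v y) x = 0 := by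
    rw [Filter.EventuallyEq.fderiv_eq (f := fun _ => w) hw]
    simp
  simp [meanCurv, divg, h1]

section BoxCutoff

variable {n : ℕ} {ε a : ℝ} {φ φ' φ'' : ℝ → ℝ}

lemma IsCutoff.gradient_prod (h : IsCutoff ε a φ φ' φ'') (x : EuclideanSpace ℝ (Fin n)) :
    gradient (fun y : EuclideanSpace ℝ (Fin n) => ∏ i, φ (y i)) x =
      ∑ i, (∏ j, (if j = i then φ' else φ) (x j)) • EuclideanSpace.single i (1 : ℝ) := by
  refine HasGradientAt.gradient (hasGradientAt_iff_hasFDerivAt.2 ?_)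
  refine (hasFDerivAt_prod_apply (fun _ => h.hasDerivAt) x).congr_fderiv ?_
  ext y
  simp only [sum_apply, smul_apply, PiLp.proj_apply, smul_eq_mul, InnerProductSpace.toDual_apply_apply, sum_inner,
    inner_smul_left, EuclideanSpace.inner_single_left]
  refine Finset.sum_congr rfl fun i _ => ?_
  have e : ∏ j ∈ Finset.univ.erase i, (if j = i then φ' else φ) (x j) =
      ∏ j ∈ Finset.univ.erase i, φ (x j) :=
    Finset.prod_congr rfl fun j hj => by rw [if_neg (Finset.ne_of_mem_erase hj)]
  rw [← Finset.prod_erase_mul _ _ (Finset.mem_univ i), e]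
  simp [mul_assoc]

lemma IsCutoff.abs_prod_le (h : IsCutoff ε a φ φ' φ'') (x : EuclideanSpace ℝ (Fin n))
    (s : Finset (Fin n)) (i : Fin n) :
    |∏ j ∈ s, (if j = i then φ' else φ) (x j)| ≤ if i ∈ s then a else 1 := by
  rw [Finset.abs_prod, ← Finset.prod_ite_eq' s i fun _ => a]
  refine Finset.prod_le_prod (fun _ _ => abs_nonneg _) fun j _ => ?_
  split_ifs with hj
  · exact h.abs_deriv_le _
  · exact h.abs_le _

lemma IsCutoff.nonneg (h : IsCutoff ε a φ φ' φ'') : 0 ≤ a :=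
  (abs_nonneg _).trans (h.abs_deriv_le 0)

lemma IsCutoff.norm_gradient_le (h : IsCutoff ε a φ φ' φ'') (x : EuclideanSpace ℝ (Fin n)) :
    ‖gradient (fun y : EuclideanSpace ℝ (Fin n) => ∏ i, φ (y i)) x‖ ≤ n * a := by
  rw [h.gradient_prod]
  refine (norm_sum_le _ _).trans ?_
  calc _ ≤ ∑ _i : Fin n, a := by
        refine Finset.sum_le_sum fun i _ => ?_
        have hp := h.abs_prod_le x Finset.univ i
        rw [if_pos (Finset.mem_univ i)] at hp
        rwa [norm_smul, PiLp.norm_single, norm_one, mul_one]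
    _ = n * a := by simp

lemma IsCutoff.hasDerivAt_ite (h : IsCutoff ε a φ φ' φ'') (i j : Fin n) (t : ℝ) :
    HasDerivAt (if j = i then φ' else φ) ((if j = i then φ'' else φ') t) t := by
  split_ifs
  · exact h.hasDerivAt' t
  · exact h.hasDerivAt t

lemma IsCutoff.differentiable_gradient (h : IsCutoff ε a φ φ' φ'') :
    Differentiable ℝ (gradient (fun y : EuclideanSpace ℝ (Fin n) => ∏ i, φ (y i))) := by
  rw [funext h.gradient_prod]
  intro x
  exact DifferentiableAt.fun_sum fun i _ => DifferentiableAt.smul_const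
    (hasFDerivAt_prod_apply (h.hasDerivAt_ite i) x).differentiableAt _

lemma IsCutoff.norm_fderiv_gradient_le (h : IsCutoff ε a φ φ' φ'')
    (x : EuclideanSpace ℝ (Fin n)) :
    ‖fderiv ℝ (gradient (fun y : EuclideanSpace ℝ (Fin n) => ∏ i, φ (y i))) x‖ ≤
      n ^ 2 * a ^ 2 := by
  have ha := h.nonneg
  rw [funext h.gradient_prod]
  have hd : ∀ i : Fin n, DifferentiableAt ℝ (fun y : EuclideanSpace ℝ (Fin n) =>
      ∏ j, (if j = i then φ' else φ) (y j)) x := fun i =>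
    (hasFDerivAt_prod_apply (h.hasDerivAt_ite i) x).differentiableAt
  rw [fderiv_fun_sum fun i _ => (hd i).smul_const _]
  refine (norm_sum_le _ _).trans ?_
  calc _ ≤ ∑ _i : Fin n, n * a ^ 2 := by
        refine Finset.sum_le_sum fun i _ => ?_
        rw [fderiv_smul_const (hd i), ContinuousLinearMap.norm_smulRight_apply]
        simp only [PiLp.norm_single, norm_one, mul_one]
        refine norm_fderiv_prod_apply_le (h.hasDerivAt_ite i) x fun k => ?_
        have hp := h.abs_prod_le x (Finset.univ.erase k) i
        rw [abs_mul]
        by_cases hk : k = i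
        · subst hk
          rw [if_neg (by simp)] at hp
          rw [if_pos rfl]
          simpa using mul_le_mul hp (h.abs_deriv2_le (x k)) (abs_nonneg _) zero_le_one
        · rw [if_pos (by simp [Ne.symm hk])] at hp
          rw [if_neg hk, pow_two]
          exact mul_le_mul hp (h.abs_deriv_le (x k)) (abs_nonneg _) ha
    _ = n ^ 2 * a ^ 2 := by simp; ring

/-- Away from the points with two coordinates in the transition region, the level sets of the
box cutoff are flat. -/
lemma IsCutoff.meanCurv_eq_zero (h : IsCutoff ε a φ φ' φ'') (hn : 2 ≤ n)
    {x : EuclideanSpace ℝ (Fin n)}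
    (h0 : gradient (fun y : EuclideanSpace ℝ (Fin n) => ∏ i, φ (y i)) x ≠ 0)
    (hx : ∀ i j, i ≠ j → x i ∈ Set.Icc (-ε) 0 ∪ Set.Icc 1 (1 + ε) →
      x j ∉ Set.Icc (-ε) 0 ∪ Set.Icc 1 (1 + ε)) :
    meanCurv (fun y : EuclideanSpace ℝ (Fin n) => ∏ i, φ (y i)) x = 0 := by
  obtain ⟨i, hi⟩ : ∃ i : Fin n, ∀ j, j ≠ i → x j ∉ Set.Icc (-ε) 0 ∪ Set.Icc 1 (1 + ε) := by
    by_cases hT : ∃ i, x i ∈ Set.Icc (-ε) 0 ∪ Set.Icc 1 (1 + ε)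
    · obtain ⟨i, hi⟩ := hT
      exact ⟨i, fun j hj => hx i j hj.symm hi⟩
    · push Not at hT
      exact ⟨⟨0, by omega⟩, fun j _ => hT j⟩
  have hclosed : IsClosed (Set.Icc (-ε) 0 ∪ Set.Icc 1 (1 + ε)) :=
    isClosed_Icc.union isClosed_Icc
  have hev : ∀ᶠ y in 𝓝 x, ∀ j, j ≠ i → y j ∉ Set.Icc (-ε) 0 ∪ Set.Icc 1 (1 + ε) := by
    rw [eventually_all]
    intro j
    by_cases hj : j = i
    · simp [hj]
    · have hc : ContinuousAt (fun y : EuclideanSpace ℝ (Fin n) => y j) x := by fun_prop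
      filter_upwards [hc.eventually_mem (hclosed.isOpen_compl.mem_nhds (hi j hj))] with y hy _
        using hy
  have hg : ∀ᶠ y in 𝓝 x, gradient (fun y : EuclideanSpace ℝ (Fin n) => ∏ i, φ (y i)) y =
      (∏ j, (if j = i then φ' else φ) (y j)) • EuclideanSpace.single i (1 : ℝ) := by
    filter_upwards [hev] with y hy
    rw [h.gradient_prod]
    refine Finset.sum_eq_single i (fun j _ hj => ?_) (by simp)
    rw [Finset.prod_eq_zero (Finset.mem_univ j), zero_smul]
    rw [if_pos rfl]
    exact h.deriv_eq_zero _ (hy j hj)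
  refine _root_.meanCurv_eq_zero (e := EuclideanSpace.single i (1 : ℝ))
    (hasFDerivAt_prod_apply (h.hasDerivAt_ite i) x).continuousAt (fun hz => h0 ?_) hg
  rw [hg.self_of_nhds, hz, zero_smul]

lemma IsCutoff.integrand_le (h : IsCutoff ε a φ φ' φ'') (hn : 2 ≤ n) {p r : ℝ} (hp : 0 < p)
    (hr0 : 0 < r) (hr1 : r < 1) (x : EuclideanSpace ℝ (Fin n)) :
    |meanCurv (fun y : EuclideanSpace ℝ (Fin n) => ∏ i, φ (y i)) x| ^ (p * r) *
      ‖gradient (fun y : EuclideanSpace ℝ (Fin n) => ∏ i, φ (y i)) x‖ ^ p ≤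
      (2 * n ^ 3) ^ (p * r) * n ^ (p - p * r) * a ^ (p + p * r) := by
  have ha := h.nonneg
  have hpr : 0 < p * r := by positivity
  have hpr' : 0 ≤ p - p * r := by nlinarith
  set v := fun y : EuclideanSpace ℝ (Fin n) => ∏ i, φ (y i)
  by_cases h0 : gradient v x = 0
  · rw [h0, norm_zero, Real.zero_rpow hp.ne', mul_zero]
    positivity
  have hG : 0 < ‖gradient v x‖ := norm_pos_iff.2 h0
  have hH : |meanCurv v x| ≤ 2 * n ^ 3 * a ^ 2 / ‖gradient v x‖ := by
    refine (abs_meanCurv_le hn (h.differentiable_gradient x) h0).trans ?_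
    refine div_le_div_of_nonneg_right ?_ hG.le
    calc 2 * n * ‖fderiv ℝ (gradient v) x‖ ≤ 2 * n * (n ^ 2 * a ^ 2) := by
          gcongr
          exact h.norm_fderiv_gradient_le x
      _ = 2 * n ^ 3 * a ^ 2 := by ring
  calc |meanCurv v x| ^ (p * r) * ‖gradient v x‖ ^ p
      ≤ (2 * n ^ 3 * a ^ 2 / ‖gradient v x‖) ^ (p * r) * ‖gradient v x‖ ^ p := by gcongr
    _ = (2 * n ^ 3 * a ^ 2) ^ (p * r) * ‖gradient v x‖ ^ (p - p * r) := by
        rw [Real.div_rpow (by positivity) hG.le, Real.rpow_sub hG]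
        ring
    _ ≤ (2 * n ^ 3 * a ^ 2) ^ (p * r) * (n * a) ^ (p - p * r) := by
        gcongr
        exact h.norm_gradient_le x
    _ = _ := by
        rw [Real.mul_rpow (by positivity) (by positivity), Real.mul_rpow (by positivity) ha,
          show p + p * r = 2 * (p * r) + (p - p * r) by ring,
          Real.rpow_add_of_nonneg ha (by positivity) hpr', Real.rpow_mul ha, Real.rpow_two]
        ring

lemma volume_real_edge_le (hε : 0 ≤ ε) {R : ℝ} (hR : 0 ≤ R) {i j : Fin n} (hij : i ≠ j) :
    volume.real {x : EuclideanSpace ℝ (Fin n) | x ∈ Metric.ball 0 R ∧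
      x i ∈ Set.Icc (-ε) 0 ∪ Set.Icc 1 (1 + ε) ∧ x j ∈ Set.Icc (-ε) 0 ∪ Set.Icc 1 (1 + ε)} ≤
      (2 * ε) ^ 2 * (2 * R) ^ (n - 2) := by
  set T := Set.Icc (-ε) 0 ∪ Set.Icc 1 (1 + ε)
  set s : Fin n → Set ℝ := fun l => if l ∈ ({i, j} : Finset (Fin n)) then T else Set.Icc (-R) R
  have hTm : MeasurableSet T := measurableSet_Icc.union measurableSet_Icc
  have hT : volume.real T ≤ 2 * ε := by
    refine (measureReal_union_le _ _).trans ?_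
    rw [Real.volume_real_Icc_of_le (by linarith), Real.volume_real_Icc_of_le (by linarith)]
    linarith
  have hTb : volume T < ⊤ := measure_union_lt_top (by simp) (by simp)
  have hsm : ∀ l, MeasurableSet (s l) := fun l => by
    dsimp only [s]
    split_ifs
    exacts [hTm, measurableSet_Icc]
  have hsb : ∀ l, volume (s l) < ⊤ := fun l => by
    dsimp only [s]
    split_ifs
    exacts [hTb, by simp]
  have hpi : volume.real (Set.univ.pi s) ≤ (2 * ε) ^ 2 * (2 * R) ^ (n - 2) := by
    rw [measureReal_def, volume_pi_pi, ENNReal.toReal_prod]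
    calc ∏ l, (volume (s l)).toReal
        ≤ ∏ l, (if l ∈ ({i, j} : Finset (Fin n)) then 2 * ε else 2 * R) := by
          refine Finset.prod_le_prod (fun _ _ => ENNReal.toReal_nonneg) fun l _ => ?_
          dsimp only [s]
          split_ifs
          · exact hT
          · rw [← measureReal_def, Real.volume_real_Icc_of_le (by linarith)]
            linarith
      _ = (2 * ε) ^ 2 * (2 * R) ^ (n - 2) := by
          rw [Finset.prod_ite, Finset.prod_const, Finset.prod_const, Finset.filter_mem_eq_inter,
            Finset.univ_inter, Finset.card_pair hij, ← Finset.compl_filter,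
            Finset.card_compl, Finset.filter_mem_eq_inter, Finset.univ_inter,
            Finset.card_pair hij, Fintype.card_fin]
  have hmp := PiLp.volume_preserving_ofLp (Fin n)
  have hpre : volume.real (WithLp.ofLp ⁻¹' (Set.univ.pi s) : Set (EuclideanSpace ℝ (Fin n))) =
      volume.real (Set.univ.pi s) := by
    rw [measureReal_def, measureReal_def,
      hmp.measure_preimage (MeasurableSet.univ_pi hsm).nullMeasurableSet]
  refine le_trans (measureReal_mono ?_ ?_) (hpre.trans_le hpi)
  · rintro x ⟨hx, hxi, hxj⟩ l -
    dsimp only [s]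
    split_ifs with hl
    · rcases Finset.mem_insert.1 hl with rfl | hl
      · exact hxi
      · rw [Finset.mem_singleton.1 hl]
        exact hxj
    · rw [mem_ball_zero_iff] at hx
      exact abs_le.1 ((EuclideanSpace.abs_apply_le_norm x l).trans hx.le)
  · rw [hmp.measure_preimage (MeasurableSet.univ_pi hsm).nullMeasurableSet, volume_pi_pi]
    exact (ENNReal.prod_lt_top fun l _ => hsb l).ne

lemma IsCutoff.abs_integral_le (h : IsCutoff ε a φ φ' φ'') (hε : 0 ≤ ε) (hn : 2 ≤ n) {p r : ℝ}
    (hp : 0 < p) (hr0 : 0 < r) (hr1 : r < 1) {R : ℝ} (hR : 0 ≤ R) :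
    |∫ x in Metric.ball (0 : EuclideanSpace ℝ (Fin n)) R ∩
        {x | gradient (fun y : EuclideanSpace ℝ (Fin n) => ∏ i, φ (y i)) x ≠ 0},
      |meanCurv (fun y : EuclideanSpace ℝ (Fin n) => ∏ i, φ (y i)) x| ^ (p * r) *
        ‖gradient (fun y : EuclideanSpace ℝ (Fin n) => ∏ i, φ (y i)) x‖ ^ p| ≤
      (2 * n ^ 3) ^ (p * r) * n ^ (p - p * r) * a ^ (p + p * r) *
        (n ^ 2 * ((2 * ε) ^ 2 * (2 * R) ^ (n - 2))) := by
  have ha := h.nonneg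
  set v := fun y : EuclideanSpace ℝ (Fin n) => ∏ i, φ (y i) with hv
  set K : ℝ := (2 * n ^ 3) ^ (p * r) * n ^ (p - p * r) * a ^ (p + p * r)
  have hK : 0 ≤ K := by positivity
  set T := Set.Icc (-ε) 0 ∪ Set.Icc 1 (1 + ε) with hT
  have hTm : MeasurableSet T := measurableSet_Icc.union measurableSet_Icc
  set D : Fin n × Fin n → Set (EuclideanSpace ℝ (Fin n)) := fun q =>
    {x | x ∈ Metric.ball 0 R ∧ x q.1 ∈ T ∧ x q.2 ∈ T} with hD
  set I := (Finset.univ : Finset (Fin n × Fin n)).filter fun q => q.1 ≠ q.2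
  set B := ⋃ q ∈ I, D q
  have hBm : MeasurableSet B := by
    refine Finset.measurableSet_biUnion _ fun q _ => ?_
    refine measurableSet_ball.inter (MeasurableSet.inter ?_ ?_)
    · exact (show Measurable fun x : EuclideanSpace ℝ (Fin n) => x q.1 by fun_prop) hTm
    · exact (show Measurable fun x : EuclideanSpace ℝ (Fin n) => x q.2 by fun_prop) hTm
  have hBb : volume B ≠ ⊤ := by
    refine ((measure_mono ?_).trans_lt (measure_ball_lt_top (x := 0) (r := R))).ne
    exact Set.iUnion₂_subset fun q _ x hx => hx.1
  have hBv : volume.real B ≤ n ^ 2 * ((2 * ε) ^ 2 * (2 * R) ^ (n - 2)) := by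
    refine (measureReal_biUnion_finset_le _ _).trans ?_
    calc ∑ q ∈ I, volume.real (D q) ≤ ∑ _q ∈ I, (2 * ε) ^ 2 * (2 * R) ^ (n - 2) :=
          Finset.sum_le_sum fun q hq =>
            volume_real_edge_le hε hR (Finset.mem_filter.1 hq).2
      _ ≤ _ := by
          rw [Finset.sum_const, nsmul_eq_mul]
          gcongr
          have : I.card ≤ n ^ 2 := (Finset.card_filter_le _ _).trans (by simp [pow_two])
          exact_mod_cast this
  set S := Metric.ball (0 : EuclideanSpace ℝ (Fin n)) R ∩ {x | gradient v x ≠ 0}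
  have hSm : MeasurableSet S := (Metric.isOpen_ball.inter
    (isOpen_ne.preimage h.differentiable_gradient.continuous)).measurableSet
  have hgi : Integrable (B.indicator fun _ => K) (volume.restrict S) :=
    (integrable_indicator_iff hBm).2
      (integrableOn_const ((Measure.restrict_apply_le S B).trans_lt hBb.lt_top).ne)
  have key := norm_integral_le_of_norm_le (μ := volume.restrict S)
    (f := fun x => |meanCurv v x| ^ (p * r) * ‖gradient v x‖ ^ p) hgi (by
      refine (ae_restrict_mem hSm).mono fun x hx => ?_
      by_cases hxB : x ∈ B
      · rw [Set.indicator_of_mem hxB, Real.norm_of_nonneg (by positivity)]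
        exact h.integrand_le hn hp hr0 hr1 x
      · rw [Set.indicator_of_notMem hxB, h.meanCurv_eq_zero hn hx.2, abs_zero,
          Real.zero_rpow (by positivity), zero_mul, norm_zero]
        intro i j hij hi hj
        exact hxB (Set.mem_biUnion (x := (i, j)) (by simp [I, hij]) ⟨hx.1, hi, hj⟩))
  refine key.trans ?_
  rw [integral_indicator_const _ hBm, smul_eq_mul, mul_comm]
  gcongr
  refine le_trans ?_ hBv
  exact ENNReal.toReal_mono hBb (Measure.restrict_apply_le S B)

end BoxCutoff

lemma unitCube_subset_ball {n : ℕ} :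
    unitCube n ⊆ Metric.ball (0 : EuclideanSpace ℝ (Fin n)) (2 * n + 1) := by
  intro x hx
  rw [mem_ball_zero_iff]
  have : ‖x‖ ≤ ∑ _i : Fin n, (1 : ℝ) := (EuclideanSpace.norm_le_sum_abs x).trans
    (Finset.sum_le_sum fun i _ => abs_le.2 ⟨by linarith [(hx i).1], (hx i).2.le⟩)
  simp only [Finset.sum_const, Finset.card_univ, Fintype.card_fin, nsmul_eq_mul] at this
  linarith [(n.cast_nonneg : (0 : ℝ) ≤ n)]

lemma unitCube_eq_preimage {n : ℕ} :
    unitCube n = WithLp.ofLp ⁻¹' (Set.univ.pi fun _ => Set.Ioo (0 : ℝ) 1) := by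
  ext x
  simp [unitCube]

lemma measurableSet_unitCube {n : ℕ} : MeasurableSet (unitCube n) := by
  rw [unitCube_eq_preimage]
  exact (PiLp.volume_preserving_ofLp (Fin n)).measurable
    (MeasurableSet.univ_pi fun _ => measurableSet_Ioo)

lemma volume_unitCube {n : ℕ} : volume (unitCube n) = 1 := by
  rw [unitCube_eq_preimage, (PiLp.volume_preserving_ofLp (Fin n)).measure_preimage
    (MeasurableSet.univ_pi fun _ => measurableSet_Ioo).nullMeasurableSet, Real.volume_pi_Ioo]
  simp

lemma one_le_Lq_norm {n : ℕ} {v : EuclideanSpace ℝ (Fin n) → ℝ} (hc : Continuous v)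
    (hle : ∀ x, ‖v x‖ ≤ 1) (h1 : ∀ x ∈ unitCube n, v x = 1) {q : ℝ} (hq : 1 ≤ q) :
    1 ≤ (∫ x in Metric.ball (0 : EuclideanSpace ℝ (Fin n)) (2 * n + 1), |v x| ^ q) ^ (1 / q) := by
  have hq0 : 0 ≤ q := by linarith
  refine Real.one_le_rpow ?_ (by positivity)
  have hvq : IntegrableOn (fun x => |v x| ^ q)
      (Metric.ball (0 : EuclideanSpace ℝ (Fin n)) (2 * n + 1)) volume := by
    refine Measure.integrableOn_of_bounded (M := 1) measure_ball_lt_top.ne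
      (hc.abs.rpow_const fun _ => Or.inr hq0).aestronglyMeasurable (ae_of_all _ fun x => ?_)
    rw [Real.norm_of_nonneg (by positivity)]
    exact Real.rpow_le_one (abs_nonneg _) (hle x) hq0
  calc (1 : ℝ) = ∫ _x in unitCube n, (1 : ℝ) := by simp [measureReal_def, volume_unitCube]
    _ = ∫ x in unitCube n, |v x| ^ q :=
        setIntegral_congr_fun measurableSet_unitCube fun x hx => by simp [h1 x hx]
    _ ≤ _ := setIntegral_mono_set hvq (ae_of_all _ fun x => by positivity)
        unitCube_subset_ball.eventuallyLE

lemma one_le_Linfty_norm {n : ℕ} {v : EuclideanSpace ℝ (Fin n) → ℝ}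
    {Ω : Set (EuclideanSpace ℝ (Fin n))} (hΩ : unitCube n ⊆ Ω)
    (hle : ∀ x, ‖v x‖ ≤ 1) (h1 : ∀ x ∈ unitCube n, v x = 1) :
    1 ≤ (eLpNorm v ⊤ (volume.restrict Ω)).toReal := by
  rw [eLpNorm_exponent_top]
  have hfin : eLpNormEssSup v (volume.restrict Ω) ≠ ⊤ :=
    ((eLpNormEssSup_le_of_ae_bound (ae_of_all _ hle)).trans_lt ENNReal.ofReal_lt_top).ne
  have hae : ∀ᵐ x ∂(volume.restrict (unitCube n)), ‖v x‖ₑ ≤ eLpNormEssSup v (volume.restrict Ω) :=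
    ae_restrict_of_ae_restrict_of_subset hΩ ae_le_eLpNormEssSup
  have : NeZero (volume.restrict (unitCube n)) := ⟨by simp [volume_unitCube]⟩
  obtain ⟨x, hx, hxQ⟩ := (hae.and (ae_restrict_mem measurableSet_unitCube)).exists
  rw [h1 x hxQ, enorm_one] at hx
  exact ENNReal.toReal_mono hfin hx

/-- Failure of the geometric Sobolev/Morrey inequalities for `r ∈ (0, 2/p - 1)`, `1 ≤ p < 2`
(Remark 3.3): there are smooth bounded domains `Ω_k` inside a fixed ball, all containing the
unit cube `Q₁`, and functions `v_k` vanishing on `∂Ω_k` with `v_k ≡ 1` on `Q₁` (hence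
`‖v_k‖_{L^q} ≥ 1` for all `1 ≤ q ≤ ∞`), while `∫_{Ω_k∩{|∇v_k|>0}} |H_{v_k}|^{pr}|∇v_k|^p → 0`;
in particular no constant `C` can make the inequality hold, for any `q ∈ [1,∞]`. -/
theorem stmt_18 (n : ℕ) (hn : 2 ≤ n) (p r : ℝ) (hp1 : 1 ≤ p) (hp2 : p < 2)
    (hr0 : 0 < r) (hr : r < 2 / p - 1) :
    ∃ (c : EuclideanSpace ℝ (Fin n)) (R : ℝ), 0 < R ∧
      ∃ (Ωs : ℕ → Set (EuclideanSpace ℝ (Fin n)))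
        (vs : ℕ → EuclideanSpace ℝ (Fin n) → ℝ),
        (∀ k, IsOpen (Ωs k) ∧ IsBounded (Ωs k) ∧ Ωs k ⊆ Metric.ball c R ∧
          unitCube n ⊆ Ωs k) ∧
        (∀ k, ContDiff ℝ (⊤ : ℕ∞) (vs k) ∧ (∀ x ∈ frontier (Ωs k), vs k x = 0) ∧
          (∀ x ∈ unitCube n, vs k x = 1)) ∧
        -- so the `L^q` norms are bounded below by `1` for every `q ∈ [1,∞)` and for `q = ∞`
        (∀ k, ∀ q : ℝ, 1 ≤ q →
          1 ≤ (∫ x in Ωs k, |vs k x| ^ q) ^ (1 / q)) ∧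
        (∀ k, 1 ≤ (eLpNorm (vs k) ⊤ (volume.restrict (Ωs k))).toReal) ∧
        -- while the right-hand sides tend to zero
        Tendsto (fun k => ∫ x in Ωs k ∩ {x | gradient (vs k) x ≠ 0},
            |meanCurv (vs k) x| ^ (p * r) * ‖gradient (vs k) x‖ ^ p) atTop (𝓝 0) ∧
        -- in particular, no constant `C` makes the inequality hold, for any `q ∈ [1,∞]`
        (∀ C : ℝ,
          (∀ q : ℝ, 1 ≤ q → ∃ k,
            C * (∫ x in Ωs k ∩ {x | gradient (vs k) x ≠ 0},
                |meanCurv (vs k) x| ^ (p * r) * ‖gradient (vs k) x‖ ^ p) ^ (1 / p) <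
              (∫ x in Ωs k, |vs k x| ^ q) ^ (1 / q)) ∧
          (∃ k,
            C * (∫ x in Ωs k ∩ {x | gradient (vs k) x ≠ 0},
                |meanCurv (vs k) x| ^ (p * r) * ‖gradient (vs k) x‖ ^ p) ^ (1 / p) <
              (eLpNorm (vs k) ⊤ (volume.restrict (Ωs k))).toReal)) := by
  obtain ⟨M, hM, hcut⟩ := exists_isCutoff
  have hε : ∀ k : ℕ, (0 : ℝ) < 1 / ((k : ℝ) + 1) := fun k => by positivity
  have hε1 : ∀ k : ℕ, 1 / ((k : ℝ) + 1) ≤ 1 := fun k => by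
    rw [div_le_one (by positivity)]
    linarith [(k.cast_nonneg : (0 : ℝ) ≤ k)]
  choose φ φ' φ'' h using fun k : ℕ => hcut _ (hε k)
  set R : ℝ := 2 * n + 1
  have hR : 0 < R := by positivity
  have hp0 : 0 < p := by linarith
  have hpr : p + p * r < 2 := by
    have h1 : p * r < p * (2 / p - 1) := mul_lt_mul_of_pos_left hr hp0
    have h2 : p * (2 / p - 1) = 2 - p := by field_simp
    linarith
  have hr1 : r < 1 := by nlinarith
  set v : ℕ → EuclideanSpace ℝ (Fin n) → ℝ := fun k y => ∏ i, φ k (y i) with hv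
  set Ω := Metric.ball (0 : EuclideanSpace ℝ (Fin n)) R
  have hQΩ : unitCube n ⊆ Ω := unitCube_subset_ball
  have hv1 : ∀ k, ∀ x ∈ unitCube n, v k x = 1 := fun k x hx =>
    Finset.prod_eq_one fun i _ => (h k).eq_one _ (hx i).1.le (hx i).2.le
  have hvs : ∀ k, ContDiff ℝ (⊤ : ℕ∞) (v k) := fun k =>
    contDiff_prod fun i _ => (h k).contDiff.comp (by fun_prop)
  have hvle : ∀ k x, ‖v k x‖ ≤ 1 := fun k x => by
    rw [Real.norm_eq_abs, hv, Finset.abs_prod]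
    exact Finset.prod_le_one (fun _ _ => abs_nonneg _) fun i _ => (h k).abs_le _
  have hv0 : ∀ k, ∀ x ∈ frontier Ω, v k x = 0 := fun k x hx => by
    have hxR : ‖x‖ = R := mem_sphere_zero_iff_norm.1 (Metric.frontier_ball_subset_sphere hx)
    obtain ⟨i, hi⟩ : ∃ i, 2 < |x i| := by
      by_contra! hc
      have : ‖x‖ ≤ ∑ _i : Fin n, (2 : ℝ) :=
        (EuclideanSpace.norm_le_sum_abs x).trans (Finset.sum_le_sum fun i _ => hc i)
      simp only [Finset.sum_const, Finset.card_univ, Fintype.card_fin, nsmul_eq_mul] at this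
      linarith
    refine Finset.prod_eq_zero (Finset.mem_univ i) ?_
    rcases lt_abs.1 hi with hi | hi
    · exact (h k).eq_zero_right _ (by linarith [hε1 k])
    · exact (h k).eq_zero_left _ (by linarith [hε1 k])
  have hLq : ∀ k, ∀ q : ℝ, 1 ≤ q → 1 ≤ (∫ x in Ω, |v k x| ^ q) ^ (1 / q) := fun k q hq =>
    one_le_Lq_norm (hvs k).continuous (hvle k) (hv1 k) hq
  have hLtop : ∀ k, 1 ≤ (eLpNorm (v k) ⊤ (volume.restrict Ω)).toReal := fun k =>
    one_le_Linfty_norm hQΩ (hvle k) (hv1 k)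
  have hlim : Tendsto (fun k => ∫ x in Ω ∩ {x | gradient (v k) x ≠ 0},
      |meanCurv (v k) x| ^ (p * r) * ‖gradient (v k) x‖ ^ p) atTop (𝓝 0) := by
    set C : ℝ := (2 * n ^ 3) ^ (p * r) * n ^ (p - p * r) * M ^ (p + p * r) *
      (n ^ 2 * (2 ^ 2 * (2 * R) ^ (n - 2)))
    have hb : Tendsto (fun k : ℕ => C * ((k : ℝ) + 1) ^ (-(2 - (p + p * r)))) atTop (𝓝 0) := by
      have h1 := (tendsto_rpow_neg_atTop (y := 2 - (p + p * r)) (by linarith)).comp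
        (tendsto_atTop_add_const_right _ (1 : ℝ) tendsto_natCast_atTop_atTop)
      simpa using h1.const_mul C
    refine squeeze_zero_norm (fun k => ?_) hb
    refine ((h k).abs_integral_le (hε k).le hn hp0 hr0 hr1 hR.le).trans_eq ?_
    have hk : (0 : ℝ) < (k : ℝ) + 1 := by positivity
    rw [show M / (1 / ((k : ℝ) + 1)) = M * ((k : ℝ) + 1) by field_simp,
      Real.mul_rpow hM.le hk.le, show -(2 - (p + p * r)) = (p + p * r) - 2 by ring,
      Real.rpow_sub hk, Real.rpow_two]
    simp only [C]
    field_simp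
  have hex : ∀ C : ℝ, ∃ k, C * (∫ x in Ω ∩ {x | gradient (v k) x ≠ 0},
      |meanCurv (v k) x| ^ (p * r) * ‖gradient (v k) x‖ ^ p) ^ (1 / p) < 1 := fun C => by
    have h1 := (hlim.rpow_const (p := 1 / p) (Or.inr (by positivity))).const_mul C
    rw [Real.zero_rpow (by positivity), mul_zero] at h1
    exact (h1.eventually_lt_const one_pos).exists
  refine ⟨0, R, hR, fun _ => Ω, v,
    fun _ => ⟨Metric.isOpen_ball, Metric.isBounded_ball, subset_rfl, hQΩ⟩,
    fun k => ⟨hvs k, hv0 k, hv1 k⟩, hLq, hLtop, hlim, fun C => ?_⟩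
  obtain ⟨k, hk⟩ := hex C
  exact ⟨fun q hq => ⟨k, hk.trans_le (hLq k q hq)⟩, k, hk.trans_le (hLtop k)⟩
end
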